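/- arXiv:1406.0766 — 3 statements merged into one kernel-verified Lean document; each statement's English description precedes it below -/
import Mathlib

section
/- Let d ≥ 1 and n ≥ 1 be integers and let G be a d-regular bipartite simple graph on 2n vertices. Then the number of perfect matchings of G satisfies pm(G) ≥ ((d−1)^{d−1}/d^{d−2})^n (with the convention 0^0 = 1). -/
/-- The number of `k`-matchings of a simple graph `G`: the number of sets of `k`
pairwise disjoint edges of `G`. -/
noncomputable def matchCount {V : Type*} (G : SimpleGraph V) (k : ℕ) : ℕ :=
  Nat.card {s : Finset (Sym2 V) // ↑s ⊆ G.edgeSet ∧ s.card = k ∧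
    ∀ e ∈ s, ∀ f ∈ s, e ≠ f → ∀ v : V, v ∈ e → v ∉ f}

open MvPolynomial in
theorem MvPolynomial.IsHomogeneous.aeval_smul_eq {σ R K : Type*} [CommSemiring R] [CommSemiring K]
    [Algebra R K] {p : MvPolynomial σ R} {m : ℕ} (hp : p.IsHomogeneous m) (s : K) (z : σ → K) :
    MvPolynomial.aeval (s • z) p = s ^ m * MvPolynomial.aeval z p := by
  rw [aeval_def, aeval_def, eval₂_eq, eval₂_eq, Finset.mul_sum]
  refine Finset.sum_congr rfl fun e he => ?_
  have hdeg : ∑ i ∈ e.support, e i = m := by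
    rw [← hp (mem_support_iff.mp he)]
    simp [Finsupp.weight_apply, Finsupp.sum]
  simp only [Pi.smul_apply, smul_eq_mul, mul_pow, Finset.prod_mul_distrib]
  rw [Finset.prod_pow_eq_pow_sum, hdeg]
  ring

/-- The restriction `p (a + X b)` of a real multivariate polynomial to a line. -/
noncomputable def linePoly {σ K : Type*} [CommRing K] [Algebra ℝ K] (p : MvPolynomial σ ℝ)
    (a b : σ → K) : Polynomial K :=
  MvPolynomial.aeval (fun i => Polynomial.C (a i) + Polynomial.C (b i) * Polynomial.X) p

section LinePoly

variable {σ K : Type*} [CommRing K] [Algebra ℝ K]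

theorem eval_linePoly (p : MvPolynomial σ ℝ) (a b : σ → K) (t : K) :
    (linePoly p a b).eval t = MvPolynomial.aeval (a + t • b) p := by
  rw [linePoly, ← Polynomial.coe_evalRingHom, MvPolynomial.map_aeval, MvPolynomial.aeval_def,
    MvPolynomial.coe_eval₂Hom]
  congr 1
  · ext r
    simp [Polynomial.algebraMap_apply]
  · ext i
    simp only [Polynomial.coe_evalRingHom, Polynomial.eval_add, Polynomial.eval_C,
      Polynomial.eval_mul, Polynomial.eval_X, Pi.add_apply, Pi.smul_apply, smul_eq_mul, mul_comm]

theorem derivative_linePoly [Fintype σ] (p : MvPolynomial σ ℝ) (a b : σ → K) :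
    Polynomial.derivative (linePoly p a b)
      = ∑ i, linePoly (MvPolynomial.pderiv i p) a b * Polynomial.C (b i) := by
  classical
  simp only [linePoly]
  induction p using MvPolynomial.induction_on with
  | C r => simp [Polynomial.algebraMap_apply]
  | add p q hp hq => simp [hp, hq, Finset.sum_add_distrib, add_mul]
  | mul_X p j hp =>
    simp only [map_mul, MvPolynomial.aeval_X, Polynomial.derivative_mul, hp,
      MvPolynomial.pderiv_mul, map_add, add_mul, Finset.sum_add_distrib]
    congr 1
    · rw [Finset.sum_mul]
      exact Finset.sum_congr rfl fun i _ => by ring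
    · rw [Finset.sum_eq_single j]
      · simp
      · intro i _ hij
        simp [MvPolynomial.pderiv_X_of_ne hij.symm]
      · simp

theorem natDegree_linePoly_single_le [DecidableEq σ] (p : MvPolynomial σ ℝ)
    (a : σ → K) (j : σ) :
    (linePoly p a (Pi.single j 1)).natDegree ≤ p.degreeOf j := by
  rw [linePoly, MvPolynomial.aeval_def, MvPolynomial.eval₂_eq]
  refine Polynomial.natDegree_sum_le_of_forall_le _ _ fun e he => ?_
  rw [Polynomial.algebraMap_apply]
  refine (Polynomial.natDegree_C_mul_le _ _).trans ((Polynomial.natDegree_prod_le _ _).trans ?_)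
  refine le_trans ?_ (MvPolynomial.degreeOf_le_iff.mp le_rfl e he)
  have hle : ∀ i ∈ e.support, ((Polynomial.C (a i)
      + Polynomial.C ((Pi.single j 1 : σ → K) i) * Polynomial.X) ^ e i).natDegree
      ≤ if i = j then e j else 0 := by
    intro i _
    split_ifs with hij
    · subst hij
      refine Polynomial.natDegree_pow_le.trans ?_
      have : (Polynomial.C (a i)
        + Polynomial.C ((Pi.single i 1 : σ → K) i) * Polynomial.X).natDegree ≤ 1 := by
        compute_degree
      simpa using Nat.mul_le_mul_left (e i) this
    · rw [Pi.single_eq_of_ne hij, map_zero, zero_mul, add_zero, ← Polynomial.C_pow,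
        Polynomial.natDegree_C]
  refine (Finset.sum_le_sum hle).trans ?_
  rw [Finset.sum_ite_eq']
  split_ifs <;> simp

theorem map_linePoly (p : MvPolynomial σ ℝ) (a b : σ → ℝ) :
    (linePoly p a b).map (algebraMap ℝ K)
      = linePoly p (fun i => algebraMap ℝ K (a i)) (fun i => algebraMap ℝ K (b i)) := by
  rw [linePoly, linePoly, ← Polynomial.coe_mapRingHom, MvPolynomial.map_aeval,
    MvPolynomial.aeval_def, MvPolynomial.coe_eval₂Hom]
  congr 1
  · ext r
    simp [Polynomial.algebraMap_apply]
  · ext i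
    simp

end LinePoly

/-- A real polynomial all of whose coefficients are nonnegative. -/
def NonnegCoeffs {σ : Type*} (p : MvPolynomial σ ℝ) : Prop := ∀ e, 0 ≤ p.coeff e

namespace NonnegCoeffs

variable {σ : Type*} {p q : MvPolynomial σ ℝ}

theorem mul (hp : NonnegCoeffs p) (hq : NonnegCoeffs q) : NonnegCoeffs (p * q) := by
  classical
  intro e
  rw [MvPolynomial.coeff_mul]
  exact Finset.sum_nonneg fun x _ => mul_nonneg (hp _) (hq _)

theorem sum {ι : Type*} {s : Finset ι} {f : ι → MvPolynomial σ ℝ}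
    (hf : ∀ i ∈ s, NonnegCoeffs (f i)) : NonnegCoeffs (∑ i ∈ s, f i) := fun e => by
  rw [MvPolynomial.coeff_sum]
  exact Finset.sum_nonneg fun i hi => hf i hi e

theorem C {r : ℝ} (hr : 0 ≤ r) : NonnegCoeffs (MvPolynomial.C r : MvPolynomial σ ℝ) := by
  classical
  intro e
  rw [MvPolynomial.coeff_C]
  split_ifs <;> simp [hr]

theorem X (i : σ) : NonnegCoeffs (MvPolynomial.X i : MvPolynomial σ ℝ) := by
  classical
  intro e
  rw [MvPolynomial.coeff_X]
  split_ifs <;> simp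

theorem prod {ι : Type*} {s : Finset ι} {f : ι → MvPolynomial σ ℝ}
    (hf : ∀ i ∈ s, NonnegCoeffs (f i)) : NonnegCoeffs (∏ i ∈ s, f i) :=
  Finset.prod_induction f NonnegCoeffs (fun _ _ => mul)
    (by simpa using C (σ := σ) zero_le_one) hf

theorem pderiv (hp : NonnegCoeffs p) (j : σ) : NonnegCoeffs (MvPolynomial.pderiv j p) := by
  intro e
  rw [MvPolynomial.coeff_pderiv]
  exact mul_nonneg (hp _) (by positivity)

theorem eval_mono (hp : NonnegCoeffs p) {x y : σ → ℝ} (hx : ∀ i, 0 ≤ x i) (hxy : ∀ i, x i ≤ y i) :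
    MvPolynomial.eval x p ≤ MvPolynomial.eval y p := by
  rw [MvPolynomial.eval_eq, MvPolynomial.eval_eq]
  refine Finset.sum_le_sum fun e _ => mul_le_mul_of_nonneg_left ?_ (hp e)
  exact Finset.prod_le_prod (fun i _ => pow_nonneg (hx i) _)
    fun i _ => pow_le_pow_left₀ (hx i) (hxy i) _

theorem eval_pos (hp : NonnegCoeffs p) (h0 : p ≠ 0) {x : σ → ℝ} (hx : ∀ i, 0 < x i) :
    0 < MvPolynomial.eval x p := by
  rw [MvPolynomial.eval_eq]
  refine Finset.sum_pos (fun e he => ?_) (MvPolynomial.support_nonempty.mpr h0)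
  exact mul_pos ((hp e).lt_of_ne' (MvPolynomial.mem_support_iff.mp he))
    (Finset.prod_pos fun i _ => pow_pos (hx i) _)

end NonnegCoeffs

theorem MvPolynomial.aeval_ofReal {σ : Type*} (p : MvPolynomial σ ℝ) (x : σ → ℝ) :
    aeval (fun i => (x i : ℂ)) p = ((eval x p : ℝ) : ℂ) := by
  rw [show (fun i => (x i : ℂ)) = algebraMap ℝ ℂ ∘ x from rfl,
    aeval_algebraMap_apply]
  simp [aeval_eq_eval]

/-- The bound `p (Re z) ≤ ‖p z‖` on the closed right half-plane, which for homogeneous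
polynomials with nonnegative coefficients is equivalent to stability. -/
def HalfPlaneBound {σ : Type*} (p : MvPolynomial σ ℝ) : Prop :=
  ∀ z : σ → ℂ, (∀ i, 0 ≤ (z i).re) →
    MvPolynomial.eval (fun i => (z i).re) p ≤ ‖MvPolynomial.aeval z p‖

section HalfPlane

variable {σ : Type*} {p : MvPolynomial σ ℝ} {m : ℕ}

theorem eval_re_le_norm_aeval_of_stable (hp : p.IsHomogeneous m)
    (hst : ∀ z : σ → ℂ, (∀ i, 0 < (z i).re) → MvPolynomial.aeval z p ≠ 0)
    {z : σ → ℂ} (hz : ∀ i, 0 < (z i).re) :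
    |MvPolynomial.eval (fun i => (z i).re) p| ≤ ‖MvPolynomial.aeval z p‖ := by
  set a : σ → ℂ := fun i => ((z i).re : ℂ) with ha
  set b : σ → ℂ := fun i => Complex.I * ((z i).im : ℂ) with hb
  set g := linePoly p a b with hg
  have hg0 : g.eval 0 = ((MvPolynomial.eval (fun i => (z i).re) p : ℝ) : ℂ) := by
    rw [hg, eval_linePoly, zero_smul, add_zero, ha,
      MvPolynomial.aeval_ofReal p fun i => (z i).re]
  have hg1 : g.eval 1 = MvPolynomial.aeval z p := by
    rw [hg, eval_linePoly, one_smul]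
    congr 2
    ext i
    simp [ha, hb, mul_comm Complex.I, Complex.re_add_im]
  have hroot : ∀ r ∈ g.roots, r.re = 0 := by
    intro r hr
    have hr0 : MvPolynomial.aeval (a + r • b) p = 0 := by
      rw [← eval_linePoly]
      exact Polynomial.isRoot_of_mem_roots hr
    have hrne : r ≠ 0 := by
      rintro rfl
      rw [zero_smul, add_zero] at hr0
      exact hst a (fun i => by simpa [ha] using hz i) hr0
    have hscale : ∀ s : ℂ, MvPolynomial.aeval (s • (a + r • b)) p = 0 := fun s => by
      rw [hp.aeval_smul_eq, hr0, mul_zero]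
    have hre : ∀ (u : ℝ) (i : σ), (((u : ℂ) * r⁻¹) • (a + r • b)) i
        = ((u : ℂ) * r⁻¹) * ((z i).re : ℂ) + u * (Complex.I * ((z i).im : ℂ)) := by
      intro u i
      simp only [Pi.smul_apply, Pi.add_apply, smul_eq_mul, ha, hb]
      field_simp
    have hinv : r⁻¹.re = 0 := by
      by_contra hne
      refine hst _ (fun i => ?_) (hscale (((r⁻¹.re : ℝ) : ℂ) * r⁻¹))
      rw [hre]
      have : 0 < r⁻¹.re * r⁻¹.re * (z i).re := mul_pos (mul_self_pos.mpr hne) (hz i)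
      simpa [-Complex.inv_re, -Complex.inv_im] using this
    rw [Complex.inv_re, div_eq_zero_iff] at hinv
    exact hinv.resolve_right fun h => hrne (Complex.normSq_eq_zero.mp h)
  rw [← Real.norm_eq_abs, ← Complex.norm_real, ← hg0, ← hg1]
  have hspl : g.Splits := IsAlgClosed.splits g
  rw [hspl.eval_eq_prod_roots, hspl.eval_eq_prod_roots, norm_mul, norm_mul]
  refine mul_le_mul_of_nonneg_left ?_ (norm_nonneg _)
  have hnorm : ∀ s : Multiset ℂ, ‖s.prod‖ = (s.map fun w => ‖w‖).prod := fun s =>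
    map_multiset_prod (normHom : ℂ →*₀ ℝ) s
  rw [hnorm, hnorm, Multiset.map_map, Multiset.map_map]
  refine Multiset.prod_map_le_prod_map₀ _ _ (fun r _ => norm_nonneg _) fun r hr => ?_
  simp only [Function.comp, zero_sub, norm_neg]
  have h1 := Complex.abs_im_le_norm (1 - r)
  have h2 : r = r.im * Complex.I := by
    apply Complex.ext <;> simp [hroot r hr]
  calc ‖r‖ = |r.im| := by rw [h2]; simp
    _ ≤ ‖1 - r‖ := by simpa using h1

theorem continuous_aeval_complex (p : MvPolynomial σ ℝ) :
    Continuous fun z : σ → ℂ => MvPolynomial.aeval z p := by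
  have h : (fun z : σ → ℂ => MvPolynomial.aeval z p)
      = fun z => MvPolynomial.eval z (p.map (algebraMap ℝ ℂ)) := by
    ext z
    rw [MvPolynomial.eval_map, MvPolynomial.aeval_def]
  rw [h]
  exact MvPolynomial.continuous_eval _

theorem HalfPlaneBound.aeval_ne_zero (h : HalfPlaneBound p) (hnn : NonnegCoeffs p) (h0 : p ≠ 0)
    {z : σ → ℂ} (hz : ∀ i, 0 < (z i).re) : MvPolynomial.aeval z p ≠ 0 :=
  norm_pos_iff.mp ((hnn.eval_pos h0 hz).trans_le (h z fun i => (hz i).le))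

theorem HalfPlaneBound.degree_linePoly_pos (h : HalfPlaneBound p) (hnn : NonnegCoeffs p)
    (h0 : p ≠ 0) (hp : p.IsHomogeneous m) (hm : 1 ≤ m) {z : σ → ℂ} (hz : ∀ i, 0 < (z i).re)
    {c : σ → ℝ} (hc : ∀ i, 0 < c i) : 0 < (linePoly p z fun i => (c i : ℂ)).degree := by
  by_contra hdeg
  obtain ⟨k, hk⟩ : ∃ k, linePoly p z (fun i => (c i : ℂ)) = Polynomial.C k :=
    ⟨_, Polynomial.eq_C_of_degree_le_zero (not_lt.mp hdeg)⟩
  have hpos := hnn.eval_pos h0 hc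
  set t : ℝ := 1 + ‖k‖ / MvPolynomial.eval c p with ht
  have ht1 : 1 ≤ t := by
    have : 0 ≤ ‖k‖ / MvPolynomial.eval c p := by positivity
    linarith
  have hval : MvPolynomial.aeval (z + (t : ℂ) • fun i => (c i : ℂ)) p = k := by
    rw [← eval_linePoly, hk, Polynomial.eval_C]
  have hle := h (z + (t : ℂ) • fun i => (c i : ℂ)) fun i => by
    have := hz i
    have := hc i
    simp only [Pi.add_apply, Pi.smul_apply, smul_eq_mul, Complex.add_re, Complex.re_ofReal_mul,
      Complex.ofReal_re]
    positivity
  rw [hval] at hle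
  have hmono : MvPolynomial.eval (t • c) p ≤
      MvPolynomial.eval (fun i => ((z + (t : ℂ) • fun i => (c i : ℂ)) i).re) p := by
    refine hnn.eval_mono (fun i => ?_) fun i => ?_
    · have := hc i
      simp only [Pi.smul_apply, smul_eq_mul]
      positivity
    · simp [(hz i).le]
  have hsm : MvPolynomial.eval (t • c) p = t ^ m * MvPolynomial.eval c p := by
    simpa [MvPolynomial.aeval_eq_eval] using hp.aeval_smul_eq t c
  have htm : t ≤ t ^ m := le_self_pow₀ ht1 (by omega)
  have : t * MvPolynomial.eval c p = MvPolynomial.eval c p + ‖k‖ := by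
    rw [ht]
    field_simp
  nlinarith

theorem HalfPlaneBound.directional_derivative_ne_zero [Fintype σ] (h : HalfPlaneBound p)
    (hnn : NonnegCoeffs p) (h0 : p ≠ 0) (hp : p.IsHomogeneous m) (hm : 1 ≤ m)
    {z : σ → ℂ} (hz : ∀ i, 0 < (z i).re) {c : σ → ℝ} (hc : ∀ i, 0 < c i) :
    ∑ i, MvPolynomial.aeval z (MvPolynomial.pderiv i p) * (c i : ℂ) ≠ 0 := by
  set f := linePoly p z fun i => (c i : ℂ) with hf
  have hder : (Polynomial.derivative f).eval 0
      = ∑ i, MvPolynomial.aeval z (MvPolynomial.pderiv i p) * (c i : ℂ) := by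
    simp [hf, derivative_linePoly, Polynomial.eval_finsetSum, eval_linePoly]
  rw [← hder]
  intro hzero
  have hdeg : 0 < f.degree := h.degree_linePoly_pos hnn h0 hp hm hz hc
  have hdne : Polynomial.derivative f ≠ 0 := by
    intro hd
    have := Polynomial.derivative_eq_zero.mp hd
    exact (Polynomial.natDegree_pos_iff_degree_pos.mpr hdeg).ne' this
  have hmem : (0 : ℂ) ∈ convexHull ℝ (f.rootSet ℂ) :=
    Polynomial.rootSet_derivative_subset_convexHull_rootSet hdeg
      (Polynomial.mem_rootSet.mpr ⟨hdne, by simpa using hzero⟩)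
  have hsub : f.rootSet ℂ ⊆ {w : ℂ | w.re < 0} := by
    intro w hw
    by_contra hre
    have hre' : 0 ≤ w.re := not_lt.mp hre
    have hw0 := (Polynomial.mem_rootSet.mp hw).2
    rw [Polynomial.coe_aeval_eq_eval, hf, eval_linePoly] at hw0
    refine h.aeval_ne_zero hnn h0 (fun i => ?_) hw0
    have := hz i
    have := hc i
    simp only [Pi.add_apply, Pi.smul_apply, smul_eq_mul, Complex.add_re, Complex.re_mul_ofReal]
    positivity
  have := convexHull_min hsub (convex_halfSpace_re_lt 0) hmem
  simp at this

theorem HalfPlaneBound.pderiv [Fintype σ] (h : HalfPlaneBound p) (hnn : NonnegCoeffs p)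
    (hp : p.IsHomogeneous m) (hm : 1 ≤ m) (j : σ) :
    HalfPlaneBound (MvPolynomial.pderiv j p) := by
  classical
  intro z hz
  rcases eq_or_ne p 0 with rfl | h0
  · simp
  let q : ℝ → MvPolynomial σ ℝ := fun ε =>
    ∑ i, MvPolynomial.C (((Pi.single j 1 : σ → ℝ) i) + ε) * MvPolynomial.pderiv i p
  let w : ℝ → σ → ℂ := fun ε i => z i + ε
  have hqhom : ∀ ε, (q ε).IsHomogeneous (m - 1) := fun ε =>
    MvPolynomial.IsHomogeneous.sum _ _ _ fun i _ => by
      have := (MvPolynomial.isHomogeneous_C σ ((Pi.single j 1 : σ → ℝ) i + ε)).mul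
        (hp.pderiv (i := i))
      rwa [zero_add] at this
  have hae : ∀ ε (y : σ → ℂ), MvPolynomial.aeval y (q ε) = ∑ i,
      MvPolynomial.aeval y (MvPolynomial.pderiv i p)
        * ((((Pi.single j 1 : σ → ℝ) i) + ε : ℝ) : ℂ) := by
    intro ε y
    simp [q, mul_comm]
  have hev : ∀ ε (y : σ → ℝ), MvPolynomial.eval y (q ε) = ∑ i,
      MvPolynomial.eval y (MvPolynomial.pderiv i p) * (((Pi.single j 1 : σ → ℝ) i) + ε) := by
    intro ε y
    simp [q, mul_comm]
  have hbound : ∀ ε > 0, MvPolynomial.eval (fun i => (w ε i).re) (q ε)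
      ≤ ‖MvPolynomial.aeval (w ε) (q ε)‖ := by
    intro ε hε
    refine (le_abs_self _).trans (eval_re_le_norm_aeval_of_stable (hqhom ε) ?_ ?_)
    · intro y hy
      rw [hae]
      refine h.directional_derivative_ne_zero hnn h0 hp hm hy fun i => ?_
      have : (0 : ℝ) ≤ (Pi.single j 1 : σ → ℝ) i := by
        rw [Pi.single_apply]; split_ifs <;> simp
      positivity
    · intro i
      have := hz i
      simp only [w, Complex.add_re, Complex.ofReal_re]
      positivity
  have hw : Continuous w := by fun_prop
  have hc1 : Continuous fun ε => MvPolynomial.eval (fun i => (w ε i).re) (q ε) := by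
    simp only [hev]
    refine continuous_finsetSum _ fun i _ => Continuous.mul ?_ (by fun_prop)
    exact (MvPolynomial.continuous_eval _).comp (by fun_prop)
  have hc2 : Continuous fun ε => ‖MvPolynomial.aeval (w ε) (q ε)‖ := by
    simp only [hae]
    refine (continuous_finsetSum _ fun i _ => Continuous.mul ?_ (by fun_prop)).norm
    exact (continuous_aeval_complex _).comp hw
  have hlim := le_of_tendsto_of_tendsto (b := nhdsWithin (0 : ℝ) (Set.Ioi 0))
    ((hc1.tendsto 0).mono_left nhdsWithin_le_nhds) ((hc2.tendsto 0).mono_left nhdsWithin_le_nhds)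
    (by filter_upwards [self_mem_nhdsWithin] with ε hε using hbound ε hε)
  have hq0 : q 0 = MvPolynomial.pderiv j p := by
    simp only [q, add_zero]
    rw [Finset.sum_eq_single j]
    · simp
    · intro i _ hij
      simp [Pi.single_eq_of_ne hij]
    · simp
  simpa [hq0, w] using hlim

end HalfPlane

theorem Multiset.prod_one_add_le_pow {s : Multiset ℝ} (hs : ∀ b ∈ s, 0 ≤ b) {k : ℕ} (hk : 1 ≤ k)
    (hcard : s.card ≤ k) : (s.map fun b => 1 + b).prod ≤ (1 + s.sum / k) ^ k := by
  have hk0 : (0 : ℝ) < k := by exact_mod_cast hk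
  set M : ℝ := 1 + s.sum / k with hM
  have hsum : 0 ≤ s.sum := Multiset.sum_nonneg hs
  have hMpos : 0 < M := by positivity
  have key : ∀ u : Multiset ℝ, (∀ b ∈ u, 0 ≤ b) →
      (u.map fun b => 1 + b).prod
        ≤ M ^ u.card * Real.exp ((u.card + u.sum) / M - u.card) := by
    intro u
    induction u using Multiset.induction_on with
    | empty => simp
    | cons b u ih =>
      intro hu
      have hb : 0 ≤ b := hu b (Multiset.mem_cons_self b u)
      have ih' := ih fun c hc => hu c (Multiset.mem_cons_of_mem hc)
      have h1 : 1 + b ≤ M * Real.exp ((1 + b) / M - 1) := by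
        have := Real.add_one_le_exp ((1 + b) / M - 1)
        rw [sub_add_cancel, div_le_iff₀ hMpos] at this
        linarith
      rw [Multiset.map_cons, Multiset.prod_cons, Multiset.card_cons, Multiset.sum_cons]
      have hexp : Real.exp (((u.card + 1 : ℕ) + (b + u.sum)) / M - (u.card + 1 : ℕ))
          = Real.exp ((1 + b) / M - 1) * Real.exp ((u.card + u.sum) / M - u.card) := by
        rw [← Real.exp_add]
        congr 1
        push_cast
        ring
      rw [hexp, pow_succ]
      have h0 : 0 ≤ (u.map fun b => 1 + b).prod := by
        refine Multiset.prod_nonneg fun x hx => ?_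
        obtain ⟨c, hc, rfl⟩ := Multiset.mem_map.mp hx
        have := hu c (Multiset.mem_cons_of_mem hc)
        positivity
      calc (1 + b) * (u.map fun b => 1 + b).prod
          ≤ (M * Real.exp ((1 + b) / M - 1))
            * (M ^ u.card * Real.exp ((u.card + u.sum) / M - u.card)) := by gcongr
        _ = _ := by ring
  refine (key s hs).trans ?_
  obtain ⟨l, hl⟩ := Nat.exists_eq_add_of_le hcard
  have hS : s.sum = (s.card + l) * (M - 1) := by
    have hkl : (k : ℝ) = s.card + l := by exact_mod_cast hl
    rw [← hkl, hM]
    field_simp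
    ring
  have hexp : (s.card + s.sum) / M - s.card = l * (1 - M⁻¹) := by
    rw [hS]
    field_simp
    ring
  have hone : Real.exp (1 - M⁻¹) ≤ M := by
    have := Real.add_one_le_exp (M⁻¹ - 1)
    rw [sub_add_cancel, ← neg_sub, Real.exp_neg] at this
    exact (inv_le_inv₀ hMpos (Real.exp_pos _)).mp this
  rw [hexp, Real.exp_nat_mul]
  calc M ^ s.card * Real.exp (1 - M⁻¹) ^ l ≤ M ^ s.card * M ^ l := by gcongr
    _ = M ^ k := by rw [← pow_add, ← hl]

/-- The factor lost in each differentiation step of Gurvits' capacity argument. -/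
noncomputable def capacityFactor (k : ℕ) : ℝ := (((k : ℝ) - 1) / k) ^ (k - 1)

theorem capacityFactor_pos {k : ℕ} (hk : 1 ≤ k) : 0 < capacityFactor k := by
  rcases hk.eq_or_lt with rfl | hk2
  · simp [capacityFactor]
  · have : (1 : ℝ) < k := by exact_mod_cast hk2
    exact pow_pos (div_pos (by linarith) (by linarith)) _

theorem capacityFactor_le_one {k : ℕ} (hk : 1 ≤ k) : capacityFactor k ≤ 1 := by
  have : (1 : ℝ) ≤ k := by exact_mod_cast hk
  exact pow_le_one₀ (div_nonneg (by linarith) (by linarith))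
    ((div_le_one (by linarith)).mpr (by linarith))

theorem le_slope_of_forall_le {a b c : ℝ} (h : ∀ t > 0, c * t ≤ a + b * t) : c ≤ b := by
  by_contra! hlt
  have h1 := h ((|a| + 1) / (c - b)) (div_pos (by positivity) (by linarith))
  have h2 : (c - b) * ((|a| + 1) / (c - b)) = |a| + 1 := by
    field_simp [(sub_pos.mpr hlt).ne']
  have := le_abs_self a
  nlinarith

theorem Polynomial.le_eval_zero_of_forall_pos {f : Polynomial ℝ} {c : ℝ}
    (h : ∀ t > 0, c ≤ f.eval t) : c ≤ f.eval 0 := by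
  refine ge_of_tendsto ((f.continuous.tendsto 0).mono_left
    (nhdsWithin_le_nhds (s := Set.Ioi (0 : ℝ)))) ?_
  filter_upwards [self_mem_nhdsWithin] with t ht using h t ht

/-- Gurvits' inequality for a real-rooted polynomial in one variable. -/
theorem Polynomial.Splits.mul_capacityFactor_le_derivative {f : Polynomial ℝ} (hf : f.Splits)
    {k : ℕ} (hk : 1 ≤ k) (hdeg : f.natDegree ≤ k) {c : ℝ} (hc : 0 < c)
    (h : ∀ t > 0, c * t ≤ f.eval t) :
    c * capacityFactor k ≤ f.derivative.eval 0 := by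
  rcases hk.eq_or_lt with rfl | hk2
  · rw [Polynomial.eq_X_add_C_of_natDegree_le_one hdeg] at h ⊢
    simp only [Polynomial.eval_add, Polynomial.eval_mul, Polynomial.eval_C,
      Polynomial.eval_X] at h
    have := le_slope_of_forall_le (a := f.coeff 0) (b := f.coeff 1) (c := c)
      fun t ht => by linarith [h t ht]
    simpa [capacityFactor] using this
  have hk1 : (1 : ℝ) < k := by exact_mod_cast hk2
  have hfpos : ∀ t > 0, 0 < f.eval t := fun t ht => (mul_pos hc ht).trans_le (h t ht)
  have hf0 : 0 ≤ f.eval 0 := Polynomial.le_eval_zero_of_forall_pos fun t ht => (hfpos t ht).le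
  rcases hf0.eq_or_lt with h0 | h0
  · obtain ⟨g, rfl⟩ : Polynomial.X ∣ f := by
      rw [Polynomial.X_dvd_iff, Polynomial.coeff_zero_eq_eval_zero, ← h0]
    have hg : c ≤ g.eval 0 := by
      refine Polynomial.le_eval_zero_of_forall_pos fun t ht => ?_
      have := h t ht
      rw [Polynomial.eval_mul, Polynomial.eval_X, mul_comm] at this
      exact le_of_mul_le_mul_left this ht
    have : c * capacityFactor k ≤ c := mul_le_of_le_one_right hc.le (capacityFactor_le_one hk)
    simpa using this.trans hg
  have hfne : f ≠ 0 := by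
    rintro rfl
    simp at h0
  have hneg : ∀ r ∈ f.roots, r < 0 := by
    intro r hr
    have hr0 : f.eval r = 0 := Polynomial.isRoot_of_mem_roots hr
    rcases lt_trichotomy r 0 with h1 | h1 | h1
    · exact h1
    · rw [h1] at hr0; exact absurd hr0 h0.ne'
    · exact absurd hr0 (hfpos r h1).ne'
  set S : ℝ := (f.roots.map fun r => 1 / (0 - r)).sum with hS
  have hder : f.derivative.eval 0 = f.eval 0 * S := hf.eval_derivative_eq_eval_mul_sum h0.ne'
  have hfac : ∀ t, f.eval t
      = f.eval 0 * ((f.roots.map fun r => t * (1 / (0 - r))).map fun b => 1 + b).prod := by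
    intro t
    rw [hf.eval_eq_prod_roots, hf.eval_eq_prod_roots, mul_assoc, Multiset.map_map,
      ← Multiset.prod_map_mul]
    congr 2
    refine Multiset.map_congr rfl fun r hr => ?_
    have := (hneg r hr).ne
    simp only [Function.comp, zero_sub]
    field_simp
    ring
  have hle : ∀ t > 0, f.eval t ≤ f.eval 0 * (1 + t * S / k) ^ k := by
    intro t ht
    rw [hfac t]
    refine mul_le_mul_of_nonneg_left ?_ h0.le
    have hsum : (f.roots.map fun r => t * (1 / (0 - r))).sum = t * S := by
      rw [hS, Multiset.sum_map_mul_left]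
    rw [← hsum]
    refine Multiset.prod_one_add_le_pow ?_ hk ?_
    · intro b hb
      obtain ⟨r, hr, rfl⟩ := Multiset.mem_map.mp hb
      have : 0 < 0 - r := by linarith [hneg r hr]
      positivity
    · rw [Multiset.card_map]
      exact (Polynomial.card_roots' f).trans hdeg
  have hS0 : 0 ≤ S := by
    refine Multiset.sum_nonneg fun b hb => ?_
    obtain ⟨r, hr, rfl⟩ := Multiset.mem_map.mp hb
    have : 0 < 0 - r := by linarith [hneg r hr]
    positivity
  have hSpos : 0 < S := by
    refine hS0.lt_of_ne fun hS00 => ?_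
    have := le_slope_of_forall_le (a := f.eval 0) (b := 0) (c := c) fun t ht => by
      simpa [← hS00] using (h t ht).trans (hle t ht)
    linarith
  have hk1' : 0 < (k : ℝ) - 1 := by linarith
  set t : ℝ := k / ((k - 1) * S) with ht
  have htpos : 0 < t := by positivity
  have hmain := (h t htpos).trans (hle t htpos)
  have hbase : 1 + t * S / k = ((k - 1) / k : ℝ)⁻¹ := by
    rw [ht]
    field_simp
    ring
  have hpos : 0 < ((k - 1) / k : ℝ) := by positivity
  rw [hbase, inv_pow, ← div_eq_mul_inv, le_div_iff₀ (by positivity)] at hmain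
  have hpow : ((k - 1) / k : ℝ) ^ k = capacityFactor k * ((k - 1) / k) := by
    rw [capacityFactor, ← pow_succ, Nat.sub_add_cancel hk]
  rw [hder]
  have heq : c * t * ((k - 1) / k : ℝ) ^ k * S = c * capacityFactor k := by
    rw [hpow, ht]
    field_simp
  rw [← heq]
  exact mul_le_mul_of_nonneg_right hmain hS0

section Capacity

variable {σ : Type*} {p : MvPolynomial σ ℝ} {m : ℕ}

theorem HalfPlaneBound.splits_linePoly_single [DecidableEq σ] (h : HalfPlaneBound p)
    (hp : p.IsHomogeneous m) {x : σ → ℝ} (hx : ∀ i, 0 ≤ x i) (j : σ)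
    (hpos : 0 < MvPolynomial.eval (x + Pi.single j 1) p) :
    (linePoly p x (Pi.single j 1)).Splits := by
  refine Polynomial.Splits.of_splits_map (algebraMap ℝ ℂ) (IsAlgClosed.splits _) fun r hr => ?_
  have hr0 := Polynomial.isRoot_of_mem_roots hr
  rw [Polynomial.IsRoot.def, map_linePoly, eval_linePoly] at hr0
  by_cases him : r.im = 0
  · exact ⟨r.re, Complex.ext (by simp) (by simp [him])⟩
  exfalso
  set w : ℂ := ⟨1, -((1 - r.re) / r.im)⟩ with hw
  set z : σ → ℂ := w • ((fun i => algebraMap ℝ ℂ (x i))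
    + r • fun i => algebraMap ℝ ℂ ((Pi.single j 1 : σ → ℝ) i)) with hz
  have hz0 : MvPolynomial.aeval z p = 0 := by
    rw [hz, hp.aeval_smul_eq, hr0, mul_zero]
  have hre : (fun i => (z i).re) = x + Pi.single j 1 := by
    ext i
    have hwr : (w * r).re = 1 := by
      simp only [hw, Complex.mul_re]
      field_simp
      ring
    have : z i = w * (x i : ℂ) + (w * r) * (((Pi.single j 1 : σ → ℝ) i : ℝ) : ℂ) := by
      simp [hz]
      ring
    rw [this, Complex.add_re, Complex.re_mul_ofReal, Complex.re_mul_ofReal, hwr]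
    simp [hw]
  have hzre : ∀ i, 0 ≤ (z i).re := fun i => by
    have hi := congrFun hre i
    have : (0 : ℝ) ≤ (Pi.single j 1 : σ → ℝ) i := by
      rw [Pi.single_apply]; split_ifs <;> simp
    have := hx i
    rw [hi, Pi.add_apply]
    positivity
  have := h z hzre
  rw [hz0, norm_zero, hre] at this
  linarith

theorem HalfPlaneBound.mul_capacityFactor_le_eval_pderiv [Fintype σ] [DecidableEq σ]
    (h : HalfPlaneBound p) (hp : p.IsHomogeneous m) {x : σ → ℝ} (hx : ∀ i, 0 ≤ x i) {j : σ}
    {k : ℕ} (hk : 1 ≤ k) (hdeg : p.degreeOf j ≤ k) {c : ℝ} (hc : 0 < c)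
    (hbound : ∀ t > 0, c * t ≤ MvPolynomial.eval (x + t • Pi.single j 1) p) :
    c * capacityFactor k ≤ MvPolynomial.eval x (MvPolynomial.pderiv j p) := by
  have heval : ∀ (q : MvPolynomial σ ℝ) t, (linePoly q x (Pi.single j 1)).eval t
      = MvPolynomial.eval (x + t • Pi.single j 1) q := fun q t => by
    rw [eval_linePoly, MvPolynomial.aeval_eq_eval]
  have hsplits : (linePoly p x (Pi.single j 1)).Splits := by
    refine h.splits_linePoly_single hp hx j ?_
    have := hbound 1 one_pos
    rw [one_smul] at this
    linarith
  have := hsplits.mul_capacityFactor_le_derivative hk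
    ((natDegree_linePoly_single_le p x j).trans hdeg) hc fun t ht => by
      rw [heval]; exact hbound t ht
  rw [derivative_linePoly, Polynomial.eval_finsetSum, Finset.sum_eq_single j] at this
  · simpa [heval] using this
  · intro i _ hij
    simp [Pi.single_eq_of_ne hij]
  · simp

theorem MvPolynomial.degreeOf_pderiv_le (p : MvPolynomial σ ℝ) (i j : σ) :
    (MvPolynomial.pderiv j p).degreeOf i ≤ p.degreeOf i := by
  rw [MvPolynomial.degreeOf_le_iff]
  intro e he
  rw [MvPolynomial.mem_support_iff, MvPolynomial.coeff_pderiv] at he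
  have := MvPolynomial.degreeOf_le_iff.mp (le_refl (p.degreeOf i)) _
    (MvPolynomial.mem_support_iff.mpr (left_ne_zero_of_mul he))
  rw [Finsupp.add_apply] at this
  omega

/-- Gurvits' capacity inequality: a lower bound for the multilinear coefficient. -/
theorem HalfPlaneBound.mul_capacityFactor_pow_le_coeff [Fintype σ]
    (h : HalfPlaneBound p) (hnn : NonnegCoeffs p) (hp : p.IsHomogeneous (Fintype.card σ))
    {k : ℕ} (hk : 1 ≤ k) (hdeg : ∀ j, p.degreeOf j ≤ k) {c : ℝ} (hc : 0 < c)
    (hbound : ∀ x : σ → ℝ, (∀ i, 0 < x i) → c * ∏ i, x i ≤ MvPolynomial.eval x p) :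
    c * capacityFactor k ^ Fintype.card σ ≤ p.coeff (∑ i, Finsupp.single i 1) := by
  classical
  have key : ∀ T : Finset σ, ∃ q : MvPolynomial σ ℝ, q.IsHomogeneous (Fintype.card σ - T.card) ∧
      NonnegCoeffs q ∧ HalfPlaneBound q ∧ (∀ j, q.degreeOf j ≤ k) ∧
      (∀ x : σ → ℝ, (∀ i ∈ T, x i = 0) → (∀ i ∉ T, 0 < x i) →
        c * capacityFactor k ^ T.card * ∏ i ∈ Tᶜ, x i ≤ MvPolynomial.eval x q) ∧
      ∀ e : σ →₀ ℕ, (∀ i ∈ T, e i = 0) →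
        q.coeff e = p.coeff (e + ∑ i ∈ T, Finsupp.single i 1) := by
    intro T
    induction T using Finset.induction_on with
    | empty => exact ⟨p, by simpa using hp, hnn, h, hdeg, by simpa using hbound, by simp⟩
    | insert j T hj ih =>
      obtain ⟨q, hq, hqnn, hqb, hqdeg, hqbound, hqcoeff⟩ := ih
      have hcard : T.card < Fintype.card σ := Finset.card_lt_univ_of_notMem hj
      refine ⟨MvPolynomial.pderiv j q, ?_, hqnn.pderiv j, hqb.pderiv hqnn hq (by omega) j,
        fun i => (MvPolynomial.degreeOf_pderiv_le q i j).trans (hqdeg i), ?_, ?_⟩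
      · rw [Finset.card_insert_of_notMem hj, ← Nat.sub_sub]
        exact hq.pderiv
      · intro x hx0 hxpos
        have hcf := capacityFactor_pos hk
        have hprod : 0 < ∏ i ∈ (insert j T)ᶜ, x i :=
          Finset.prod_pos fun i hi => hxpos i (Finset.mem_compl.mp hi)
        have hx : ∀ i, 0 ≤ x i := fun i => by
          by_cases hi : i ∈ insert j T
          · rw [hx0 i hi]
          · exact (hxpos i hi).le
        have hstep := hqb.mul_capacityFactor_le_eval_pderiv hq hx (j := j) hk (hqdeg j)
          (c := c * capacityFactor k ^ T.card * ∏ i ∈ (insert j T)ᶜ, x i) (by positivity)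
          fun t ht => by
            refine le_trans (le_of_eq ?_) (hqbound (x + t • Pi.single j 1) ?_ ?_)
            · rw [← Finset.mul_prod_erase _ _ (Finset.mem_compl.mpr hj), Finset.compl_insert]
              have h1 : ∏ i ∈ Tᶜ.erase j, (x + t • (Pi.single j 1 : σ → ℝ)) i = ∏ i ∈ Tᶜ.erase j, x i :=
                Finset.prod_congr rfl fun i hi => by
                  simp [Pi.single_eq_of_ne (Finset.ne_of_mem_erase hi)]
              rw [h1]
              simp [hx0 j (Finset.mem_insert_self j T)]
              ring
            · intro i hi
              have hij : i ≠ j := fun hij => hj (hij ▸ hi)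
              simp [Pi.single_eq_of_ne hij, hx0 i (Finset.mem_insert_of_mem hi)]
            · intro i hi
              rcases eq_or_ne i j with rfl | hij
              · simpa [hx0 i (Finset.mem_insert_self i T)] using ht
              · simpa [Pi.single_eq_of_ne hij] using hxpos i (by simp [hi, hij])
        rw [Finset.card_insert_of_notMem hj, pow_succ]
        linarith
      · intro e he
        rw [MvPolynomial.coeff_pderiv, he j (Finset.mem_insert_self j T), hqcoeff _ fun i hi => ?_,
          Finset.sum_insert hj, add_assoc]
        · simp
        · have hij : i ≠ j := fun hij => hj (hij ▸ hi)
          simp [he i (Finset.mem_insert_of_mem hi), Finsupp.single_eq_of_ne hij]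
  obtain ⟨q, -, -, -, -, hq, hqcoeff⟩ := key Finset.univ
  have h1 := hq 0 (by simp) (by simp)
  have h2 := hqcoeff 0 (by simp)
  rw [zero_add] at h2
  rw [← h2]
  simpa [MvPolynomial.eval_zero, MvPolynomial.constantCoeff_eq] using h1

end Capacity

/-- The product over all rows `i` of the sums of the variables in `N i`; its multilinear
coefficient is the permanent of the incidence matrix of `N`. -/
noncomputable def rowPoly {ι κ : Type*} [Fintype ι] (N : ι → Finset κ) : MvPolynomial κ ℝ :=
  ∏ i, ∑ j ∈ N i, MvPolynomial.X j

section RowPoly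

variable {ι κ : Type*} [Fintype ι] (N : ι → Finset κ)

theorem rowPoly_isHomogeneous : (rowPoly N).IsHomogeneous (Fintype.card ι) := by
  have := MvPolynomial.IsHomogeneous.prod Finset.univ
    (fun i => ∑ j ∈ N i, (MvPolynomial.X j : MvPolynomial κ ℝ)) (fun _ => 1) fun i _ =>
      MvPolynomial.IsHomogeneous.sum _ _ _ fun j _ => MvPolynomial.isHomogeneous_X _ j
  simpa [rowPoly] using this

theorem rowPoly_nonnegCoeffs : NonnegCoeffs (rowPoly N) :=
  NonnegCoeffs.prod fun _ _ => NonnegCoeffs.sum fun j _ => NonnegCoeffs.X j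

theorem rowPoly_halfPlaneBound : HalfPlaneBound (rowPoly N) := by
  intro z hz
  simp only [rowPoly, map_prod, map_sum, MvPolynomial.eval_X, MvPolynomial.aeval_X, norm_prod]
  refine Finset.prod_le_prod (fun i _ => Finset.sum_nonneg fun j _ => hz j) fun i _ => ?_
  rw [← Complex.re_sum]
  exact Complex.re_le_norm _

theorem degreeOf_rowPoly_le [DecidableEq κ] (j : κ) :
    (rowPoly N).degreeOf j ≤ (Finset.univ.filter fun i => j ∈ N i).card := by
  rw [rowPoly, Finset.card_filter]
  refine (MvPolynomial.degreeOf_prod_le _ _ _).trans (Finset.sum_le_sum fun i _ => ?_)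
  refine (MvPolynomial.degreeOf_sum_le _ _ _).trans (Finset.sup_le fun l hl => ?_)
  rw [MvPolynomial.degreeOf_X]
  split_ifs with h1 h2 <;> simp_all

theorem mul_prod_le_eval_rowPoly [Fintype κ] [DecidableEq κ] {d : ℕ} (hd : 1 ≤ d)
    (hrow : ∀ i, (N i).card = d) (hcol : ∀ j, (Finset.univ.filter fun i => j ∈ N i).card = d)
    {x : κ → ℝ} (hx : ∀ j, 0 < x j) :
    (d : ℝ) ^ Fintype.card ι * ∏ j, x j ≤ MvPolynomial.eval x (rowPoly N) := by
  have hd0 : (0 : ℝ) < d := by exact_mod_cast hd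
  have hamgm : ∀ i, d * ∏ j ∈ N i, x j ^ (d : ℝ)⁻¹ ≤ ∑ j ∈ N i, x j := by
    intro i
    have := Real.geom_mean_le_arith_mean_weighted (N i) (fun _ => (d : ℝ)⁻¹) x
      (fun _ _ => by positivity) (by simp [hrow i, hd0.ne']) fun j _ => (hx j).le
    rw [← Finset.mul_sum] at this
    calc d * ∏ j ∈ N i, x j ^ (d : ℝ)⁻¹ ≤ d * ((d : ℝ)⁻¹ * ∑ j ∈ N i, x j) := by gcongr
      _ = _ := by field_simp
  have hswap : ∏ i, ∏ j ∈ N i, x j ^ (d : ℝ)⁻¹ = ∏ j, x j := by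
    rw [Finset.prod_comm' (t' := Finset.univ) (s' := fun j => Finset.univ.filter fun i => j ∈ N i)
      (by simp)]
    refine Finset.prod_congr rfl fun j _ => ?_
    rw [Finset.prod_const, hcol j, Real.rpow_inv_natCast_pow (hx j).le (by omega)]
  simp only [rowPoly, map_prod, map_sum, MvPolynomial.eval_X]
  refine le_trans (le_of_eq ?_) (Finset.prod_le_prod (fun i _ => ?_) fun i _ => hamgm i)
  · rw [Finset.prod_mul_distrib, hswap, Finset.prod_const, Finset.card_univ]
  · have : ∀ j ∈ N i, 0 ≤ x j ^ (d : ℝ)⁻¹ := fun j _ => Real.rpow_nonneg (hx j).le _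
    have := Finset.prod_nonneg this
    positivity

theorem coeff_rowPoly_le [Fintype κ] [DecidableEq ι] :
    (rowPoly N).coeff (∑ j, Finsupp.single j 1)
      ≤ Nat.card {f : ι → κ // (∀ i, f i ∈ N i) ∧ Function.Injective f} := by
  classical
  have hX : ∀ f : ι → κ, ∏ i, (MvPolynomial.X (f i) : MvPolynomial κ ℝ)
      = MvPolynomial.monomial (∑ i, Finsupp.single (f i) 1) 1 := fun f => by
    simp only [MvPolynomial.X, MvPolynomial.monomial_sum_one]
  rw [rowPoly, Finset.prod_univ_sum, MvPolynomial.coeff_sum]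
  simp only [hX, MvPolynomial.coeff_monomial]
  rw [Finset.sum_boole, Nat.card_eq_fintype_card, Fintype.card_subtype]
  refine Nat.cast_le.mpr (Finset.card_le_card fun f hf => ?_)
  simp only [Finset.mem_filter, Fintype.mem_piFinset, Finset.mem_univ, true_and] at hf ⊢
  refine ⟨hf.1, fun a b hab => ?_⟩
  by_contra hne
  have h1 := DFunLike.congr_fun hf.2 (f a)
  simp only [Finsupp.finsetSum_apply, Finsupp.single_apply] at h1
  rw [Finset.sum_ite_eq' Finset.univ (f a) fun _ => 1, if_pos (Finset.mem_univ _)] at h1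
  have h2 : ∑ i ∈ {a, b}, (if f i = f a then 1 else 0) ≤ ∑ i, if f i = f a then 1 else 0 :=
    Finset.sum_le_sum_of_subset (Finset.subset_univ _)
  rw [Finset.sum_pair hne, if_pos rfl, if_pos hab.symm] at h2
  omega

/-- The permanent bound: the number of systems of distinct representatives of a `d`-regular
bipartite incidence structure. -/
theorem pow_le_card_injective_choices [Fintype κ] [DecidableEq κ] {d : ℕ} (hd : 1 ≤ d)
    (hcard : Fintype.card ι = Fintype.card κ) (hrow : ∀ i, (N i).card = d)
    (hcol : ∀ j, (Finset.univ.filter fun i => j ∈ N i).card = d) :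
    (d * capacityFactor d) ^ Fintype.card κ
      ≤ (Nat.card {f : ι → κ // (∀ i, f i ∈ N i) ∧ Function.Injective f} : ℝ) := by
  classical
  refine le_trans ?_ (coeff_rowPoly_le N)
  rw [mul_pow]
  refine (rowPoly_halfPlaneBound N).mul_capacityFactor_pow_le_coeff (rowPoly_nonnegCoeffs N)
    (hcard ▸ rowPoly_isHomogeneous N) hd
    (fun j => (degreeOf_rowPoly_le N j).trans (hcol j).le) (by positivity) fun x hx => ?_
  rw [← hcard]
  exact mul_prod_le_eval_rowPoly N hd hrow hcol hx

end RowPoly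

theorem natCast_mul_capacityFactor {d : ℕ} (hd : 1 ≤ d) :
    (d : ℝ) * capacityFactor d = ((d : ℝ) - 1) ^ (d - 1) / (d : ℝ) ^ (d - 2) := by
  have hd0 : (d : ℝ) ≠ 0 := by positivity
  rcases hd.eq_or_lt with rfl | hd2
  · simp [capacityFactor]
  · obtain ⟨k, rfl⟩ := Nat.exists_eq_add_of_le' hd2
    simp only [capacityFactor, div_pow, show k + Nat.succ 1 - 1 = k + 1 by omega,
      show k + Nat.succ 1 - 2 = k by omega]
    field_simp
    ring

section Graph

variable {V : Type*} [Fintype V] {G : SimpleGraph V} {n : ℕ}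

theorem card_injective_choices_le_matchCount [DecidableRel G.Adj] (C : G.Coloring (Fin 2))
    (hcard : Fintype.card {v // C v = 0} = n) :
    Nat.card {f : {v // C v = 0} → {v // C v = 1} //
      (∀ i : {v // C v = 0}, f i ∈ Finset.univ.filter fun j : {v // C v = 1} => G.Adj i j) ∧
        Function.Injective f} ≤ matchCount G n := by
  classical
  have hne : ∀ (i : {v // C v = 0}) (j : {v // C v = 1}), (i : V) ≠ j := fun i j hij => by
    have := i.2
    rw [hij, j.2] at this
    exact absurd this (by decide)
  have hedge : ∀ (i i' : {v // C v = 0}) (j j' : {v // C v = 1}),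
      s((i : V), (j : V)) = s((i' : V), (j' : V)) → i = i' ∧ j = j' := by
    intro i i' j j' h
    rcases Sym2.eq_iff.mp h with ⟨h1, h2⟩ | ⟨h1, -⟩
    · exact ⟨Subtype.ext h1, Subtype.ext h2⟩
    · exact absurd h1 (hne i j')
  rw [matchCount]
  refine Nat.card_le_card_of_injective (fun f => ⟨Finset.univ.image
    fun i : {v // C v = 0} => s((i : V), (f.1 i : V)), ?_, ?_, ?_⟩) ?_
  · intro e he
    obtain ⟨i, -, rfl⟩ := Finset.mem_image.mp (Finset.mem_coe.mp he)
    exact (Finset.mem_filter.mp (f.2.1 i)).2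
  · rw [Finset.card_image_of_injective _ fun i i' h => (hedge _ _ _ _ h).1, Finset.card_univ, hcard]
  · intro e he e' he' hee' v hv hv'
    obtain ⟨i, -, rfl⟩ := Finset.mem_image.mp he
    obtain ⟨i', -, rfl⟩ := Finset.mem_image.mp he'
    rcases Sym2.mem_iff.mp hv with rfl | rfl <;> rcases Sym2.mem_iff.mp hv' with h | h
    · exact hee' (by rw [Subtype.ext h])
    · exact hne _ _ h
    · exact hne _ _ h.symm
    · exact hee' (by rw [f.2.2 (Subtype.ext h)])
  · intro f g hfg
    refine Subtype.ext (funext fun i => ?_)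
    have hmem : s((i : V), (f.1 i : V)) ∈ Finset.univ.image
        fun i : {v // C v = 0} => s((i : V), (g.1 i : V)) :=
      (Subtype.ext_iff.mp hfg).subset (Finset.mem_image_of_mem _ (Finset.mem_univ i))
    obtain ⟨i', -, h⟩ := Finset.mem_image.mp hmem
    obtain ⟨rfl, h2⟩ := hedge _ _ _ _ h
    exact h2.symm

theorem card_filter_adj_colorClass [DecidableRel G.Adj] {d : ℕ} (hreg : G.IsRegularOfDegree d)
    (C : G.Coloring (Fin 2)) {a b : Fin 2} (hab : ∀ c, c ≠ a → c = b) (v : {v // C v = a}) :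
    (Finset.univ.filter fun w : {w // C w = b} => G.Adj v w).card = d := by
  rw [← hreg v, ← SimpleGraph.card_neighborFinset_eq_degree]
  refine Finset.card_bij (fun w _ => (w : V)) (fun w hw => ?_) (fun _ _ _ _ h => Subtype.ext h)
    fun w hw => ?_
  · simpa using hw
  · rw [SimpleGraph.mem_neighborFinset] at hw
    exact ⟨⟨w, hab _ fun h => C.valid hw (v.2.trans h.symm)⟩, by simpa using hw, rfl⟩

end Graph

/-- **Schrijver's theorem.** A `d`-regular bipartite simple graph on `2n` vertices has at
least `((d-1)^(d-1)/d^(d-2))^n` perfect matchings. -/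
theorem schrijver {V : Type*} [Fintype V] (d n : ℕ) (hd : 1 ≤ d) (hn : 1 ≤ n)
    (G : SimpleGraph V) [DecidableRel G.Adj]
    (hcard : Fintype.card V = 2 * n)
    (hreg : G.IsRegularOfDegree d) (hbip : G.Colorable 2) :
    (((d : ℝ) - 1) ^ (d - 1) / (d : ℝ) ^ (d - 2)) ^ n ≤ (matchCount G n : ℝ) := by
  classical
  obtain ⟨C⟩ := hbip
  have hrow : ∀ i : {v // C v = 0},
      (Finset.univ.filter fun j : {v // C v = 1} => G.Adj i j).card = d :=
    card_filter_adj_colorClass hreg C (by decide)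
  have hcol : ∀ j : {v // C v = 1},
      (Finset.univ.filter fun i : {v // C v = 0} => G.Adj i j).card = d := fun j => by
    simpa only [G.adj_comm] using card_filter_adj_colorClass hreg C (b := 0) (by decide) j
  have heq : Fintype.card {v // C v = 0} = Fintype.card {v // C v = 1} := by
    have := Finset.sum_card_bipartiteAbove_eq_sum_card_bipartiteBelow
      (s := Finset.univ) (t := Finset.univ)
      fun (i : {v // C v = 0}) (j : {v // C v = 1}) => G.Adj i j
    simp only [Finset.bipartiteAbove, Finset.bipartiteBelow, hrow, hcol, Finset.sum_const,
      Finset.card_univ, smul_eq_mul] at this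
    exact Nat.eq_of_mul_eq_mul_right hd this
  have hsum : Fintype.card {v // C v = 0} + Fintype.card {v // C v = 1} = 2 * n := by
    rw [← hcard, ← Fintype.card_congr (Equiv.sumCompl fun v => C v = 0), Fintype.card_sum]
    congr 1
    refine Fintype.card_congr (Equiv.subtypeEquivRight fun v => ?_)
    generalize C v = c
    revert c
    decide
  have h0 : Fintype.card {v // C v = 0} = n := by omega
  have hmain := pow_le_card_injective_choices
    (fun i : {v // C v = 0} => Finset.univ.filter fun j : {v // C v = 1} => G.Adj i j)
    hd heq hrow (by simpa using hcol)
  rw [← heq, h0, natCast_mul_capacityFactor hd] at hmain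
  exact hmain.trans (Nat.cast_le.mpr (card_injective_choices_le_matchCount C h0))
end

section
/- Let d ≥ 1 and n ≥ 1 be integers, let G be a d-regular bipartite simple graph on 2n vertices, let 1 ≤ k ≤ n, and set p = k/n. Then m_k(G) ≥ binom(n,k)^2 · ((d−p)/d)^{n(d−p)} · (dp)^{np}, where the exponents are real powers. -/
section

open Polynomial Finset

theorem exists_factorization_of_splits {f : ℝ[X]} (hf : f.Splits) (h0 : f.coeff 0 ≠ 0) :
    ∃ B : Multiset ℝ, B.card = f.natDegree ∧
      f = C (f.coeff 0) * (B.map fun b => 1 + C b * X).prod ∧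
      ∀ b ∈ B, b ≠ 0 ∧ f.eval (-b⁻¹) = 0 := by
  have hf0 : f ≠ 0 := by rintro rfl; simp at h0
  have hr : ∀ r ∈ f.roots, r ≠ 0 := by
    rintro r hr rfl
    rw [mem_roots hf0, IsRoot.def, ← coeff_zero_eq_eval_zero] at hr
    exact h0 hr
  refine ⟨f.roots.map fun r => -r⁻¹, by simp [hf.natDegree_eq_card_roots], ?_, ?_⟩
  · have key : f = C (f.leadingCoeff * (f.roots.map fun r => -r).prod) *
        ((f.roots.map fun r => -r⁻¹).map fun b => 1 + C b * X).prod := by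
      conv_lhs => rw [hf.eq_prod_roots]
      rw [C_mul, mul_assoc]
      congr 1
      rw [map_multiset_prod, Multiset.map_map, Multiset.map_map, ← Multiset.prod_map_mul]
      congr 1
      refine Multiset.map_congr rfl fun r h => ?_
      have := hr r h
      simp only [Function.comp_apply]
      rw [mul_add, ← mul_assoc, ← C_mul]
      simp [this]
      ring
    have h1 : f.coeff 0 = f.leadingCoeff * (f.roots.map fun r => -r).prod := by
      conv_lhs => rw [key]
      simp [coeff_zero_eq_eval_zero, eval_multiset_prod]
    rw [h1]
    exact key
  · intro b hb
    obtain ⟨r, h, rfl⟩ := Multiset.mem_map.1 hb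
    refine ⟨by simpa using hr r h, ?_⟩
    have := (mem_roots hf0).1 h
    simpa using this

theorem coeff_prod_one_add (B : Multiset ℝ) :
    (B.map fun b => 1 + C b * X).prod.coeff 0 = 1 ∧
    (B.map fun b => 1 + C b * X).prod.coeff 1 = B.sum ∧
    2 * (B.map fun b => 1 + C b * X).prod.coeff 2 = B.sum ^ 2 - (B.map (· ^ 2)).sum := by
  induction B using Multiset.induction with
  | empty => simp [coeff_one]
  | cons b B ih =>
    obtain ⟨h0, h1, h2⟩ := ih
    simp only [Multiset.map_cons, Multiset.prod_cons, Multiset.sum_cons, add_mul, one_mul, mul_assoc,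
      coeff_add, coeff_C_mul, coeff_X_mul_zero]
    have e1 : ∀ P : ℝ[X], (X * P).coeff 1 = P.coeff 0 := fun P => coeff_X_mul P 0
    have e2 : ∀ P : ℝ[X], (X * P).coeff 2 = P.coeff 1 := fun P => coeff_X_mul P 1
    rw [e1, e2, h0, h1]
    refine ⟨by simp, by ring, ?_⟩
    linear_combination h2

theorem Multiset.sq_sum_le_card_mul_sum_sq (B : Multiset ℝ) :
    B.sum ^ 2 ≤ B.card * (B.map (· ^ 2)).sum := by
  rw [← B.coe_toList]
  generalize B.toList = l
  have h := _root_.sq_sum_le_card_mul_sum_sq (s := (Finset.univ : Finset (Fin l.length)))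
    (f := fun i => l[i])
  have e := Fin.sum_univ_fun_getElem l (fun x : ℝ => x ^ 2)
  simp only [Fin.getElem_fin] at e h
  rw [e, Fin.sum_univ_getElem] at h
  simpa using h

theorem newton_inequality_low {f : ℝ[X]} (hf : f.Splits) {N : ℕ} (hN : f.natDegree ≤ N) :
    2 * N * (f.coeff 0 * f.coeff 2) ≤ (N - 1) * f.coeff 1 ^ 2 := by
  rcases Nat.eq_zero_or_pos N with rfl | hNpos
  · rw [coeff_eq_zero_of_natDegree_lt (n := 1) (by omega)]; simp
  have hN1 : (1 : ℝ) ≤ N := by exact_mod_cast hNpos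
  by_cases h0 : f.coeff 0 = 0
  · rw [h0]; simp only [zero_mul, mul_zero]; exact mul_nonneg (by linarith) (sq_nonneg _)
  obtain ⟨B, hB, hfac, -⟩ := exists_factorization_of_splits hf h0
  obtain ⟨-, h1, h2⟩ := coeff_prod_one_add B
  have e1 : f.coeff 1 = f.coeff 0 * B.sum := by
    conv_lhs => rw [hfac, coeff_C_mul, h1]
  have e2 : 2 * f.coeff 2 = f.coeff 0 * (B.sum ^ 2 - (B.map (· ^ 2)).sum) := by
    conv_lhs => rw [hfac, coeff_C_mul]
    rw [← h2]; ring
  have hs : B.sum ^ 2 ≤ N * (B.map (· ^ 2)).sum := by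
    refine (Multiset.sq_sum_le_card_mul_sum_sq B).trans ?_
    have : (B.card : ℝ) ≤ N := by exact_mod_cast hB ▸ hN
    refine mul_le_mul_of_nonneg_right this (Multiset.sum_nonneg ?_)
    intro x hx
    obtain ⟨y, -, rfl⟩ := Multiset.mem_map.1 hx
    positivity
  rw [e1]
  have : 2 * N * (f.coeff 0 * f.coeff 2) = N * f.coeff 0 * (2 * f.coeff 2) := by ring
  rw [this, e2]
  nlinarith [mul_le_mul_of_nonneg_left hs (sq_nonneg (f.coeff 0))]

theorem splits_derivative {f : ℝ[X]} (hf : f.Splits) : f.derivative.Splits := by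
  rw [splits_iff_card_roots] at hf ⊢
  refine le_antisymm (card_roots' _) ?_
  have := card_roots_le_derivative f
  have := natDegree_derivative_le f
  omega

theorem newton_inequality {f : ℝ[X]} (hf : f.Splits) {n : ℕ} (hn : f.natDegree ≤ n) (k : ℕ)
    (hk : k + 1 ≤ n) :
    f.coeff k * f.coeff (k + 2) * ((k + 2) * (n - k)) ≤
      f.coeff (k + 1) ^ 2 * ((k + 1) * (n - k - 1)) := by
  have hs : (derivative^[k] f).Splits := by
    clear hk
    induction k with
    | zero => simpa
    | succ k ih => rw [Function.iterate_succ_apply']; exact splits_derivative ih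
  have hd : (derivative^[k] f).natDegree ≤ n - k :=
    (natDegree_iterate_derivative f k).trans (by omega)
  have key := newton_inequality_low hs hd
  simp only [coeff_iterate_derivative, zero_add, Nat.descFactorial_self, nsmul_eq_mul,
    Nat.cast_sub (show k ≤ n by omega)] at key
  have a1 : ((1 + k).descFactorial k : ℝ) = (k + 1) * k.factorial := by
    have := Nat.factorial_mul_descFactorial (show k ≤ 1 + k by omega)
    rw [show 1 + k - k = 1 by omega, add_comm 1 k] at this
    rw [add_comm 1 k]
    have h : (k + 1).descFactorial k = (k + 1) * k.factorial := by
      simpa [Nat.factorial_succ] using this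
    exact_mod_cast h
  have a2 : (2 : ℝ) * ((2 + k).descFactorial k : ℝ) = (k + 2) * (k + 1) * k.factorial := by
    have := Nat.factorial_mul_descFactorial (show k ≤ 2 + k by omega)
    rw [show 2 + k - k = 2 by omega, add_comm 2 k] at this
    rw [add_comm 2 k]
    have h : (2 * (k + 2).descFactorial k) = (k + 2) * (k + 1) * k.factorial := by
      simpa [Nat.factorial_succ, mul_assoc] using this
    exact_mod_cast h
  rw [a1, add_comm 1 k, add_comm 2 k] at key
  rw [add_comm 2 k] at a2
  have e : 2 * ((n : ℝ) - k) *
      (k.factorial * f.coeff k * ((k + 2).descFactorial k * f.coeff (k + 2))) =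
      ((n : ℝ) - k) * (k.factorial * f.coeff k *
        ((2 * ((k + 2).descFactorial k : ℝ)) * f.coeff (k + 2))) := by
    ring
  rw [e, a2] at key
  have hpos : (0 : ℝ) < (k + 1) * (k.factorial : ℝ) ^ 2 := by positivity
  refine le_of_mul_le_mul_left ?_ hpos
  linarith

theorem mul_rpow_le_of_forall_mul_rpow_le {a D s N : ℝ} (hs : 0 < s) (hsN : s ≤ N)
    (h : ∀ v : ℝ, 0 < v → D * v ^ s ≤ a * (1 + v) ^ N) :
    D * (s ^ s * (N - s) ^ (N - s)) ≤ a * N ^ N := by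
  have hN : 0 < N := hs.trans_le hsN
  rcases hsN.lt_or_eq with hlt | rfl
  · have hd : 0 < N - s := sub_pos.2 hlt
    have := h (s / (N - s)) (by positivity)
    have e : 1 + s / (N - s) = N / (N - s) := by field_simp; ring
    rw [e, Real.div_rpow hs.le hd.le, Real.div_rpow hN.le hd.le] at this
    have e2 : (N - s) ^ N = (N - s) ^ s * (N - s) ^ (N - s) := by
      rw [← Real.rpow_add hd]; congr 1; ring
    have h1 : 0 < (N - s) ^ s := Real.rpow_pos_of_pos hd _
    have h2 : 0 < (N - s) ^ (N - s) := Real.rpow_pos_of_pos hd _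
    rw [e2] at this
    have := mul_le_mul_of_nonneg_right this (mul_pos h1 h2).le
    have l : D * (s ^ s / (N - s) ^ s) * ((N - s) ^ s * (N - s) ^ (N - s)) =
      D * (s ^ s * (N - s) ^ (N - s)) := by field_simp
    have r : a * (N ^ N / ((N - s) ^ s * (N - s) ^ (N - s))) * ((N - s) ^ s * (N - s) ^ (N - s)) =
      a * N ^ N := by field_simp
    rwa [l, r] at this
  · have hle : D ≤ a := by
      have ht : Filter.Tendsto (fun w : ℝ => a * (1 + w) ^ s) (nhdsWithin 0 (Set.Ioi 0))
          (nhds (a * (1 + 0) ^ s)) := by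
        apply tendsto_nhdsWithin_of_tendsto_nhds
        have : ContinuousAt (fun w : ℝ => a * (1 + w) ^ s) 0 := by
          refine continuousAt_const.mul (ContinuousAt.rpow_const (by fun_prop) (Or.inr hs.le))
        exact this
      rw [add_zero, Real.one_rpow, mul_one] at ht
      refine ge_of_tendsto ht ?_
      filter_upwards [self_mem_nhdsWithin] with w hw
      have hw : 0 < w := hw
      have := h w⁻¹ (by positivity)
      have e : 1 + w⁻¹ = (1 + w) * w⁻¹ := by field_simp; ring
      rw [e, Real.mul_rpow (by positivity) (by positivity), ← mul_assoc] at this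
      exact le_of_mul_le_mul_right this (Real.rpow_pos_of_pos (by positivity) _)
    simp only [sub_self, Real.rpow_zero, mul_one]
    exact mul_le_mul_of_nonneg_right hle (Real.rpow_nonneg hs.le _)

theorem eval_pos_of_coeff_nonneg {f : ℝ[X]} (h0 : 0 < f.coeff 0) (hc : ∀ i, 0 ≤ f.coeff i)
    {x : ℝ} (hx : 0 ≤ x) : 0 < f.eval x := by
  rw [eval_eq_sum_range]
  refine Finset.sum_pos' (fun i _ => mul_nonneg (hc i) (pow_nonneg hx i)) ⟨0, by simp, ?_⟩
  simpa using h0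

theorem exists_pos_factorization {f : ℝ[X]} (hf : f.Splits) (h0 : 0 < f.coeff 0)
    (hpos : ∀ x : ℝ, 0 ≤ x → 0 < f.eval x) :
    ∃ B : Multiset ℝ, B.card = f.natDegree ∧
      f = C (f.coeff 0) * (B.map fun b => 1 + C b * X).prod ∧ ∀ b ∈ B, 0 < b := by
  obtain ⟨B, h1, h2, h3⟩ := exists_factorization_of_splits hf h0.ne'
  refine ⟨B, h1, h2, fun b hb => ?_⟩
  obtain ⟨hb0, hb1⟩ := h3 b hb
  by_contra hneg
  have : b⁻¹ < 0 := inv_lt_zero.2 (lt_of_le_of_ne (not_lt.1 hneg) hb0)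
  exact (hpos (-b⁻¹) (by linarith)).ne' hb1

theorem coeff_prod_one_add_pos (B : Multiset ℝ) (hB : ∀ b ∈ B, 0 < b) (j : ℕ) :
    0 ≤ (B.map fun b => 1 + C b * X).prod.coeff j ∧
      (j ≤ B.card → 0 < (B.map fun b => 1 + C b * X).prod.coeff j) := by
  induction B using Multiset.induction generalizing j with
  | empty =>
    simp only [Multiset.map_zero, Multiset.prod_zero, coeff_one, Multiset.card_zero]
    split_ifs with h
    · simp
    · exact ⟨le_rfl, fun h' => absurd (by omega) h⟩
  | cons b B ih =>
    have hb := hB b (Multiset.mem_cons_self _ _)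
    have ih := ih fun c hc => hB c (Multiset.mem_cons_of_mem hc)
    simp only [Multiset.map_cons, Multiset.prod_cons, add_mul, one_mul, mul_assoc, coeff_add,
      coeff_C_mul, Multiset.card_cons]
    cases j with
    | zero => simpa using ih 0
    | succ j =>
      rw [coeff_X_mul]
      have h1 := ih j
      have h2 := ih (j + 1)
      refine ⟨add_nonneg h2.1 (mul_nonneg hb.le h1.1), fun h => ?_⟩
      exact add_pos_of_nonneg_of_pos h2.1 (mul_pos hb (h1.2 (by omega)))

theorem choose_mul_le_coeff {f : ℝ[X]} (hf : f.Splits) (hc : ∀ i, 0 ≤ f.coeff i)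
    (h0 : 0 < f.coeff 0) {n k : ℕ} (hn : f.natDegree ≤ n) (hk1 : 1 ≤ k) (hkn : k ≤ n)
    {D : ℝ} (hD : 0 < D) (h : ∀ t : ℝ, 0 < t → D * t ^ k ≤ f.eval t) :
    n.choose k * (D * ((k : ℝ) ^ (k : ℝ) * ((n : ℝ) - k) ^ ((n : ℝ) - k))) ≤
      f.coeff k * (n : ℝ) ^ (n : ℝ) := by
  -- the degree of `f` is at least `k`
  have hdeg : k ≤ f.natDegree := by
    by_contra hlt
    push Not at hlt
    set A := f.eval 1
    have hA : 0 < A := eval_pos_of_coeff_nonneg h0 hc zero_le_one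
    set t := A / D + 1
    have ht : 1 ≤ t := by simp only [t]; linarith [div_pos hA hD]
    have h1 := h t (by linarith)
    have h2 : f.eval t ≤ A * t ^ (k - 1) := by
      simp only [A]
      rw [eval_eq_sum_range, eval_eq_sum_range, Finset.sum_mul]
      refine Finset.sum_le_sum fun i hi => ?_
      rw [one_pow, mul_one]
      refine mul_le_mul_of_nonneg_left (pow_le_pow_right₀ ht ?_) (hc i)
      have := Finset.mem_range.1 hi
      omega
    have h3 : t ^ k = t * t ^ (k - 1) := by rw [← pow_succ']; congr 1; omega
    rw [h3, ← mul_assoc] at h1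
    have h4 := le_of_mul_le_mul_right (h1.trans h2) (by positivity)
    have h5 : D * t = A + D := by simp only [t]; field_simp
    linarith
  obtain ⟨B, hB, hfac, hBpos⟩ := exists_pos_factorization hf h0
    (fun x hx => eval_pos_of_coeff_nonneg h0 hc hx)
  have hcpos : ∀ j ≤ f.natDegree, 0 < f.coeff j := by
    intro j hj
    rw [hfac, coeff_C_mul]
    exact mul_pos h0 ((coeff_prod_one_add_pos B hBpos j).2 (hB ▸ hj))
  -- normalized coefficients form a log-concave sequence
  set a : ℕ → ℝ := fun i => f.coeff i / n.choose i with ha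
  have hch : ∀ i ≤ n, (0 : ℝ) < n.choose i := fun i hi => by exact_mod_cast Nat.choose_pos hi
  have hapos : ∀ j ≤ f.natDegree, 0 < a j := fun j hj => div_pos (hcpos j hj) (hch j (hj.trans hn))
  have hanonneg : ∀ j, 0 ≤ a j := fun j => div_nonneg (hc j) (Nat.cast_nonneg _)
  have hlc : ∀ i, i + 2 ≤ n → a i * a (i + 2) ≤ a (i + 1) ^ 2 := by
    intro i hi
    have hN := newton_inequality hf hn i (by omega)
    have c1 : (n.choose (i + 1) : ℝ) * (i + 1) = n.choose i * (n - i) := by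
      have := Nat.choose_succ_right_eq n i
      rw [← Nat.cast_sub (by omega : i ≤ n)]
      exact_mod_cast this
    have c2 : (n.choose (i + 2) : ℝ) * (i + 2) = n.choose (i + 1) * (n - i - 1) := by
      have := Nat.choose_succ_right_eq n (i + 1)
      have e : (n : ℝ) - i - 1 = ((n - (i + 1) : ℕ) : ℝ) := by
        rw [Nat.cast_sub (by omega : i + 1 ≤ n)]; push_cast; ring
      rw [e]
      exact_mod_cast this
    have p0 := hch i (by omega)
    have p1 := hch (i + 1) (by omega)
    have p2 := hch (i + 2) hi
    have q1 : (0 : ℝ) < n - i - 1 := by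
      have : ((i + 2 : ℕ) : ℝ) ≤ n := by exact_mod_cast hi
      push_cast at this; linarith
    have q0 : (0 : ℝ) < n - i := by linarith
    simp only [ha]
    rw [div_mul_div_comm, div_pow, div_le_div_iff₀ (by positivity) (by positivity)]
    have hpos : (0 : ℝ) < (i + 1) * (n - i - 1) := by positivity
    refine le_of_mul_le_mul_right ?_ hpos
    have e1 : f.coeff i * f.coeff (i + 2) * (n.choose (i + 1) : ℝ) ^ 2 * ((i + 1) * (n - i - 1)) =
        f.coeff i * f.coeff (i + 2) * ((i + 2) * (n - i)) * (n.choose i * n.choose (i + 2)) := by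
      linear_combination f.coeff i * f.coeff (i + 2) *
        (n.choose (i + 1) * (n - i - 1) * c1 - (n.choose i * (n - i)) * c2)
    rw [e1]
    have := mul_le_mul_of_nonneg_right hN (mul_pos p0 p2).le
    linarith
  -- supporting geometric sequence at `k`
  set r := a k / a (k - 1) with hr
  have hrpos : 0 < r := div_pos (hapos k hdeg) (hapos (k - 1) (by omega))
  have hstep1 : ∀ i, k ≤ i + 1 → i < n → a (i + 1) ≤ r * a i := by
    intro i hi
    induction i, (show k - 1 ≤ i by omega) using Nat.le_induction with
    | base =>
      intro _
      rw [hr, Nat.sub_add_cancel hk1, div_mul_cancel₀]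
      exact (hapos (k - 1) (by omega)).ne'
    | succ i hle ih =>
      intro hin
      have ih := ih (by omega) (by omega)
      have hl := hlc i (by omega)
      by_cases hi0 : i ≤ f.natDegree
      · refine le_of_mul_le_mul_left (hl.trans ?_) (hapos i hi0)
        nlinarith [hanonneg (i + 1)]
      · have : a (i + 2) = 0 := by
          simp only [ha]; rw [coeff_eq_zero_of_natDegree_lt (by omega), zero_div]
        rw [this]; exact mul_nonneg hrpos.le (hanonneg _)
  have hstep2 : ∀ j i, i + 1 + j = k → r * a i ≤ a (i + 1) := by
    intro j
    induction j with
    | zero =>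
      intro i hi
      have : i = k - 1 := by omega
      subst this
      rw [hr, Nat.sub_add_cancel hk1, div_mul_cancel₀]
      exact (hapos (k - 1) (by omega)).ne'
    | succ j ih =>
      intro i hi
      have ih := ih (i + 1) (by omega)
      have hl := hlc i (by omega)
      have p2 := hapos (i + 1) (by omega)
      have p3 := hapos i (by omega)
      refine le_of_mul_le_mul_right ?_ p2
      calc r * a i * a (i + 1) = a i * (r * a (i + 1)) := by ring
        _ ≤ a i * a (i + 2) := mul_le_mul_of_nonneg_left ih p3.le
        _ ≤ a (i + 1) * a (i + 1) := by rw [← sq]; exact hl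
  have hub : ∀ i ≤ n, a i * r ^ k ≤ a k * r ^ i := by
    intro i hi
    rcases le_total k i with hki | hki
    · induction i, hki using Nat.le_induction with
      | base => exact le_rfl
      | succ i hle ih =>
        have := hstep1 i (by omega) (by omega)
        calc a (i + 1) * r ^ k ≤ r * a i * r ^ k := mul_le_mul_of_nonneg_right this (by positivity)
          _ = r * (a i * r ^ k) := by ring
          _ ≤ r * (a k * r ^ i) := mul_le_mul_of_nonneg_left (ih (by omega)) hrpos.le
          _ = a k * r ^ (i + 1) := by ring
    · have key : ∀ j i, i + j = k → a i * r ^ j ≤ a k := by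
        intro j
        induction j with
        | zero => intro i h; rw [← h]; simp
        | succ j ih =>
          intro i h
          calc a i * r ^ (j + 1) = r * a i * r ^ j := by ring
            _ ≤ a (i + 1) * r ^ j :=
              mul_le_mul_of_nonneg_right (hstep2 j i (by omega)) (by positivity)
            _ ≤ _ := ih (i + 1) (by omega)
      have e : r ^ k = r ^ (k - i) * r ^ i := by rw [← pow_add]; congr 1; omega
      rw [e, ← mul_assoc]
      exact mul_le_mul_of_nonneg_right (key (k - i) i (by omega)) (by positivity)
  have hbound : ∀ v : ℝ, 0 < v → D * v ^ (k : ℝ) ≤ a k * (1 + v) ^ (n : ℝ) := by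
    intro v hv
    rw [Real.rpow_natCast, Real.rpow_natCast]
    have h1 := mul_le_mul_of_nonneg_right (h (v / r) (by positivity)) (pow_pos hrpos k).le
    rw [div_pow, mul_assoc, div_mul_cancel₀ _ (pow_pos hrpos k).ne'] at h1
    refine h1.trans ?_
    rw [eval_eq_sum_range' (Nat.lt_succ_of_le hn), Finset.sum_mul, add_comm 1 v, add_pow,
      Finset.mul_sum]
    refine Finset.sum_le_sum fun i hi => ?_
    have hi : i ≤ n := Nat.lt_succ_iff.1 (Finset.mem_range.1 hi)
    have e : f.coeff i = a i * n.choose i := by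
      simp only [ha]; rw [div_mul_cancel₀ _ (hch i hi).ne']
    rw [e, one_pow, div_pow]
    have h2 := mul_le_mul_of_nonneg_right (hub i hi)
      (show 0 ≤ n.choose i * (v ^ i / r ^ i) by positivity)
    calc a i * n.choose i * (v ^ i / r ^ i) * r ^ k
        = a i * r ^ k * (n.choose i * (v ^ i / r ^ i)) := by ring
      _ ≤ a k * r ^ i * (n.choose i * (v ^ i / r ^ i)) := h2
      _ = a k * (v ^ i * 1 * n.choose i) := by field_simp
  have := mul_rpow_le_of_forall_mul_rpow_le (by exact_mod_cast hk1) (by exact_mod_cast hkn) hbound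
  have e : f.coeff k = n.choose k * a k := by
    simp only [ha]; rw [mul_div_cancel₀ _ (hch k hkn).ne']
  rw [e, mul_assoc]
  exact mul_le_mul_of_nonneg_left this (hch k hkn).le

theorem coeff_zero_prod_C_add {I R : Type*} [CommSemiring R] (s : Finset I) (c a : I → R) :
    (∏ i ∈ s, (C (c i) + C (a i) * X)).coeff 0 = ∏ i ∈ s, c i := by
  simp [coeff_zero_eq_eval_zero, eval_prod]

theorem coeff_one_prod_C_add {I R : Type*} [DecidableEq I] [CommSemiring R] (s : Finset I) (c a : I → R) :
    (∏ i ∈ s, (C (c i) + C (a i) * X)).coeff 1 = ∑ i ∈ s, a i * ∏ i' ∈ s.erase i, c i' := by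
  induction s using Finset.induction_on with
  | empty => simp [coeff_one]
  | insert k s hk ih =>
    rw [Finset.prod_insert hk, add_mul, mul_assoc, coeff_add, coeff_C_mul, coeff_C_mul,
      coeff_X_mul _ 0, coeff_zero_prod_C_add, ih, Finset.sum_insert hk, Finset.erase_insert hk,
      add_comm, Finset.mul_sum]
    congr 1
    refine Finset.sum_congr rfl fun i hi => ?_
    have hne : i ≠ k := fun h => hk (h ▸ hi)
    rw [Finset.erase_insert_of_ne hne.symm,
      Finset.prod_insert fun h => hk (Finset.mem_of_mem_erase h)]
    ring

section MatchingForm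

variable {I J R : Type*} [Fintype I] [Fintype J] [DecidableEq I] [DecidableEq J]
  (r : I → J → Prop) [DecidableRel r]

open Classical in
/-- The matchings of the bipartite graph `r` whose right endpoints lie in `S`. -/
noncomputable def relMatchings (S : Finset J) : Finset (Finset (I × J)) :=
  Finset.univ.filter fun M => (∀ e ∈ M, r e.1 e.2 ∧ e.2 ∈ S) ∧
    (∀ e ∈ M, ∀ f ∈ M, e.1 = f.1 → e = f) ∧ (∀ e ∈ M, ∀ f ∈ M, e.2 = f.2 → e = f)

/-- The matching polynomial of the bipartite graph `r` restricted to the columns in `S`, where each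
unmatched row contributes a linear form in the variables of the remaining columns. -/
noncomputable def matchingForm [CommSemiring R] (S : Finset J) (y t : R) (z : J → R) : R :=
  ∑ M ∈ relMatchings r S, t ^ M.card *
    ∏ i ∈ (M.image Prod.fst)ᶜ, (y + ∑ j ∈ Sᶜ with r i j, z j)

variable {r}

theorem mem_relMatchings {S : Finset J} {M : Finset (I × J)} : M ∈ relMatchings r S ↔
    (∀ e ∈ M, r e.1 e.2 ∧ e.2 ∈ S) ∧ (∀ e ∈ M, ∀ f ∈ M, e.1 = f.1 → e = f) ∧
      (∀ e ∈ M, ∀ f ∈ M, e.2 = f.2 → e = f) := by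
  simp [relMatchings]

theorem empty_mem_relMatchings (S : Finset J) : ∅ ∈ relMatchings r S := by
  simp [mem_relMatchings]

theorem relMatchings_empty : relMatchings r ∅ = {∅} := by
  ext M
  rw [mem_relMatchings, Finset.mem_singleton]
  constructor
  · intro h
    refine Finset.eq_empty_of_forall_notMem fun e he => ?_
    simpa using (h.1 e he).2
  · rintro rfl; simp

theorem map_matchingForm {R' : Type*} [CommSemiring R] [CommSemiring R'] (φ : R →+* R')
    (S : Finset J) (y t : R) (z : J → R) :
    φ (matchingForm r S y t z) = matchingForm r S (φ y) (φ t) (fun j => φ (z j)) := by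
  simp [matchingForm, map_sum, map_prod]

theorem card_image_fst_of_mem_relMatchings {S : Finset J} {M : Finset (I × J)}
    (hM : M ∈ relMatchings r S) : (M.image Prod.fst).card = M.card :=
  Finset.card_image_of_injOn fun _ he _ hf h => (mem_relMatchings.1 hM).2.1 _ he _ hf h

theorem card_add_card_compl_of_mem_relMatchings {S : Finset J} {M : Finset (I × J)}
    (hM : M ∈ relMatchings r S) :
    M.card + ((M.image Prod.fst)ᶜ).card = Fintype.card I := by
  rw [← card_image_fst_of_mem_relMatchings hM, Finset.card_add_card_compl]

theorem matchingForm_mul [CommSemiring R] (S : Finset J) (c y t : R) (z : J → R) :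
    matchingForm r S (c * y) (c * t) (fun j => c * z j) =
      c ^ Fintype.card I * matchingForm r S y t z := by
  simp only [matchingForm]
  rw [Finset.mul_sum]
  refine Finset.sum_congr rfl fun M hM => ?_
  simp only [← Finset.mul_sum, ← mul_add, Finset.prod_mul_distrib, Finset.prod_const]
  rw [← card_add_card_compl_of_mem_relMatchings hM]
  ring

/-- The matching form as a univariate polynomial in the variable of column `j`. -/
noncomputable def matchingFormPoly [CommSemiring R] (r : I → J → Prop) [DecidableRel r]
    (S : Finset J) (j : J) (y t : R) (z : J → R) : R[X] :=
  matchingForm r S (C y) (C t) (Function.update (fun j' => C (z j')) j X)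

theorem eval_matchingFormPoly [CommSemiring R] (S : Finset J) (j : J) (y t : R) (z : J → R)
    (x : R) : (matchingFormPoly r S j y t z).eval x =
      matchingForm r S y t (Function.update z j x) := by
  rw [matchingFormPoly, ← coe_evalRingHom, map_matchingForm]
  simp only [coe_evalRingHom, eval_C]
  congr 1
  ext j'
  rcases eq_or_ne j' j with rfl | h
  · simp
  · simp [h]

theorem map_matchingFormPoly {R' : Type*} [CommSemiring R] [CommSemiring R'] (φ : R →+* R')
    (S : Finset J) (j : J) (y t : R) (z : J → R) :
    (matchingFormPoly r S j y t z).map φ =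
      matchingFormPoly r S j (φ y) (φ t) (fun j' => φ (z j')) := by
  rw [matchingFormPoly, ← coe_mapRingHom, map_matchingForm, matchingFormPoly]
  simp only [coe_mapRingHom, map_C]
  congr 1
  ext j'
  rcases eq_or_ne j' j with rfl | h
  · simp
  · simp [h]

theorem matchingFormPoly_eq [CommSemiring R] {S : Finset J} {j : J} (hj : j ∉ S) (y t : R)
    (z : J → R) : matchingFormPoly r S j y t z = ∑ M ∈ relMatchings r S, C (t ^ M.card) *
      ∏ i ∈ (M.image Prod.fst)ᶜ, (C (y + ∑ j' ∈ (insert j S)ᶜ with r i j', z j') +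
        C (if r i j then 1 else 0) * X) := by
  rw [matchingFormPoly, matchingForm]
  refine Finset.sum_congr rfl fun M _ => ?_
  rw [C_pow]
  congr 1
  refine Finset.prod_congr rfl fun i _ => ?_
  have hS : Sᶜ = insert j (insert j S)ᶜ := by
    ext x; by_cases h : x = j <;> simp [h, hj]
  have hu : ∑ j' ∈ (insert j S)ᶜ with r i j', Function.update (fun j' => C (z j')) j X j' =
      C (∑ j' ∈ (insert j S)ᶜ with r i j', z j') := by
    rw [map_sum]
    refine Finset.sum_congr rfl fun j' hj' => ?_
    have : j' ≠ j := by rintro rfl; simp at hj'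
    simp [this]
  rw [hS, Finset.filter_insert]
  split_ifs with h
  · rw [Finset.sum_insert (by simp), hu]
    simp [add_assoc, add_comm X]
  · rw [hu]; simp

theorem matchingForm_insert [CommSemiring R] {S : Finset J} {j : J} (hj : j ∉ S) (y t : R)
    (z : J → R) : matchingForm r (insert j S) y t z =
      (matchingFormPoly r S j y t z).coeff 0 + t * (matchingFormPoly r S j y t z).coeff 1 := by
  rw [matchingFormPoly_eq hj, finsetSum_coeff, finsetSum_coeff]
  simp only [coeff_C_mul, coeff_zero_prod_C_add, coeff_one_prod_C_add]
  rw [matchingForm, ← Finset.sum_filter_not_add_sum_filter _ (fun M => ∃ e ∈ M, e.2 = j)]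
  congr 1
  · refine Finset.sum_congr ?_ fun _ _ => rfl
    ext M
    simp only [Finset.mem_filter, mem_relMatchings, Finset.mem_insert]
    constructor
    · rintro ⟨⟨h1, h2⟩, h3⟩
      push Not at h3
      exact ⟨fun e he => ⟨(h1 e he).1, (h1 e he).2.resolve_left (h3 e he)⟩, h2⟩
    · rintro ⟨h1, h2⟩
      refine ⟨⟨fun e he => ⟨(h1 e he).1, Or.inr (h1 e he).2⟩, h2⟩, ?_⟩
      rintro ⟨e, he, rfl⟩
      exact hj (h1 e he).2
  · have hsplit : ∀ M : Finset (I × J), t * (t ^ M.card *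
        ∑ i ∈ (M.image Prod.fst)ᶜ, (if r i j then (1 : R) else 0) *
          ∏ i' ∈ (M.image Prod.fst)ᶜ.erase i, (y + ∑ j' ∈ (insert j S)ᶜ with r i' j', z j')) =
        ∑ i ∈ (M.image Prod.fst)ᶜ with r i j, t ^ (M.card + 1) *
          ∏ i' ∈ (M.image Prod.fst)ᶜ.erase i, (y + ∑ j' ∈ (insert j S)ᶜ with r i' j', z j') := by
      intro M
      simp only [ite_mul, one_mul, zero_mul]
      rw [← Finset.sum_filter, ← mul_assoc, ← pow_succ', Finset.mul_sum]
    rw [Finset.mul_sum]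
    simp only [hsplit]
    rw [Finset.sum_sigma']
    symm
    refine Finset.sum_bij (fun p _ => insert (p.2, j) p.1) ?_ ?_ ?_ ?_
    · rintro ⟨M, i⟩ hp
      simp only [Finset.mem_sigma, Finset.mem_filter, Finset.mem_compl, Finset.mem_image,
        mem_relMatchings, not_exists, not_and] at hp
      obtain ⟨⟨h1, h2, h3⟩, h4, h5⟩ := hp
      simp only [Finset.mem_filter, mem_relMatchings]
      refine ⟨⟨?_, ?_, ?_⟩, (i, j), by simp, rfl⟩
      · intro e he
        rcases Finset.mem_insert.1 he with rfl | he
        · simp [h5]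
        · exact ⟨(h1 e he).1, Finset.mem_insert_of_mem (h1 e he).2⟩
      · intro e he f hf hef
        rcases Finset.mem_insert.1 he with rfl | he <;> rcases Finset.mem_insert.1 hf with rfl | hf
        · rfl
        · exact absurd hef.symm (h4 f hf)
        · exact absurd hef (h4 e he)
        · exact h2 e he f hf hef
      · intro e he f hf hef
        rcases Finset.mem_insert.1 he with rfl | he <;> rcases Finset.mem_insert.1 hf with rfl | hf
        · rfl
        · exact absurd (show (i, j).2 ∈ S from hef ▸ (h1 f hf).2) hj
        · exact absurd (show (i, j).2 ∈ S from hef ▸ (h1 e he).2) hj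
        · exact h3 e he f hf hef
    · rintro ⟨M, i⟩ hp ⟨M', i'⟩ hp' heq
      simp only [Finset.mem_sigma, mem_relMatchings] at hp hp'
      have hn : ∀ k, (k, j) ∉ M := fun k hk => hj (hp.1.1 _ hk).2
      have hn' : ∀ k, (k, j) ∉ M' := fun k hk => hj (hp'.1.1 _ hk).2
      simp only at heq
      have hii : i = i' := by
        have : (i, j) ∈ insert (i', j) M' := heq ▸ Finset.mem_insert_self _ _
        rcases Finset.mem_insert.1 this with h | h
        · exact (Prod.ext_iff.1 h).1
        · exact absurd h (hn' i)
      subst hii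
      have : M = M' := by
        rw [← Finset.erase_insert (hn i), heq, Finset.erase_insert (hn' i)]
      subst this
      rfl
    · intro M hM
      simp only [Finset.mem_filter, mem_relMatchings] at hM
      obtain ⟨⟨h1, h2, h3⟩, ⟨i, j'⟩, he, rfl⟩ := hM
      refine ⟨⟨M.erase (i, j'), i⟩, ?_, Finset.insert_erase he⟩
      simp only [Finset.mem_sigma, Finset.mem_filter, Finset.mem_compl, Finset.mem_image,
        mem_relMatchings, not_exists, not_and]
      refine ⟨⟨fun e hm => ?_, fun e hm f hf => h2 e (Finset.mem_of_mem_erase hm) f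
        (Finset.mem_of_mem_erase hf), fun e hm f hf => h3 e (Finset.mem_of_mem_erase hm) f
        (Finset.mem_of_mem_erase hf)⟩, fun e hm hei => ?_, (h1 _ he).1⟩
      · have hm' := Finset.mem_of_mem_erase hm
        refine ⟨(h1 e hm').1, (Finset.mem_insert.1 (h1 e hm').2).resolve_left fun h => ?_⟩
        exact Finset.ne_of_mem_erase hm (h3 e hm' _ he h)
      · exact Finset.ne_of_mem_erase hm (h2 e (Finset.mem_of_mem_erase hm) _ he hei)
    · rintro ⟨M, i⟩ hp
      simp only [Finset.mem_sigma, mem_relMatchings] at hp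
      have hn : (i, j) ∉ M := fun hk => hj (hp.1.1 _ hk).2
      simp only
      rw [Finset.card_insert_of_notMem hn, Finset.image_insert,
        Finset.compl_insert (s := M.image Prod.fst)]

theorem natDegree_matchingFormPoly_le [CommSemiring R] {S : Finset J} {j : J} (hj : j ∉ S)
    (y t : R) (z : J → R) :
    (matchingFormPoly r S j y t z).natDegree ≤ (Finset.univ.filter fun i => r i j).card := by
  rw [matchingFormPoly_eq hj]
  refine natDegree_sum_le_of_forall_le _ _ fun M _ => ?_
  refine (natDegree_C_mul_le _ _).trans ((natDegree_prod_le _ _).trans ?_)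
  rw [Finset.card_filter]
  refine le_trans (Finset.sum_le_sum fun i _ => ?_)
    (Finset.sum_le_sum_of_subset (Finset.subset_univ _))
  refine natDegree_add_le_of_degree_le (by rw [natDegree_C]; exact Nat.zero_le _) ?_
  split_ifs
  · simpa using natDegree_X_le
  · simp

end MatchingForm

theorem coeff_zero_add_mul_coeff_one_ne_zero {Q : ℂ[X]} {t : ℂ} (ht : 0 < t.im)
    (h0 : Q.eval 0 ≠ 0) (hQ : ∀ x : ℂ, 0 < x.im → Q.eval x ≠ 0) :
    Q.coeff 0 + t * Q.coeff 1 ≠ 0 := by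
  have hQ0 : Q ≠ 0 := by rintro rfl; simp at h0
  have h1 : Q.coeff 1 = Q.derivative.eval 0 := by
    rw [← coeff_zero_eq_eval_zero, coeff_derivative]; simp
  have hdiv := (IsAlgClosed.splits Q).eval_derivative_div_eval_of_ne_zero h0
  set w := (Q.roots.map fun z => 1 / (0 - z)).sum with hw
  have him : w.im ≤ 0 := by
    refine Multiset.sum_induction (fun u : ℂ => u.im ≤ 0) _
      (fun a b ha hb => by simpa using add_nonpos ha hb) (by simp) fun a ha => ?_
    obtain ⟨z, hz, rfl⟩ := Multiset.mem_map.1 ha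
    have hz0 := (mem_roots hQ0).1 hz
    have hzim : z.im ≤ 0 := by
      by_contra h
      exact hQ z (not_le.1 h) hz0
    rw [zero_sub, one_div, Complex.inv_im, Complex.neg_im, neg_neg]
    exact div_nonpos_of_nonpos_of_nonneg hzim (Complex.normSq_nonneg _)
  have e : Q.coeff 0 + t * Q.coeff 1 = Q.eval 0 * (1 + t * w) := by
    rw [h1, ← hdiv, coeff_zero_eq_eval_zero]
    field_simp
  rw [e]
  refine mul_ne_zero h0 fun h => ?_
  have ht0 : t ≠ 0 := by rintro rfl; simp at ht
  have hwt : w = -t⁻¹ := by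
    have : t * w = -1 := by linear_combination h
    field_simp
    linear_combination this
  rw [hwt, Complex.neg_im, Complex.inv_im, neg_div, neg_neg] at him
  exact absurd him (not_le.2 (div_pos ht (Complex.normSq_pos.2 ht0)))

theorem splits_of_forall_im_pos {f : ℝ[X]}
    (h : ∀ x : ℂ, 0 < x.im → (f.map (algebraMap ℝ ℂ)).eval x ≠ 0) : f.Splits := by
  refine Splits.of_splits_map (algebraMap ℝ ℂ) (IsAlgClosed.splits _) fun a ha => ?_
  have ha0 : (f.map (algebraMap ℝ ℂ)).eval a = 0 := (mem_roots'.1 ha).2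
  refine ⟨a.re, ?_⟩
  have him : a.im = 0 := by
    rcases lt_trichotomy a.im 0 with hlt | heq | hgt
    · refine absurd ?_ (h (starRingEnd ℂ a) (by simpa using hlt))
      rw [eval_map_algebraMap] at ha0 ⊢
      rw [aeval_conj, ha0, map_zero]
    · exact heq
    · exact absurd ha0 (h a hgt)
  exact Complex.ext (by simp) (by simp [him])

section Stability

variable {I J : Type*} [Fintype I] [Fintype J] [DecidableEq I] [DecidableEq J]
  {r : I → J → Prop} [DecidableRel r]

theorem matchingForm_ne_zero_of_im_pos (S : Finset J) {y t : ℂ} (hy : 0 < y.im) (ht : 0 < t.im)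
    {z : J → ℂ} (hz : ∀ j, 0 < (z j).im ∨ z j = 0) : matchingForm r S y t z ≠ 0 := by
  induction S using Finset.induction_on generalizing z with
  | empty =>
    rw [matchingForm, relMatchings_empty, Finset.sum_singleton]
    simp only [Finset.card_empty, pow_zero, one_mul]
    refine Finset.prod_ne_zero_iff.2 fun i _ h => ?_
    have him := congrArg Complex.im h
    rw [Complex.add_im, Complex.im_sum, Complex.zero_im] at him
    have : ∀ j, 0 ≤ (z j).im := fun j => by
      rcases hz j with h | h
      · exact h.le
      · simp [h]
    exact (add_pos_of_pos_of_nonneg hy (Finset.sum_nonneg fun j _ => this j)).ne' him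
  | insert j S hj ih =>
    have key : ∀ x : ℂ, 0 < x.im ∨ x = 0 → (matchingFormPoly r S j y t z).eval x ≠ 0 := by
      intro x hx
      rw [eval_matchingFormPoly]
      refine ih fun j' => ?_
      rcases eq_or_ne j' j with rfl | h
      · simpa using hx
      · simpa [h] using hz j'
    rw [matchingForm_insert hj]
    exact coeff_zero_add_mul_coeff_one_ne_zero ht (key 0 (Or.inr rfl)) fun x hx => key x (Or.inl hx)

theorem eventually_im_one_add_mul_I_mul_pos {w : ℂ} (hw : 0 < w.im ∨ w.im = 0 ∧ 0 < w.re) :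
    ∀ᶠ ε : ℝ in nhdsWithin 0 (Set.Ioi 0), 0 < ((1 + ε * Complex.I) * w).im := by
  rcases hw with hw | ⟨h0, hw⟩
  · have hc : ContinuousAt (fun ε : ℝ => ((1 + ε * Complex.I) * w).im) 0 := by fun_prop
    have h : ∀ᶠ ε : ℝ in nhds 0, 0 < ((1 + ε * Complex.I) * w).im :=
      hc.eventually (lt_mem_nhds (by simpa using hw))
    exact h.filter_mono nhdsWithin_le_nhds
  · filter_upwards [self_mem_nhdsWithin] with ε hε
    have hε : 0 < ε := hε
    simp [h0]
    positivity

theorem matchingForm_ne_zero (S : Finset J) {y t : ℂ} {z : J → ℂ}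
    (hy : 0 < y.im ∨ y.im = 0 ∧ 0 < y.re) (ht : 0 < t.im ∨ t.im = 0 ∧ 0 < t.re)
    (hz : ∀ j, 0 < (z j).im ∨ (z j).im = 0 ∧ 0 < (z j).re) : matchingForm r S y t z ≠ 0 := by
  have h := (eventually_im_one_add_mul_I_mul_pos hy).and
    ((eventually_im_one_add_mul_I_mul_pos ht).and
      (Filter.eventually_all.2 fun j => eventually_im_one_add_mul_I_mul_pos (hz j)))
  obtain ⟨ε, h1, h2, h3⟩ := h.exists
  have := matchingForm_ne_zero_of_im_pos (r := r) S h1 h2 fun j => Or.inl (h3 j)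
  rw [matchingForm_mul] at this
  exact right_ne_zero_of_mul this

theorem splits_matchingFormPoly (S : Finset J) (j : J) {t : ℝ} (ht : 0 < t) {z : J → ℝ}
    (hz : ∀ j, 0 < z j) : (matchingFormPoly r S j 1 t z).Splits := by
  refine splits_of_forall_im_pos fun x hx => ?_
  rw [map_matchingFormPoly, eval_matchingFormPoly]
  refine matchingForm_ne_zero S (Or.inr (by simp)) (Or.inr (by simpa using ht)) fun j' => ?_
  rcases eq_or_ne j' j with rfl | h
  · left; simpa using hx
  · right; simpa [h] using hz j'

theorem splits_matchingForm_X (z : J → ℝ) :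
    (matchingForm r Finset.univ 1 X fun j => C (z j) : ℝ[X]).Splits := by
  refine splits_of_forall_im_pos fun x hx => ?_
  rw [← coe_mapRingHom, ← coe_evalRingHom, map_matchingForm, map_matchingForm]
  have e : ∀ (y t : ℂ) (z z' : J → ℂ), matchingForm r Finset.univ y t z =
      matchingForm r Finset.univ y t z' := by
    intro y t z z'; simp [matchingForm]
  rw [e _ _ _ fun _ => 1]
  refine matchingForm_ne_zero _ (Or.inr (by simp)) (Or.inl (by simpa using hx)) fun _ => ?_
  right; simp

theorem matchingForm_pos (S : Finset J) {y t : ℝ} (hy : 0 < y) (ht : 0 ≤ t) {z : J → ℝ}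
    (hz : ∀ j, 0 ≤ z j) : 0 < matchingForm r S y t z := by
  have hlin : ∀ i, 0 < y + ∑ j ∈ Sᶜ with r i j, z j := fun i =>
    add_pos_of_pos_of_nonneg hy (Finset.sum_nonneg fun j _ => hz j)
  refine Finset.sum_pos' (fun M _ => ?_) ⟨∅, empty_mem_relMatchings S, ?_⟩
  · exact mul_nonneg (pow_nonneg ht _) (Finset.prod_nonneg fun i _ => (hlin i).le)
  · simpa using Finset.prod_pos fun i _ => hlin i

end Stability

theorem Multiset.prod_one_add_le_pow_s1 (B : Multiset ℝ) (hB : ∀ b ∈ B, 0 ≤ b) {d : ℕ}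
    (hd : B.card ≤ d) : (B.map fun b => 1 + b).prod ≤ (1 + B.sum / d) ^ d := by
  set m := 1 + B.sum / d with hm
  have hS : 0 ≤ B.sum := Multiset.sum_nonneg hB
  have hm1 : 1 ≤ m := by rw [hm]; linarith [div_nonneg hS (Nat.cast_nonneg (α := ℝ) d)]
  have hm0 : 0 < m := by linarith
  have key : (B.map fun b => 1 + b).prod ≤
      m ^ B.card * Real.exp ((B.card * (1 - m) + B.sum) / m) := by
    clear hd hS hm
    clear_value m
    induction B using Multiset.induction with
    | empty => simp
    | cons b B ih =>
      have ih := ih fun c hc => hB c (Multiset.mem_cons_of_mem hc)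
      have hb := hB b (Multiset.mem_cons_self _ _)
      simp only [Multiset.map_cons, Multiset.prod_cons, Multiset.card_cons, Multiset.sum_cons]
      have h1 : 1 + b ≤ m * Real.exp ((1 - m + b) / m) := by
        have := Real.add_one_le_exp ((1 - m + b) / m)
        have e : m * ((1 - m + b) / m + 1) = 1 + b := by field_simp; ring
        rw [← e]
        exact mul_le_mul_of_nonneg_left this hm0.le
      calc (1 + b) * (B.map fun b => 1 + b).prod
          ≤ (m * Real.exp ((1 - m + b) / m)) *
            (m ^ B.card * Real.exp ((B.card * (1 - m) + B.sum) / m)) := by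
            refine mul_le_mul h1 ih (Multiset.prod_nonneg ?_) (by positivity)
            intro a ha
            obtain ⟨c, hc, rfl⟩ := Multiset.mem_map.1 ha
            linarith [hB c (Multiset.mem_cons_of_mem hc)]
        _ = _ := by
            rw [mul_mul_mul_comm, ← Real.exp_add, ← pow_succ']
            congr 2
            push_cast
            ring
  refine key.trans ?_
  obtain ⟨e, rfl⟩ := Nat.exists_eq_add_of_le hd
  rcases Nat.eq_zero_or_pos (B.card + e) with h0 | hpos
  · obtain ⟨h1, h2⟩ := Nat.add_eq_zero_iff.1 h0
    rw [Multiset.card_eq_zero] at h1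
    subst h1 h2
    simp
  have hsum : B.sum = (B.card + e) * (m - 1) := by
    have : ((B.card + e : ℕ) : ℝ) ≠ 0 := by exact_mod_cast hpos.ne'
    rw [hm]
    push_cast at this ⊢
    field_simp
    ring
  have hexp : Real.exp ((m - 1) / m) ≤ m := by
    have := Real.add_one_le_exp (-((m - 1) / m))
    rw [Real.exp_neg] at this
    have e : -((m - 1) / m) + 1 = m⁻¹ := by field_simp; ring
    rw [e] at this
    exact (inv_le_inv₀ hm0 (Real.exp_pos _)).1 this
  rw [pow_add]
  refine mul_le_mul_of_nonneg_left ?_ (by positivity)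
  have e' : (B.card * (1 - m) + B.sum) / m = e * ((m - 1) / m) := by rw [hsum]; ring
  rw [e', Real.exp_nat_mul]
  exact pow_le_pow_left₀ (Real.exp_pos _).le hexp e

theorem Real.rpow_self_pos {x : ℝ} (hx : 0 ≤ x) : 0 < x ^ x := by
  rcases hx.eq_or_lt with rfl | h
  · simp
  · exact Real.rpow_pos_of_pos h _

theorem mul_rpow_le_one_add {p y : ℝ} (hp : 0 < p) (hp1 : p ≤ 1) (hy : 0 ≤ y) :
    ((1 - p) ^ (1 - p))⁻¹ * (p ^ p)⁻¹ * y ^ p ≤ 1 + y := by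
  have hq : 0 ≤ 1 - p := sub_nonneg.2 hp1
  have h := Real.geom_mean_le_arith_mean2_weighted hq hp.le (inv_nonneg.2 hq)
    (div_nonneg hy hp.le) (by ring)
  rw [Real.inv_rpow hq, Real.div_rpow hy hp.le, mul_div_cancel₀ _ hp.ne'] at h
  have h1 : (1 - p) * (1 - p)⁻¹ ≤ 1 := mul_inv_le_one
  calc _ = ((1 - p) ^ (1 - p))⁻¹ * (y ^ p / p ^ p) := by ring
    _ ≤ _ := h
    _ ≤ _ := by linarith

theorem mul_le_coeff_zero_add_mul_coeff_one {f : ℝ[X]} (hf : f.Splits) (h0 : 0 < f.coeff 0)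
    (hpos : ∀ x : ℝ, 0 ≤ x → 0 < f.eval x) {d : ℕ} (hd : f.natDegree ≤ d) {p : ℝ} (hp : 0 < p)
    (hp1 : p ≤ 1) (hd1 : 1 ≤ d) {K t : ℝ} (hK : 0 < K) (ht : 0 < t)
    (h : ∀ x : ℝ, 0 < x → K * x ^ p ≤ f.eval x) :
    K * (t ^ p * ((d : ℝ) ^ p * ((1 - p) ^ (1 - p))⁻¹ * ((d : ℝ) - p) ^ ((d : ℝ) - p) /
      (d : ℝ) ^ (d : ℝ))) ≤ f.coeff 0 + t * f.coeff 1 := by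
  obtain ⟨B, hB, hfac, hBpos⟩ := exists_pos_factorization hf h0 hpos
  obtain ⟨-, h1, -⟩ := coeff_prod_one_add B
  set c := f.coeff 0 with hc
  have e1 : f.coeff 1 = c * B.sum := by rw [hfac, coeff_C_mul, h1]
  have hdpos : (0 : ℝ) < d := by exact_mod_cast hd1
  have hd1' : (1 : ℝ) ≤ d := by exact_mod_cast hd1
  set β := B.sum / d with hβ
  have hS : 0 ≤ B.sum := Multiset.sum_nonneg fun b hb => (hBpos b hb).le
  have hβ0 : 0 ≤ β := div_nonneg hS hdpos.le
  have hSβ : B.sum = d * β := by rw [hβ]; field_simp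
  have hup : ∀ x : ℝ, 0 < x → f.eval x ≤ c * (1 + β * x) ^ d := by
    intro x hx
    have := Multiset.prod_one_add_le_pow_s1 (B.map fun b => b * x) (fun b hb => by
      obtain ⟨b', hb', rfl⟩ := Multiset.mem_map.1 hb
      exact mul_nonneg (hBpos b' hb').le hx.le) (d := d) (by simpa [hB] using hd)
    rw [Multiset.map_map, Multiset.sum_map_mul_right, Multiset.map_id', mul_div_right_comm] at this
    rw [hfac, eval_mul, eval_C, eval_multiset_prod, Multiset.map_map]
    refine mul_le_mul_of_nonneg_left ?_ h0.le
    have e : (eval x ∘ fun b : ℝ => 1 + C b * X) = (fun b => 1 + b) ∘ fun b => b * x := by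
      ext b; simp
    rw [e]
    exact this
  have hβpos : 0 < β := by
    refine lt_of_le_of_ne hβ0 fun hz => ?_
    have hx : 0 < 2 * c / K := by positivity
    have h2 := (h _ (Real.rpow_pos_of_pos hx p⁻¹)).trans (hup _ (Real.rpow_pos_of_pos hx p⁻¹))
    rw [← Real.rpow_mul hx.le, inv_mul_cancel₀ hp.ne', Real.rpow_one, ← hz,
      mul_div_cancel₀ _ hK.ne'] at h2
    simp at h2
    linarith
  have hT := mul_rpow_le_of_forall_mul_rpow_le (a := c) (D := K / β ^ p) hp (hp1.trans hd1')
    (fun v hv => by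
      have h2 := (h (v / β) (by positivity)).trans (hup (v / β) (by positivity))
      rw [Real.div_rpow hv.le hβ0, mul_div_cancel₀ _ hβpos.ne'] at h2
      rw [Real.rpow_natCast]
      calc _ = K * (v ^ p / β ^ p) := by ring
        _ ≤ _ := h2)
  have hW := mul_rpow_le_one_add hp hp1 (show 0 ≤ t * (d * β) by positivity)
  rw [Real.mul_rpow ht.le (by positivity), Real.mul_rpow hdpos.le hβ0] at hW
  rw [e1, hSβ]
  have p1 : 0 < (1 - p) ^ (1 - p) := Real.rpow_self_pos (sub_nonneg.2 hp1)
  have p2 : 0 < p ^ p := Real.rpow_self_pos hp.le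
  have p3 : 0 < β ^ p := Real.rpow_pos_of_pos hβpos _
  have p4 : 0 < (d : ℝ) ^ p := Real.rpow_pos_of_pos hdpos _
  have p5 : 0 < t ^ p := Real.rpow_pos_of_pos ht _
  have p6 : 0 < (d : ℝ) ^ (d : ℝ) := Real.rpow_self_pos hdpos.le
  generalize (1 - p) ^ (1 - p) = q at *
  generalize ((d : ℝ) - p) ^ ((d : ℝ) - p) = D at *
  generalize (d : ℝ) ^ (d : ℝ) = F at *
  generalize p ^ p = P at *
  generalize β ^ p = b at *
  generalize (d : ℝ) ^ p = A at *
  generalize t ^ p = T at *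
  have hT' : K * (D / F) ≤ c * (b / P) := by
    rw [mul_div_assoc', mul_div_assoc', div_le_div_iff₀ p6 p2]
    have := mul_le_mul_of_nonneg_right hT p3.le
    calc K * D * P = K / b * (P * D) * b := by field_simp
      _ ≤ _ := this
      _ = _ := by ring
  calc K * (T * (A * q⁻¹ * D / F)) = (T * A * q⁻¹) * (K * (D / F)) := by ring
    _ ≤ (T * A * q⁻¹) * (c * (b / P)) := mul_le_mul_of_nonneg_left hT' (by positivity)
    _ = c * (q⁻¹ * P⁻¹ * (T * (A * b))) := by ring
    _ ≤ c * (1 + t * (d * β)) := mul_le_mul_of_nonneg_left hW h0.le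
    _ = _ := by ring

section Capacity

variable {I J : Type*} [Fintype I] [Fintype J] [DecidableEq I] [DecidableEq J]
  {r : I → J → Prop} [DecidableRel r]

theorem capacity_le_matchingForm {d : ℕ} (hd : 1 ≤ d)
    (hrow : ∀ i, (Finset.univ.filter fun j => r i j).card = d)
    (hcol : ∀ j, (Finset.univ.filter fun i => r i j).card = d) {p : ℝ} (hp : 0 < p) (hp1 : p ≤ 1)
    {t : ℝ} (ht : 0 < t) (S : Finset J) {z : J → ℝ} (hz : ∀ j, 0 < z j) :
    (((1 - p) ^ (1 - p))⁻¹ * (p ^ p)⁻¹ * (d : ℝ) ^ p) ^ Fintype.card I *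
      (t ^ p * ((d : ℝ) ^ p * ((1 - p) ^ (1 - p))⁻¹ * ((d : ℝ) - p) ^ ((d : ℝ) - p) /
        (d : ℝ) ^ (d : ℝ))) ^ S.card * ∏ j ∈ Sᶜ, z j ^ p ≤ matchingForm r S 1 t z := by
  have hdpos : (0 : ℝ) < d := by exact_mod_cast hd
  have hd1 : (1 : ℝ) ≤ d := by exact_mod_cast hd
  have p1 : 0 < (1 - p) ^ (1 - p) := Real.rpow_self_pos (sub_nonneg.2 hp1)
  have p2 : 0 < p ^ p := Real.rpow_self_pos hp.le
  have p4 : 0 < (d : ℝ) ^ p := Real.rpow_pos_of_pos hdpos _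
  have p5 : 0 < t ^ p := Real.rpow_pos_of_pos ht _
  have p6 : 0 < (d : ℝ) ^ (d : ℝ) := Real.rpow_self_pos hdpos.le
  have p7 : 0 < ((d : ℝ) - p) ^ ((d : ℝ) - p) := Real.rpow_self_pos (by linarith)
  induction S using Finset.induction_on generalizing z with
  | empty =>
    rw [matchingForm, relMatchings_empty, Finset.sum_singleton]
    simp only [Finset.card_empty, pow_zero, one_mul, mul_one, Finset.compl_empty,
      Finset.image_empty]
    have hprod : ∏ j, z j ^ p = ∏ i : I, ∏ j with r i j, z j ^ (p / d) := by
      simp only [Finset.prod_filter]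
      rw [Finset.prod_comm]
      refine Finset.prod_congr rfl fun j _ => ?_
      rw [← Finset.prod_filter, Finset.prod_const, hcol, ← Real.rpow_natCast,
        ← Real.rpow_mul (hz j).le, div_mul_cancel₀ _ hdpos.ne']
    rw [hprod, ← Finset.card_univ, ← Finset.prod_const, ← Finset.prod_mul_distrib]
    refine Finset.prod_le_prod (fun i _ => ?_) fun i _ => ?_
    · exact mul_nonneg (by positivity)
        (Finset.prod_nonneg fun j _ => Real.rpow_nonneg (hz j).le _)
    · have hsum0 : 0 ≤ ∑ j with r i j, z j := Finset.sum_nonneg fun j _ => (hz j).le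
      refine le_trans ?_ (mul_rpow_le_one_add hp hp1 hsum0)
      rw [mul_assoc]
      refine mul_le_mul_of_nonneg_left ?_ (by positivity)
      have hgm := Real.geom_mean_le_arith_mean_weighted (Finset.univ.filter fun j => r i j)
        (fun _ => (d : ℝ)⁻¹) z (fun _ _ => by positivity)
        (by rw [Finset.sum_const, hrow, nsmul_eq_mul, mul_inv_cancel₀ hdpos.ne'])
        (fun j _ => (hz j).le)
      rw [← Finset.mul_sum] at hgm
      have hg0 : 0 ≤ ∏ j with r i j, z j ^ (d : ℝ)⁻¹ :=
        Finset.prod_nonneg fun j _ => Real.rpow_nonneg (hz j).le _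
      have h1 : (d : ℝ) * ∏ j with r i j, z j ^ (d : ℝ)⁻¹ ≤ ∑ j with r i j, z j := by
        have := mul_le_mul_of_nonneg_left hgm hdpos.le
        rwa [← mul_assoc, mul_inv_cancel₀ hdpos.ne', one_mul] at this
      have h2 := Real.rpow_le_rpow (by positivity) h1 hp.le
      rw [Real.mul_rpow hdpos.le hg0,
        ← Real.finsetProd_rpow _ _ (fun j _ => Real.rpow_nonneg (hz j).le _)] at h2
      refine le_trans (le_of_eq ?_) h2
      congr 1
      refine Finset.prod_congr rfl fun j _ => ?_
      rw [← Real.rpow_mul (hz j).le, div_eq_inv_mul]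
  | insert j S hj ih =>
    rw [matchingForm_insert hj, Finset.card_insert_of_notMem hj, pow_succ]
    set G := (((1 - p) ^ (1 - p))⁻¹ * (p ^ p)⁻¹ * (d : ℝ) ^ p) ^ Fintype.card I with hG
    set H := t ^ p * ((d : ℝ) ^ p * ((1 - p) ^ (1 - p))⁻¹ * ((d : ℝ) - p) ^ ((d : ℝ) - p) /
        (d : ℝ) ^ (d : ℝ)) with hH
    have hGpos : 0 < G := by positivity
    have hHpos : 0 < H := by positivity
    have hevalpos : ∀ x : ℝ, 0 ≤ x → 0 < (matchingFormPoly r S j 1 t z).eval x := by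
      intro x hx
      rw [eval_matchingFormPoly]
      refine matchingForm_pos S one_pos ht.le fun j' => ?_
      rcases eq_or_ne j' j with rfl | h
      · simpa using hx
      · simpa [h] using (hz j').le
    have hP : 0 < ∏ j' ∈ (insert j S)ᶜ, z j' ^ p :=
      Finset.prod_pos fun j' _ => Real.rpow_pos_of_pos (hz j') _
    have := mul_le_coeff_zero_add_mul_coeff_one (splits_matchingFormPoly (r := r) S j ht hz)
      (by rw [coeff_zero_eq_eval_zero]; exact hevalpos 0 le_rfl) hevalpos
      ((natDegree_matchingFormPoly_le hj 1 t z).trans_eq (hcol j)) hp hp1 hd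
      (K := G * H ^ S.card * ∏ j' ∈ (insert j S)ᶜ, z j' ^ p) (by positivity) ht (fun x hx => by
        rw [eval_matchingFormPoly]
        have h1 := ih (z := Function.update z j x) fun j' => by
          rcases eq_or_ne j' j with rfl | h
          · simpa using hx
          · simpa [h] using hz j'
        refine le_trans (le_of_eq ?_) h1
        have hS : Sᶜ = insert j (insert j S)ᶜ := by
          ext x; by_cases h : x = j <;> simp [h, hj]
        rw [hS, Finset.prod_insert (by simp), Function.update_self]
        have e : ∏ j' ∈ (insert j S)ᶜ, Function.update z j x j' ^ p =
            ∏ j' ∈ (insert j S)ᶜ, z j' ^ p := by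
          refine Finset.prod_congr rfl fun j' hj' => ?_
          have : j' ≠ j := by rintro rfl; simp at hj'
          rw [Function.update_of_ne this]
        rw [e]
        ring)
    refine le_trans (le_of_eq ?_) this
    rw [← hH]
    ring

end Capacity

theorem choose_mul_pow_mul_pow_le_one {n k : ℕ} (hkn : k ≤ n) {p : ℝ} (hp : 0 ≤ p) (hp1 : p ≤ 1) :
    n.choose k * (p ^ k * (1 - p) ^ (n - k)) ≤ 1 := by
  have hq : 0 ≤ 1 - p := sub_nonneg.2 hp1
  have h := add_pow p (1 - p) n
  rw [add_sub_cancel, one_pow] at h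
  rw [mul_comm]
  refine le_trans ?_ h.symm.le
  exact Finset.single_le_sum (f := fun m => p ^ m * (1 - p) ^ (n - m) * (n.choose m : ℝ))
    (fun m _ => by positivity) (Finset.mem_range.2 (Nat.lt_succ_of_le hkn))

section Count

variable {I J : Type*} [Fintype I] [Fintype J] [DecidableEq I] [DecidableEq J]
  {r : I → J → Prop} [DecidableRel r]

theorem matchingForm_univ_X (z : J → ℝ) :
    (matchingForm r Finset.univ 1 X fun j => C (z j) : ℝ[X]) =
      ∑ M ∈ relMatchings r Finset.univ, X ^ M.card := by
  simp [matchingForm]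

theorem coeff_matchingForm_univ_X (z : J → ℝ) (k : ℕ) :
    (matchingForm r Finset.univ 1 X fun j => C (z j) : ℝ[X]).coeff k =
      ((relMatchings r Finset.univ).filter fun M => M.card = k).card := by
  rw [matchingForm_univ_X, finsetSum_coeff, Finset.card_filter]
  simp only [coeff_X_pow, eq_comm]
  push_cast
  rfl

theorem lower_bound_card_relMatchings {d n k : ℕ} (hd : 1 ≤ d)
    (hrow : ∀ i, (Finset.univ.filter fun j => r i j).card = d)
    (hcol : ∀ j, (Finset.univ.filter fun i => r i j).card = d)
    (hI : Fintype.card I = n) (hJ : Fintype.card J = n) (hk1 : 1 ≤ k) (hkn : k ≤ n)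
    {p : ℝ} (hp : p = (k : ℝ) / n) :
    (n.choose k : ℝ) ^ 2 * (((d : ℝ) - p) / d) ^ ((n : ℝ) * ((d : ℝ) - p))
      * ((d : ℝ) * p) ^ ((n : ℝ) * p) ≤
      ((relMatchings r Finset.univ).filter fun M => M.card = k).card := by
  have hn0 : (0 : ℝ) < n := by exact_mod_cast hk1.trans hkn
  have hk0 : (0 : ℝ) < k := by exact_mod_cast hk1
  have hp0 : 0 < p := by rw [hp]; positivity
  have hp1 : p ≤ 1 := by rw [hp, div_le_one hn0]; exact_mod_cast hkn
  have hq0 : 0 ≤ 1 - p := sub_nonneg.2 hp1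
  have hd0 : (0 : ℝ) < d := by exact_mod_cast hd
  have hd1 : (1 : ℝ) ≤ d := by exact_mod_cast hd
  have hdp : 0 ≤ (d : ℝ) - p := by linarith
  have hnp : (n : ℝ) * p = k := by rw [hp]; field_simp
  have hpn : p * (n : ℝ) = k := by rw [mul_comm, hnp]
  have p1 : 0 < (1 - p) ^ (1 - p) := Real.rpow_self_pos hq0
  have p2 : 0 < p ^ p := Real.rpow_self_pos hp0.le
  have p4 : 0 < (d : ℝ) ^ p := Real.rpow_pos_of_pos hd0 _
  have p5 : 0 < (d : ℝ) ^ ((d : ℝ) - p) := Real.rpow_pos_of_pos hd0 _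
  have p6 : (d : ℝ) ^ (d : ℝ) = (d : ℝ) ^ p * (d : ℝ) ^ ((d : ℝ) - p) := by
    rw [← Real.rpow_add hd0]; congr 1; ring
  have p7 : 0 < ((d : ℝ) - p) ^ ((d : ℝ) - p) := Real.rpow_self_pos hdp
  set f : ℝ[X] := matchingForm r Finset.univ 1 X fun j => C ((fun _ => 1 : J → ℝ) j) with hf
  have hcoeff : ∀ m, f.coeff m = ((relMatchings r Finset.univ).filter fun M => M.card = m).card :=
    coeff_matchingForm_univ_X _
  have hdeg : f.natDegree ≤ n := by
    rw [hf, matchingForm_univ_X]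
    refine natDegree_sum_le_of_forall_le _ _ fun M hM => (natDegree_X_pow_le _).trans ?_
    have := card_add_card_compl_of_mem_relMatchings hM
    omega
  have h0 : 0 < f.coeff 0 := by
    rw [hcoeff]
    exact_mod_cast Finset.card_pos.2
      ⟨∅, Finset.mem_filter.2 ⟨empty_mem_relMatchings _, Finset.card_empty⟩⟩
  have heval : ∀ t : ℝ, 0 < t → ((((1 - p) ^ (1 - p))⁻¹ * (p ^ p)⁻¹ * (d : ℝ) ^ p) ^ n *
      ((d : ℝ) ^ p * ((1 - p) ^ (1 - p))⁻¹ * ((d : ℝ) - p) ^ ((d : ℝ) - p) /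
        (d : ℝ) ^ (d : ℝ)) ^ n) * t ^ k ≤ f.eval t := by
    intro t ht
    have h := capacity_le_matchingForm (r := r) hd hrow hcol hp0 hp1 ht Finset.univ
      (z := fun _ => 1) fun _ => one_pos
    have e : f.eval t = matchingForm r Finset.univ 1 t fun _ => 1 := by
      rw [hf, ← coe_evalRingHom, map_matchingForm]
      simp
    rw [e]
    refine le_trans (le_of_eq ?_) h
    have ht' : t ^ k = (t ^ p) ^ n := by
      rw [← Real.rpow_natCast (t ^ p), ← Real.rpow_mul ht.le, hpn, Real.rpow_natCast]
    rw [hI, Finset.card_univ, hJ, Finset.compl_univ, Finset.prod_empty, ht', mul_one, mul_pow (t ^ p)]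
    ring
  have hmain := choose_mul_le_coeff (splits_matchingForm_X (r := r) _)
    (fun i => by rw [← hf, hcoeff]; exact Nat.cast_nonneg _) h0 hdeg hk1 hkn
    (by rw [p6]; positivity) heval
  rw [← hf, hcoeff] at hmain
  have ek : (k : ℝ) ^ (k : ℝ) = ((n : ℝ) ^ p) ^ n * (p ^ p) ^ n := by
    conv_lhs => rw [← hnp]
    rw [Real.mul_rpow hn0.le hp0.le, mul_comm (n : ℝ) p, Real.rpow_mul hn0.le, Real.rpow_mul hp0.le,
      Real.rpow_natCast, Real.rpow_natCast]
  have enk : ((n : ℝ) - k) ^ ((n : ℝ) - k) =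
      ((n : ℝ) ^ (1 - p)) ^ n * ((1 - p) ^ (1 - p)) ^ n := by
    have : (n : ℝ) - k = n * (1 - p) := by rw [← hnp]; ring
    rw [this, Real.mul_rpow hn0.le hq0, mul_comm (n : ℝ) (1 - p), Real.rpow_mul hn0.le,
      Real.rpow_mul hq0, Real.rpow_natCast, Real.rpow_natCast]
  have en : (n : ℝ) ^ (n : ℝ) = ((n : ℝ) ^ p) ^ n * ((n : ℝ) ^ (1 - p)) ^ n := by
    rw [← mul_pow, ← Real.rpow_add hn0, add_sub_cancel, Real.rpow_one, Real.rpow_natCast]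
  have hchoose : n.choose k * ((p ^ p) ^ n * ((1 - p) ^ (1 - p)) ^ n) ≤ 1 := by
    have e1 : (p ^ p) ^ n = p ^ k := by
      rw [← Real.rpow_natCast (p ^ p), ← Real.rpow_mul hp0.le, hpn, Real.rpow_natCast]
    have e2 : ((1 - p) ^ (1 - p)) ^ n = (1 - p) ^ (n - k) := by
      rw [← Real.rpow_natCast _ n, ← Real.rpow_mul hq0, ← Real.rpow_natCast _ (n - k),
        Nat.cast_sub hkn]
      congr 1
      rw [← hnp]; ring
    rw [e1, e2]
    exact choose_mul_pow_mul_pow_le_one hkn hp0.le hp1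
  have el : (((d : ℝ) - p) / d) ^ ((n : ℝ) * ((d : ℝ) - p)) * ((d : ℝ) * p) ^ ((n : ℝ) * p) =
      (((d : ℝ) - p) ^ ((d : ℝ) - p) / (d : ℝ) ^ ((d : ℝ) - p)) ^ n * ((d : ℝ) ^ p * p ^ p) ^ n := by
    rw [mul_comm (n : ℝ), mul_comm (n : ℝ), Real.rpow_mul (div_nonneg hdp hd0.le),
      Real.rpow_mul (by positivity), Real.rpow_natCast, Real.rpow_natCast,
      Real.div_rpow hdp hd0.le, Real.mul_rpow hd0.le hp0.le]
  rw [ek, enk, en, p6] at hmain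
  rw [mul_assoc, el]
  have n1 : 0 < (n : ℝ) ^ p := Real.rpow_pos_of_pos hn0 _
  have n2 : 0 < (n : ℝ) ^ (1 - p) := Real.rpow_pos_of_pos hn0 _
  have hch : (0 : ℝ) ≤ n.choose k := Nat.cast_nonneg _
  generalize (1 - p) ^ (1 - p) = q at *
  generalize ((d : ℝ) - p) ^ ((d : ℝ) - p) = D at *
  generalize (d : ℝ) ^ ((d : ℝ) - p) = F at *
  generalize p ^ p = a at *
  generalize (d : ℝ) ^ p = A at *
  generalize (n : ℝ) ^ p = N at *
  generalize (n : ℝ) ^ (1 - p) = N' at *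
  generalize (n.choose k : ℝ) = c at *
  have hmain' : c * (A * D / (q * F)) ^ n ≤
      ((relMatchings r Finset.univ).filter fun M => M.card = k).card := by
    refine le_of_mul_le_mul_right (le_trans (le_of_eq ?_) hmain) (show 0 < N ^ n * N' ^ n by positivity)
    simp only [← mul_pow, mul_assoc]
    congr 2
    field_simp
  refine le_trans ?_ hmain'
  calc c ^ 2 * ((D / F) ^ n * (A * a) ^ n)
      = (c * (A * D / (q * F)) ^ n) * (c * (a ^ n * q ^ n)) := by
        simp only [mul_pow, div_pow]
        field_simp
    _ ≤ (c * (A * D / (q * F)) ^ n) * 1 :=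
        mul_le_mul_of_nonneg_left hchoose (by positivity)
    _ = _ := mul_one _

end Count

theorem card_relMatchings_le_matchCount {V : Type*} [Fintype V] [DecidableEq V]
    (G : SimpleGraph V) [DecidableRel G.Adj] (P : V → Prop) [DecidablePred P] (k : ℕ) :
    ((relMatchings (fun (i : {v // P v}) (j : {v // ¬P v}) => G.Adj i j)
      Finset.univ).filter fun M => M.card = k).card ≤ matchCount G k := by
  set φ : {v // P v} × {v // ¬P v} → Sym2 V := fun e => s(e.1.1, e.2.1) with hφ
  have hmem : ∀ e f v, v ∈ φ e → v ∈ φ f → e.1 = f.1 ∨ e.2 = f.2 := by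
    rintro ⟨⟨a, ha⟩, ⟨b, hb⟩⟩ ⟨⟨a', ha'⟩, ⟨b', hb'⟩⟩ v h1 h2
    simp only [hφ, Sym2.mem_iff] at h1 h2
    simp only [Subtype.mk.injEq]
    rcases h1 with rfl | rfl <;> rcases h2 with rfl | rfl
    · exact Or.inl rfl
    · exact absurd ha hb'
    · exact absurd ha' hb
    · exact Or.inr rfl
  have hinj : Function.Injective φ := by
    rintro ⟨⟨a, ha⟩, ⟨b, hb⟩⟩ ⟨⟨a', ha'⟩, ⟨b', hb'⟩⟩ h
    simp only [hφ, Sym2.eq_iff] at h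
    rcases h with ⟨rfl, rfl⟩ | ⟨rfl, rfl⟩
    · rfl
    · exact absurd ha hb'
  rw [matchCount, ← Nat.card_eq_finsetCard]
  refine Nat.card_le_card_of_injective
    (fun M => ⟨M.1.image φ, ?_, ?_, ?_⟩) fun M M' h => ?_
  · obtain ⟨M, hM⟩ := M
    rw [Finset.mem_filter, mem_relMatchings] at hM
    intro e he
    obtain ⟨x, hx, rfl⟩ := Finset.mem_image.1 (Finset.mem_coe.1 he)
    exact (hM.1.1 x hx).1
  · rw [Finset.card_image_of_injective _ hinj]
    exact (Finset.mem_filter.1 M.2).2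
  · obtain ⟨M, hM⟩ := M
    rw [Finset.mem_filter, mem_relMatchings] at hM
    intro e he f hf hne v hve hvf
    obtain ⟨x, hx, rfl⟩ := Finset.mem_image.1 he
    obtain ⟨y, hy, rfl⟩ := Finset.mem_image.1 hf
    rcases hmem x y v hve hvf with h | h
    · exact hne (congrArg φ (hM.1.2.1 x hx y hy h))
    · exact hne (congrArg φ (hM.1.2.2 x hx y hy h))
  · exact Subtype.ext (Finset.image_injective hinj (Subtype.ext_iff.1 h))

end

/-- **Friedland's Lower Matching Conjecture.** For a `d`-regular bipartite simple graph
on `2n` vertices and `1 ≤ k ≤ n`, with `p = k/n`, the number of `k`-matchings is at least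
`binom(n,k)^2 ((d-p)/d)^(n(d-p)) (dp)^(np)`. -/
theorem lower_matching_conjecture {V : Type*} [Fintype V] (d n : ℕ) (hd : 1 ≤ d) (hn : 1 ≤ n)
    (G : SimpleGraph V) [DecidableRel G.Adj]
    (hcard : Fintype.card V = 2 * n)
    (hreg : G.IsRegularOfDegree d) (hbip : G.Colorable 2)
    (k : ℕ) (hk1 : 1 ≤ k) (hkn : k ≤ n) (p : ℝ) (hp : p = (k : ℝ) / n) :
    (n.choose k : ℝ) ^ 2 * (((d : ℝ) - p) / d) ^ ((n : ℝ) * ((d : ℝ) - p))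
      * ((d : ℝ) * p) ^ ((n : ℝ) * p) ≤ (matchCount G k : ℝ) := by
  classical
  obtain ⟨c⟩ := hbip
  set r : {v // c v = 0} → {v // ¬c v = 0} → Prop := fun i j => G.Adj i j with hr
  have hrow : ∀ i, (Finset.univ.filter fun j => r i j).card = d := by
    intro i
    rw [← hreg i.1, ← G.card_neighborFinset_eq_degree]
    refine Finset.card_bij (fun j _ => j.1) (fun j hj => ?_) (fun _ _ _ _ h => Subtype.ext h)
      fun v hv => ?_
    · simpa [hr] using hj
    · have hadj : G.Adj i v := by simpa using hv
      exact ⟨⟨v, fun h => c.valid hadj (i.2.trans h.symm)⟩, by simpa [hr] using hadj, rfl⟩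
  have hcol : ∀ j, (Finset.univ.filter fun i => r i j).card = d := by
    intro j
    rw [← hreg j.1, ← G.card_neighborFinset_eq_degree]
    refine Finset.card_bij (fun i _ => i.1) (fun i hi => ?_) (fun _ _ _ _ h => Subtype.ext h)
      fun v hv => ?_
    · simpa [hr, G.adj_comm] using hi
    · have hadj : G.Adj j v := by simpa using hv
      have hne := c.valid hadj
      have hj := j.2
      exact ⟨⟨v, by omega⟩, by simpa [hr, G.adj_comm] using hadj, rfl⟩
  have hdouble := Finset.sum_card_bipartiteAbove_eq_sum_card_bipartiteBelow
    (s := Finset.univ) (t := Finset.univ) r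
  simp only [Finset.bipartiteAbove, Finset.bipartiteBelow, hrow, hcol, Finset.sum_const,
    Finset.card_univ, smul_eq_mul] at hdouble
  have heq := Nat.eq_of_mul_eq_mul_right hd hdouble
  have hcompl := Fintype.card_subtype_compl fun v => c v = 0
  have hle := Fintype.card_subtype_le fun v => c v = 0
  have hI : Fintype.card {v // c v = 0} = n := by omega
  refine (lower_bound_card_relMatchings hd hrow hcol hI (heq ▸ hI) hk1 hkn hp).trans ?_
  exact_mod_cast card_relMatchings_le_matchCount G (fun v => c v = 0) k
end

section
/- Let d ≥ 1 and n ≥ 1 be integers, let G be a d-regular bipartite simple graph on 2n vertices, let 1 ≤ k ≤ n, and set p = k/n and p_μ = binom(n,k)·p^k·(1−p)^{n−k}. Then m_k(G) ≥ p_μ · exp(2n·Γ_d(p)). -/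
/-- The entropy function `Γ_d(p)` of the infinite `d`-regular tree.
(In Lean, `Real.log 0 = 0`, which implements the convention `0 · ln 0 = 0`.) -/
noncomputable def Gammad (d : ℕ) (p : ℝ) : ℝ :=
  (1 / 2) * (p * Real.log ((d : ℝ) / p) + ((d : ℝ) - p) * Real.log (1 - p / d)
    - 2 * (1 - p) * Real.log (1 - p))

section MonomerDimer

variable {L R : Type*} [DecidableEq R]

/-- The monomer-dimer partition function of the bipartite graph with classes `l` and `B`:
a matching has weight the product of `A u x` over its edges, `y u` over the vertices `u` of `l`
it misses and `w x` over the vertices `x` of `B` it misses. -/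
def monomerDimer (A : L → R → ℝ) (y : L → ℝ) (w : R → ℝ) : List L → Finset R → ℝ
  | [], B => ∏ x ∈ B, w x
  | u :: l, B => y u * monomerDimer A y w l B + ∑ x ∈ B, A u x * monomerDimer A y w l (B.erase x)

namespace monomerDimer

variable {A : L → R → ℝ} {y : L → ℝ} {w : R → ℝ}

theorem nonneg (hA : ∀ u x, 0 ≤ A u x) (hy : ∀ u, 0 ≤ y u) (hw : ∀ x, 0 ≤ w x)
    (l : List L) (B : Finset R) : 0 ≤ monomerDimer A y w l B := by
  induction l generalizing B with
  | nil => exact Finset.prod_nonneg fun x _ => hw x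
  | cons u l ih =>
    exact add_nonneg (mul_nonneg (hy u) (ih B))
      (Finset.sum_nonneg fun x _ => mul_nonneg (hA u x) (ih _))

theorem perm {l l' : List L} (h : l.Perm l') (B : Finset R) :
    monomerDimer A y w l B = monomerDimer A y w l' B := by
  induction h generalizing B with
  | nil => rfl
  | cons u _ ih => simp only [monomerDimer, ih]
  | trans _ _ ih₁ ih₂ => rw [ih₁, ih₂]
  | swap a b l =>
    have key : ∑ x ∈ B, ∑ z ∈ B.erase x,
          A b x * (A a z * monomerDimer A y w l ((B.erase x).erase z)) =
        ∑ z ∈ B, ∑ x ∈ B.erase z,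
          A a z * (A b x * monomerDimer A y w l ((B.erase z).erase x)) := by
      rw [Finset.sum_comm' (t' := B) (s' := fun z => B.erase z)]
      · refine Finset.sum_congr rfl fun z _ => Finset.sum_congr rfl fun x _ => ?_
        rw [Finset.erase_right_comm]; ring
      · intro x z
        simp only [Finset.mem_erase]
        tauto
    simp only [monomerDimer, mul_add, Finset.sum_add_distrib, Finset.mul_sum]
    rw [key]
    simp only [← mul_assoc, mul_comm (A a _) (y b), mul_comm (A b _) (y a), mul_comm (y a) (y b)]
    ring

theorem congr {A' : L → R → ℝ} {y' : L → ℝ} {w' : R → ℝ} {l : List L} {B : Finset R}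
    (hA : ∀ u ∈ l, ∀ x ∈ B, A u x = A' u x) (hy : ∀ u ∈ l, y u = y' u)
    (hw : ∀ x ∈ B, w x = w' x) :
    monomerDimer A y w l B = monomerDimer A' y' w' l B := by
  induction l generalizing B with
  | nil => exact Finset.prod_congr rfl hw
  | cons u l ih =>
    simp only [List.mem_cons, forall_eq_or_imp] at hA hy
    simp only [monomerDimer]
    rw [hy.1, ih hA.2 hy.2 hw]
    congr 1
    refine Finset.sum_congr rfl fun x hx => ?_
    rw [hA.1 x hx, ih (fun u hu z hz => hA.2 u hu z (Finset.mem_of_mem_erase hz)) hy.2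
      (fun z hz => hw z (Finset.mem_of_mem_erase hz))]

/-- Expansion of the partition function along a vertex of the right class. -/
theorem expand_right (l : List L) {B : Finset R} {x : R} (hx : x ∈ B) :
    monomerDimer A y w l B = w x * monomerDimer A y w l (B.erase x) +
      ∑ i : Fin l.length, A l[i] x * monomerDimer A y w (l.eraseIdx i) (B.erase x) := by
  induction l generalizing B with
  | nil => simp [monomerDimer, Finset.mul_prod_erase _ _ hx]
  | cons u l ih =>
    have h1 : ∑ z ∈ B, A u z * monomerDimer A y w l (B.erase z) =
        A u x * monomerDimer A y w l (B.erase x) +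
        ∑ z ∈ B.erase x, A u z * (w x * monomerDimer A y w l ((B.erase x).erase z) +
          ∑ i : Fin l.length,
            A l[i] x * monomerDimer A y w (l.eraseIdx i) ((B.erase x).erase z)) := by
      rw [← Finset.add_sum_erase _ _ hx]
      congr 1
      refine Finset.sum_congr rfl fun z hz => ?_
      rw [Finset.mem_erase] at hz
      rw [ih (Finset.mem_erase.2 ⟨hz.1.symm, hx⟩), Finset.erase_right_comm]
    change _ = _ + ∑ i : Fin (l.length + 1),
      A (u :: l)[(i : ℕ)] x * monomerDimer A y w ((u :: l).eraseIdx i) (B.erase x)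
    rw [monomerDimer, h1, ih hx, Fin.sum_univ_succ]
    simp only [mul_add, Finset.sum_add_distrib, Finset.mul_sum, monomerDimer,
      Fin.getElem_fin, Fin.val_zero, Fin.val_succ, List.getElem_cons_zero,
      List.getElem_cons_succ, List.eraseIdx_cons_zero, List.eraseIdx_cons_succ]
    rw [Finset.sum_comm (s := B.erase x)]
    simp only [mul_left_comm (A u _) (w x), mul_left_comm (A u _) (A _ x),
      mul_left_comm (y u) (A _ x), mul_left_comm (y u) (w x)]
    ring

theorem opposite_of_same (hA : ∀ u x, 0 ≤ A u x) (u : L) (l : List L)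
    {B : Finset R} {v : R} (hv : v ∈ B)
    (h : ∀ x ∈ B, x ≠ v →
      monomerDimer A y w l B * monomerDimer A y w l ((B.erase x).erase v) ≤
        monomerDimer A y w l (B.erase x) * monomerDimer A y w l (B.erase v)) :
    monomerDimer A y w l B * monomerDimer A y w (u :: l) (B.erase v) ≤
      monomerDimer A y w (u :: l) B * monomerDimer A y w l (B.erase v) := by
  simp only [monomerDimer]
  rw [← Finset.add_sum_erase _ _ hv]
  have : monomerDimer A y w l B *
        ∑ x ∈ B.erase v, A u x * monomerDimer A y w l ((B.erase v).erase x) ≤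
      (∑ x ∈ B.erase v, A u x * monomerDimer A y w l (B.erase x)) *
        monomerDimer A y w l (B.erase v) := by
    rw [Finset.mul_sum, Finset.sum_mul]
    refine Finset.sum_le_sum fun x hx => ?_
    rw [Finset.mem_erase] at hx
    have := mul_le_mul_of_nonneg_left (h x hx.2 hx.1) (hA u x)
    rw [Finset.erase_right_comm]
    linarith
  nlinarith [mul_nonneg (hA u v) (mul_self_nonneg (monomerDimer A y w l (B.erase v)))]

/-- Negative correlation of two vertices in the same class. -/
theorem same_side (hA : ∀ u x, 0 ≤ A u x) (l : List L) {B : Finset R} {x v : R}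
    (hx : x ∈ B) (hv : v ∈ B) (hxv : x ≠ v) :
    monomerDimer A y w l B * monomerDimer A y w l ((B.erase x).erase v) ≤
      monomerDimer A y w l (B.erase x) * monomerDimer A y w l (B.erase v) := by
  induction hm : l.length generalizing l B x v with
  | zero =>
    rw [List.length_eq_zero_iff] at hm
    subst hm
    simp only [monomerDimer]
    rw [← Finset.mul_prod_erase B _ hx,
      ← Finset.mul_prod_erase (B.erase v) _ (Finset.mem_erase.2 ⟨hxv, hx⟩),
      Finset.erase_right_comm]
    apply le_of_eq; ring
  | succ m ih =>
    rw [expand_right l hx, expand_right l (Finset.mem_erase.2 ⟨hxv, hx⟩ : x ∈ B.erase v),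
      Finset.erase_right_comm (a := v)]
    have : (∑ i : Fin l.length, A l[i] x * monomerDimer A y w (l.eraseIdx i) (B.erase x)) *
          monomerDimer A y w l ((B.erase x).erase v) ≤
        monomerDimer A y w l (B.erase x) * ∑ i : Fin l.length,
          A l[i] x * monomerDimer A y w (l.eraseIdx i) ((B.erase x).erase v) := by
      rw [Finset.mul_sum, Finset.sum_mul]
      refine Finset.sum_le_sum fun i _ => ?_
      have hlen : (l.eraseIdx i).length = m := by
        rw [List.length_eraseIdx_of_lt i.2]; omega
      have hv' : v ∈ B.erase x := Finset.mem_erase.2 ⟨hxv.symm, hv⟩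
      have h := opposite_of_same (y := y) (w := w) hA l[i] (l.eraseIdx i) hv'
        fun z hz hzv => ih _ hz hv' hzv hlen
      have hp : (l[i] :: l.eraseIdx i).Perm l := List.getElem_cons_eraseIdx_perm i.2
      rw [perm hp, perm hp] at h
      nlinarith [mul_le_mul_of_nonneg_left h (hA l[i] x)]
    nlinarith

/-- Positive correlation of two vertices in opposite classes. -/
theorem opposite_side (hA : ∀ u x, 0 ≤ A u x) (u : L) (l : List L) {B : Finset R} {v : R}
    (hv : v ∈ B) :
    monomerDimer A y w l B * monomerDimer A y w (u :: l) (B.erase v) ≤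
      monomerDimer A y w (u :: l) B * monomerDimer A y w l (B.erase v) :=
  opposite_of_same hA u l hv fun _ hx hxv => same_side hA l hx hv hxv

theorem add_single_right (l : List L) {B : Finset R} {v : R} (hv : v ∈ B) (t : ℝ) :
    monomerDimer A y (w + Pi.single v t) l B =
      monomerDimer A y w l B + t * monomerDimer A y w l (B.erase v) := by
  rw [expand_right l hv, expand_right (w := w) l hv]
  have h : ∀ l' : List L, monomerDimer A y (w + Pi.single v t) l' (B.erase v) =
      monomerDimer A y w l' (B.erase v) := fun l' =>
    congr (fun _ _ _ _ => rfl) (fun _ _ => rfl) fun x hx => by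
      simp [Finset.ne_of_mem_erase hx]
  simp only [h, Pi.add_apply, Pi.single_eq_same]
  ring

variable [DecidableEq L]

theorem add_single_left {u : L} {l : List L} (hu : u ∉ l) (B : Finset R) (s : ℝ) :
    monomerDimer A (y + Pi.single u s) w (u :: l) B =
      monomerDimer A y w (u :: l) B + s * monomerDimer A y w l B := by
  have h : ∀ B' : Finset R, monomerDimer A (y + Pi.single u s) w l B' =
      monomerDimer A y w l B' := fun B' =>
    congr (fun _ _ _ _ => rfl) (fun x hx => by
      have : x ≠ u := fun h => hu (h ▸ hx)
      simp [this]) fun _ _ => rfl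
  simp only [monomerDimer, h, Pi.add_apply, Pi.single_eq_same]
  ring

theorem add_edge {u : L} {l : List L} (hu : u ∉ l) {B : Finset R} {v : R} (hv : v ∈ B) :
    monomerDimer (A + Pi.single u (Pi.single v 1)) y w (u :: l) B =
      monomerDimer A y w (u :: l) B + monomerDimer A y w l (B.erase v) := by
  have h : ∀ B' : Finset R, monomerDimer (A + Pi.single u (Pi.single v 1)) y w l B' =
      monomerDimer A y w l B' := fun B' =>
    congr (fun x hx _ _ => by
      have : x ≠ u := fun h => hu (h ▸ hx)
      simp [this]) (fun _ _ => rfl) fun _ _ => rfl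
  simp only [monomerDimer, h, Pi.add_apply, Pi.single_eq_same, add_mul, Finset.sum_add_distrib]
  rw [Finset.sum_eq_single_of_mem v hv (f := fun x => (Pi.single v (1 : ℝ) : R → ℝ) x * _)
    (fun x _ hx => by simp [hx])]
  simp
  ring

theorem mul_rpow_le_add_mul_one_add {a b c d C α r : ℝ} (ha : 0 ≤ a) (hb : 0 ≤ b) (hc : 0 ≤ c)
    (hd : 0 ≤ d) (hbc : b * c ≤ a * d)
    (h : ∀ s t : ℝ, 0 < s → 0 < t → C * (s * t) ^ α ≤ a + s * b + t * c + s * t * d)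
    (hr : 0 < r) : C * r ^ α ≤ (a + d) * (1 + r) := by
  suffices H : ∀ ε > 0, ∃ s t : ℝ, 0 < s ∧ 0 < t ∧ s * t = r ∧
      s * b + t * c ≤ a * r + d + ε by
    refine le_of_forall_pos_le_add fun ε hε => ?_
    obtain ⟨s, t, hs, ht, rfl, hst⟩ := H ε hε
    linarith [h s t hs ht]
  intro ε hε
  rcases hb.eq_or_lt with rfl | hb'
  · refine ⟨r / (ε / (c + 1)), ε / (c + 1), by positivity, by positivity, by field_simp, ?_⟩
    have : ε / (c + 1) * c ≤ ε := by
      rw [div_mul_eq_mul_div, div_le_iff₀ (by positivity)]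
      nlinarith
    nlinarith [mul_nonneg ha hr.le]
  rcases hc.eq_or_lt with rfl | hc'
  · refine ⟨ε / (b + 1), r / (ε / (b + 1)), by positivity, by positivity, by field_simp, ?_⟩
    have : ε / (b + 1) * b ≤ ε := by
      rw [div_mul_eq_mul_div, div_le_iff₀ (by positivity)]
      nlinarith
    nlinarith [mul_nonneg ha hr.le]
  have hq : √(r * b * c) ^ 2 = r * b * c := Real.sq_sqrt (by positivity)
  have hq0 : 0 < √(r * b * c) := Real.sqrt_pos.2 (by positivity)
  refine ⟨√(r * b * c) / b, √(r * b * c) / c, by positivity, by positivity, ?_, ?_⟩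
  · rw [div_mul_div_comm, ← sq, hq]
    field_simp
  · rw [div_mul_cancel₀ _ hb'.ne', div_mul_cancel₀ _ hc'.ne']
    have : √(r * b * c) + √(r * b * c) ≤ a * r + d := by
      apply le_of_sq_le_sq _ (by positivity)
      nlinarith [mul_le_mul_of_nonneg_left hbc hr.le, sq_nonneg (a * r - d)]
    linarith

theorem mul_entropy_le_add {a b c d C α : ℝ} (ha : 0 ≤ a) (hb : 0 ≤ b) (hc : 0 ≤ c)
    (hd : 0 ≤ d) (hbc : b * c ≤ a * d) (hα : 0 < α) (hα1 : α ≤ 1)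
    (h : ∀ s t : ℝ, 0 < s → 0 < t → C * (s * t) ^ α ≤ a + s * b + t * c + s * t * d) :
    C * (α ^ α * (1 - α) ^ (1 - α)) ≤ a + d := by
  have H := fun r (hr : 0 < r) => mul_rpow_le_add_mul_one_add ha hb hc hd hbc h hr
  rcases hα1.eq_or_lt with rfl | hα1
  · simp only [Real.rpow_one] at H
    simp only [Real.rpow_one, sub_self, Real.rpow_zero, mul_one]
    by_contra! hC
    have hpos : 0 < C - (a + d) := sub_pos.2 hC
    have h1 := H ((a + d + 1) / (C - (a + d))) (by positivity)
    have h2 : (C - (a + d)) * ((a + d + 1) / (C - (a + d))) = a + d + 1 := by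
      field_simp
    nlinarith
  · have hpos : 0 < 1 - α := sub_pos.2 hα1
    have h1 := H (α / (1 - α)) (by positivity)
    have h2 : (1 - α) ^ (1 - α) = (1 - α) / (1 - α) ^ α := by
      rw [Real.rpow_sub hpos, Real.rpow_one]
    rw [Real.div_rpow hα.le hpos.le] at h1
    have h3 : 1 + α / (1 - α) = 1 / (1 - α) := by field_simp; ring
    rw [h3, mul_one_div, le_div_iff₀ hpos] at h1
    rw [h2]
    calc _ = C * (α ^ α / (1 - α) ^ α) * (1 - α) := by ring
      _ ≤ _ := h1

/-- Capacity bound: trading the vertex weights spread along the edges of `T` for the edges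
themselves costs at most a factor `α ^ α * (1 - α) ^ (1 - α)` per edge. -/
theorem capacity_le [Fintype R] {α : ℝ} (hα : 0 < α) (hα1 : α ≤ 1) {l : List L} (hl : l.Nodup)
    (hlmem : ∀ u, u ∈ l) (hA : ∀ u x, 0 ≤ A u x) (hy : ∀ u, 0 ≤ y u) (hw : ∀ x, 0 ≤ w x)
    (T : Finset (L × R)) (K : ℝ)
    (h : ∀ Y Z : L × R → ℝ, (∀ e, 0 < Y e) → (∀ e, 0 < Z e) →
      K * ∏ e ∈ T, (Y e * Z e) ^ α ≤ monomerDimer A (y + ∑ e ∈ T, Pi.single e.1 (Y e))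
        (w + ∑ e ∈ T, Pi.single e.2 (Z e)) l Finset.univ) :
    K * (α ^ α * (1 - α) ^ (1 - α)) ^ T.card ≤
      monomerDimer (A + ∑ e ∈ T, Pi.single e.1 (Pi.single e.2 1)) y w l Finset.univ := by
  induction T using Finset.induction_on generalizing A K with
  | empty => simpa using h 1 1 (fun _ => one_pos) (fun _ => one_pos)
  | insert e T he ih =>
    rw [Finset.sum_insert he, Finset.card_insert_of_notMem he, pow_succ', ← mul_assoc,
      ← add_assoc]
    have hsingle : ∀ u x,
        0 ≤ (Pi.single e.1 (Pi.single e.2 1) : L → R → ℝ) u x := fun u x => by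
      have h1 : (0 : R → ℝ) ≤ Pi.single e.2 1 := Pi.single_nonneg.2 zero_le_one
      exact (Pi.single_nonneg.2 h1 : (0 : L → R → ℝ) ≤ _) u x
    refine ih (A := A + Pi.single e.1 (Pi.single e.2 1))
      (fun u x => add_nonneg (hA u x) (hsingle u x)) _ fun Y Z hY hZ => ?_
    set y' := y + ∑ e ∈ T, Pi.single e.1 (Y e) with hy'
    set w' := w + ∑ e ∈ T, Pi.single e.2 (Z e) with hw'
    have hy0 : ∀ u, 0 ≤ y' u := fun u => by
      rw [hy', Pi.add_apply, Finset.sum_apply]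
      refine add_nonneg (hy u) (Finset.sum_nonneg fun f _ => ?_)
      exact (Pi.single_nonneg.2 (hY f).le : (0 : L → ℝ) ≤ _) u
    have hw0 : ∀ x, 0 ≤ w' x := fun x => by
      rw [hw', Pi.add_apply, Finset.sum_apply]
      refine add_nonneg (hw x) (Finset.sum_nonneg fun f _ => ?_)
      exact (Pi.single_nonneg.2 (hZ f).le : (0 : R → ℝ) ≤ _) x
    have hp : l.Perm (e.1 :: l.erase e.1) := List.perm_cons_erase (hlmem e.1)
    have hnot : e.1 ∉ l.erase e.1 := hl.not_mem_erase
    have hmem : e.2 ∈ Finset.univ := Finset.mem_univ e.2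
    rw [perm hp, add_edge hnot hmem, mul_right_comm]
    refine mul_entropy_le_add
      (b := monomerDimer A y' w' (l.erase e.1) Finset.univ)
      (c := monomerDimer A y' w' (e.1 :: l.erase e.1) (Finset.univ.erase e.2))
      (nonneg hA hy0 hw0 _ _) (nonneg hA hy0 hw0 _ _) (nonneg hA hy0 hw0 _ _)
      (nonneg hA hy0 hw0 _ _) (opposite_side hA _ _ hmem) hα hα1 fun s t hs ht => ?_
    have h1 := h (Function.update Y e s) (Function.update Z e t)
      (fun f => by rcases eq_or_ne f e with rfl | hf <;> simp [*])
      (fun f => by rcases eq_or_ne f e with rfl | hf <;> simp [*])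
    have hne : ∀ f ∈ T, f ≠ e := fun f hf h => he (h ▸ hf)
    rw [Finset.prod_insert he, Finset.sum_insert he, Finset.sum_insert he,
      Finset.prod_congr rfl (fun f hf => by
        rw [Function.update_of_ne (hne f hf), Function.update_of_ne (hne f hf)] :
          ∀ f ∈ T, _ = (Y f * Z f) ^ α),
      Finset.sum_congr rfl (fun f hf => by rw [Function.update_of_ne (hne f hf)] :
          ∀ f ∈ T, _ = (Pi.single f.1 (Y f) : L → ℝ)),
      Finset.sum_congr rfl (fun f hf => by rw [Function.update_of_ne (hne f hf)] :
          ∀ f ∈ T, _ = (Pi.single f.2 (Z f) : R → ℝ)),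
      Function.update_self, Function.update_self, add_left_comm, add_comm (Pi.single _ _),
      add_left_comm w, add_comm (Pi.single _ _), ← hy', ← hw', perm hp,
      add_single_left hnot, add_single_right _ hmem, add_single_right _ hmem] at h1
    linarith

end monomerDimer

end MonomerDimer

section Padding

variable {L R : Type*} [DecidableEq R]

/-- The partition function `monomerDimer`, where moreover exactly `j` vertices of the left class
are left uncovered with weight `1` instead of their weight `y`. -/
def markedDimer (A : L → R → ℝ) (y : L → ℝ) (w : R → ℝ) : ℕ → List L → Finset R → ℝ
  | 0, [], B => ∏ x ∈ B, w x
  | _ + 1, [], _ => 0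
  | 0, u :: l, B =>
    y u * markedDimer A y w 0 l B + ∑ x ∈ B, A u x * markedDimer A y w 0 l (B.erase x)
  | j + 1, u :: l, B => markedDimer A y w j l B +
    (y u * markedDimer A y w (j + 1) l B + ∑ x ∈ B, A u x * markedDimer A y w (j + 1) l (B.erase x))

theorem monomerDimer_disjSum {X : Type*} [DecidableEq X] (A : L → R → ℝ) (y : L → ℝ) (w : R → ℝ)
    (l : List L) (B : Finset R) (S : Finset X) :
    monomerDimer (fun u => Sum.elim (A u) 1) y (Sum.elim w 0) l (B.disjSum S) =
      (S.card.factorial : ℝ) * markedDimer A y w S.card l B := by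
  have herase : ∀ (B : Finset R) (S : Finset X) (x : R),
      (B.disjSum S).erase (Sum.inl x) = (B.erase x).disjSum S := fun B S x => by
    ext (z | z) <;> simp
  have herase' : ∀ (B : Finset R) (S : Finset X) (x : X),
      (B.disjSum S).erase (Sum.inr x) = B.disjSum (S.erase x) := fun B S x => by
    ext (z | z) <;> simp
  induction l generalizing B S with
  | nil =>
    rcases hS : S.card with _ | j
    · rw [Finset.card_eq_zero] at hS
      simp [hS, monomerDimer, markedDimer]
    · have : S.card ≠ 0 := by omega
      simp [monomerDimer, markedDimer, Finset.prod_disjSum, this]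
  | cons u l ih =>
    simp only [monomerDimer, Finset.sum_disjSum, herase, herase', Sum.elim_inl, Sum.elim_inr, ih]
    rcases hS : S.card with _ | j
    · rw [Finset.card_eq_zero] at hS
      simp [hS, markedDimer]
    · have hsum : ∑ x ∈ S, (1 : X → ℝ) x * (((S.erase x).card.factorial : ℝ) *
          markedDimer A y w (S.erase x).card l B) =
          ∑ x ∈ S, (j.factorial : ℝ) * markedDimer A y w j l B :=
        Finset.sum_congr rfl fun x hx => by
          rw [Finset.card_erase_of_mem hx, hS, Nat.add_sub_cancel, Pi.one_apply, one_mul]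
      rw [hsum, Finset.sum_const, hS, markedDimer, Nat.factorial_succ]
      simp only [mul_left_comm _ ((Nat.factorial _ : ℕ) : ℝ), Finset.mul_sum, mul_add, nsmul_eq_mul]
      push_cast
      simp only [mul_left_comm _ ((j : ℝ) + 1), mul_assoc]
      ring_nf

open Polynomial in
theorem markedDimer_zero (y : L → ℝ) (w : R → ℝ) (j : ℕ) (l : List L) (B : Finset R) :
    markedDimer 0 y w j l B =
      (∏ x ∈ B, w x) * ((l.map fun u => X + C (y u)).prod).coeff j := by
  induction l generalizing j with
  | nil => rcases j with _ | j <;> simp [markedDimer, coeff_one]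
  | cons u l ih =>
    rcases j with _ | j
    · simp [markedDimer, ih, add_mul, mul_coeff_zero]
      ring
    · simp [markedDimer, ih, add_mul, coeff_X_mul]
      ring

end Padding

section Count

variable {L R : Type*} [DecidableEq L] [DecidableEq R]

/-- The matchings contained in `E` whose endpoints lie in `l` and `B`, and which leave exactly `j`
vertices of `l` uncovered. -/
def bipartiteMatchings (E : Finset (L × R)) (j : ℕ) (l : List L) (B : Finset R) :
    Finset (Finset (L × R)) :=
  E.powerset.filter fun M => M.card + j = l.length ∧
    (∀ e ∈ M, ∀ f ∈ M, e ≠ f → e.1 ≠ f.1 ∧ e.2 ≠ f.2) ∧ ∀ e ∈ M, e.1 ∈ l ∧ e.2 ∈ B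

theorem mem_bipartiteMatchings {E : Finset (L × R)} {j : ℕ} {l : List L} {B : Finset R}
    {M : Finset (L × R)} :
    M ∈ bipartiteMatchings E j l B ↔ M ⊆ E ∧ M.card + j = l.length ∧
      (∀ e ∈ M, ∀ f ∈ M, e ≠ f → e.1 ≠ f.1 ∧ e.2 ≠ f.2) ∧ ∀ e ∈ M, e.1 ∈ l ∧ e.2 ∈ B := by
  simp [bipartiteMatchings]

theorem card_bipartiteMatchings_uncovered (E : Finset (L × R)) (j : ℕ) {u : L} {l : List L}
    (hu : u ∉ l) (B : Finset R) :
    (bipartiteMatchings E j l B).card ≤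
      ((bipartiteMatchings E (j + 1) (u :: l) B).filter fun M => ¬ ∃ e ∈ M, e.1 = u).card := by
  refine Finset.card_le_card fun M hM => ?_
  rw [mem_bipartiteMatchings] at hM
  obtain ⟨h1, h2, h3, h4⟩ := hM
  refine Finset.mem_filter.2 ⟨mem_bipartiteMatchings.2 ⟨h1, ?_, h3, fun e he => ?_⟩, ?_⟩
  · simp only [List.length_cons]; omega
  · exact ⟨List.mem_cons_of_mem _ (h4 e he).1, (h4 e he).2⟩
  · rintro ⟨e, he, rfl⟩
    exact hu (h4 e he).1

theorem card_bipartiteMatchings_covered (E : Finset (L × R)) (j : ℕ) {u : L} {l : List L}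
    (hu : u ∉ l) (B : Finset R) :
    ∑ x ∈ B with (u, x) ∈ E, (bipartiteMatchings E j l (B.erase x)).card ≤
      ((bipartiteMatchings E j (u :: l) B).filter fun M => ∃ e ∈ M, e.1 = u).card := by
  have hnot : ∀ x z, ∀ M ∈ bipartiteMatchings E j l (B.erase x), (u, z) ∉ M := fun x z M hM h =>
    hu ((mem_bipartiteMatchings.1 hM).2.2.2 _ h).1
  have hinj : ∀ x, Set.InjOn (insert (u, x))
      (bipartiteMatchings E j l (B.erase x) : Set (Finset (L × R))) := fun x M hM M' hM' h => by
    rw [← Finset.erase_insert (hnot x x M hM), h, Finset.erase_insert (hnot x x M' hM')]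
  rw [Finset.sum_congr rfl fun x _ => (Finset.card_image_of_injOn (hinj x)).symm,
    ← Finset.card_biUnion]
  · refine Finset.card_le_card fun M' hM' => ?_
    simp only [Finset.mem_biUnion, Finset.mem_filter, Finset.mem_image] at hM'
    obtain ⟨x, ⟨hxB, hxE⟩, M, hM, rfl⟩ := hM'
    have hn := hnot x x M hM
    rw [mem_bipartiteMatchings] at hM
    obtain ⟨h1, h2, h3, h4⟩ := hM
    have hsep : ∀ e ∈ M, e.1 ≠ u ∧ e.2 ≠ x := fun e he =>
      ⟨fun h => hu (h ▸ (h4 e he).1), Finset.ne_of_mem_erase (h4 e he).2⟩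
    refine Finset.mem_filter.2 ⟨mem_bipartiteMatchings.2 ⟨?_, ?_, ?_, ?_⟩,
      (u, x), Finset.mem_insert_self _ _, rfl⟩
    · exact Finset.insert_subset hxE h1
    · rw [Finset.card_insert_of_notMem hn, List.length_cons]; omega
    · intro e he f hf hef
      rcases Finset.mem_insert.1 he with rfl | he <;> rcases Finset.mem_insert.1 hf with rfl | hf
      · exact absurd rfl hef
      · exact ⟨(hsep f hf).1.symm, (hsep f hf).2.symm⟩
      · exact hsep e he
      · exact h3 e he f hf hef
    · intro e he
      rcases Finset.mem_insert.1 he with rfl | he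
      · exact ⟨List.mem_cons_self, hxB⟩
      · exact ⟨List.mem_cons_of_mem _ (h4 e he).1, Finset.mem_of_mem_erase (h4 e he).2⟩
  · intro x _ z _ hxz
    rw [Function.onFun, Finset.disjoint_left]
    intro M hM hM'
    obtain ⟨M₁, h₁, rfl⟩ := Finset.mem_image.1 hM
    obtain ⟨M₂, h₂, h⟩ := Finset.mem_image.1 hM'
    have : (u, x) ∈ insert (u, z) M₂ := h ▸ Finset.mem_insert_self _ _
    rcases Finset.mem_insert.1 this with h | h
    · exact hxz (Prod.ext_iff.1 h).2
    · exact hnot z x M₂ h₂ h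

theorem markedDimer_le_card (E : Finset (L × R)) (j : ℕ) {l : List L} (hl : l.Nodup)
    (B : Finset R) :
    markedDimer (fun u x => if (u, x) ∈ E then 1 else 0) 0 1 j l B ≤
      ((bipartiteMatchings E j l B).card : ℝ) := by
  induction l generalizing j B with
  | nil =>
    rcases j with _ | j
    · have : ∅ ∈ bipartiteMatchings E 0 [] B := mem_bipartiteMatchings.2 (by simp)
      simpa [markedDimer] using Finset.card_pos.2 ⟨_, this⟩
    · simp [markedDimer]
  | cons u l ih =>
    rw [List.nodup_cons] at hl
    have hcov : ∀ j, ∑ x ∈ B, (if (u, x) ∈ E then (1 : ℝ) else 0) *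
        markedDimer (fun u x => if (u, x) ∈ E then 1 else 0) 0 1 j l (B.erase x) ≤
          (((bipartiteMatchings E j (u :: l) B).filter fun M => ∃ e ∈ M, e.1 = u).card : ℝ) := by
      intro j
      refine le_trans ?_ (Nat.cast_le.2 (card_bipartiteMatchings_covered E j hl.1 B))
      push_cast
      simp only [ite_mul, one_mul, zero_mul, ← Finset.sum_filter]
      exact Finset.sum_le_sum fun x _ => ih j hl.2 _
    rcases j with _ | j
    · rw [markedDimer, Pi.zero_apply, zero_mul, zero_add]
      exact (hcov 0).trans (Nat.cast_le.2 (Finset.card_filter_le _ _))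
    · rw [markedDimer, Pi.zero_apply, zero_mul, zero_add,
        ← Finset.card_filter_add_card_filter_not (fun M => ∃ e ∈ M, e.1 = u), Nat.cast_add, add_comm]
      exact add_le_add (hcov _) ((ih j hl.2 B).trans
        (Nat.cast_le.2 (card_bipartiteMatchings_uncovered E j hl.1 B)))

end Count

section MeanInequalities

theorem card_mul_prod_rpow_le_sum {ι : Type*} (s : Finset ι) {f : ι → ℝ} (hf : ∀ i ∈ s, 0 ≤ f i) :
    (s.card : ℝ) * ∏ i ∈ s, f i ^ ((1 : ℝ) / s.card) ≤ ∑ i ∈ s, f i := by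
  rcases s.eq_empty_or_nonempty with rfl | hs
  · simp
  have hcard : (0 : ℝ) < s.card := Nat.cast_pos.2 hs.card_pos
  have h := Real.geom_mean_le_arith_mean_weighted s (fun _ => (1 : ℝ) / s.card) f
    (fun _ _ => by positivity) (by rw [Finset.sum_const, nsmul_eq_mul]; field_simp) hf
  rw [← Finset.mul_sum, one_div, ← div_eq_inv_mul, le_div_iff₀ hcard] at h
  rw [one_div]
  linarith

/-- Maclaurin's inequality between the `k`-th elementary symmetric mean and the geometric mean. -/
theorem choose_mul_prod_rpow_le_sum_powersetCard {ι : Type*} [DecidableEq ι] (s : Finset ι)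
    {f : ι → ℝ} (hf : ∀ i ∈ s, 0 < f i) {k : ℕ} (hk : 1 ≤ k) (hks : k ≤ s.card) :
    (s.card.choose k : ℝ) * ∏ i ∈ s, f i ^ ((k : ℝ) / s.card) ≤
      ∑ t ∈ s.powersetCard k, ∏ i ∈ t, f i := by
  have hpos : (0 : ℝ) < s.card.choose k := Nat.cast_pos.2 (Nat.choose_pos hks)
  have h := card_mul_prod_rpow_le_sum (s.powersetCard k) (f := fun t => ∏ i ∈ t, f i)
    fun t ht => Finset.prod_nonneg fun i hi => (hf i ((Finset.mem_powersetCard.1 ht).1 hi)).le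
  rw [Finset.card_powersetCard] at h
  convert h using 2
  have hcard : (s.card : ℝ) ≠ 0 := by
    have : s.card ≠ 0 := by omega
    exact_mod_cast this
  have hchoose : (s.card : ℝ) * ((s.card - 1).choose (k - 1) : ℝ) = s.card.choose k * k := by
    have := Nat.add_one_mul_choose_eq (s.card - 1) (k - 1)
    rw [Nat.sub_add_cancel hk, Nat.sub_add_cancel (hk.trans hks)] at this
    exact_mod_cast this
  calc ∏ i ∈ s, f i ^ ((k : ℝ) / s.card)
      = ∏ i ∈ s, ∏ t ∈ (s.powersetCard k).filter (i ∈ ·),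
          f i ^ ((1 : ℝ) / s.card.choose k) := by
        refine Finset.prod_congr rfl fun i hi => ?_
        have hc := Finset.card_filter_powersetCard_subset {i} s k
          (Finset.singleton_subset_iff.2 hi) (by simpa using hk)
        simp only [Finset.singleton_subset_iff, Finset.card_singleton] at hc
        rw [Finset.prod_const, hc, ← Real.rpow_mul_natCast (hf i hi).le]
        congr 1
        field_simp
        linarith
    _ = ∏ t ∈ s.powersetCard k, ∏ i ∈ t, f i ^ ((1 : ℝ) / s.card.choose k) := by
        refine Finset.prod_comm' fun i t => ?_
        simp only [Finset.mem_filter, Finset.mem_powersetCard]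
        constructor
        · rintro ⟨_, ht, hit⟩
          exact ⟨hit, ht⟩
        · rintro ⟨hit, ht⟩
          exact ⟨ht.1 hit, ht, hit⟩
    _ = _ := by
        refine Finset.prod_congr rfl fun t ht => ?_
        exact Real.finsetProd_rpow _ _
          (fun i hi => (hf i ((Finset.mem_powersetCard.1 ht).1 hi)).le) _

theorem rpow_le_entropy_mul_one_add {p S : ℝ} (hp : 0 < p) (hp1 : p ≤ 1) (hS : 0 ≤ S) :
    S ^ p ≤ p ^ p * (1 - p) ^ (1 - p) * (1 + S) := by
  rcases hp1.eq_or_lt with rfl | hp1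
  · simp
  have hq : 0 < 1 - p := sub_pos.2 hp1
  have h := Real.geom_mean_le_arith_mean2_weighted hq.le hp.le
    (one_div_nonneg.2 hq.le) (div_nonneg hS hp.le) (by ring)
  rw [mul_one_div_cancel hq.ne', mul_div_cancel₀ _ hp.ne', Real.div_rpow zero_le_one hq.le,
    Real.one_rpow, Real.div_rpow hS hp.le, div_mul_div_comm, one_mul,
    div_le_iff₀ (by positivity)] at h
  linarith

theorem exp_mul_log_natCast {x : ℝ} {m : ℕ} (hx : 0 ≤ x) (h : x = 0 → m = 0) :
    Real.exp (m * Real.log x) = x ^ m := by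
  rcases hx.eq_or_lt with rfl | hx
  · simp [h rfl]
  · rw [mul_comm, Real.exp_mul, Real.exp_log hx, Real.rpow_natCast]

end MeanInequalities

section Bipartite

variable {L R : Type*}

theorem sum_single_fst_apply [DecidableEq L] (E : Finset (L × R)) (Y : L × R → ℝ) (u : L) :
    (∑ e ∈ E, (Pi.single e.1 (Y e) : L → ℝ)) u = ∑ e ∈ E with e.1 = u, Y e := by
  simp [Finset.sum_apply, Pi.single_apply, Finset.sum_filter, eq_comm]

theorem sum_single_snd_apply [DecidableEq R] (E : Finset (L × R)) (Z : L × R → ℝ) (x : R) :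
    (∑ e ∈ E, (Pi.single e.2 (Z e) : R → ℝ)) x = ∑ e ∈ E with e.2 = x, Z e := by
  simp [Finset.sum_apply, Pi.single_apply, Finset.sum_filter, eq_comm]

theorem row_bound [DecidableEq L] [Fintype L] {E : Finset (L × R)} {d n k : ℕ} (hd : 1 ≤ d)
    (hk1 : 1 ≤ k) (hkn : k ≤ n) (hL : Fintype.card L = n) (hrow : ∀ u, (E.filter fun e => e.1 = u).card = d)
    {Y : L × R → ℝ} (hY : ∀ e, 0 < Y e) :
    (n.choose k : ℝ) * (d : ℝ) ^ k * ∏ e ∈ E, Y e ^ ((k : ℝ) / n / d) ≤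
      ∑ t ∈ Finset.powersetCard k Finset.univ, ∏ u ∈ t, ∑ e ∈ E with e.1 = u, Y e := by
  have hd0 : (0 : ℝ) < d := Nat.cast_pos.2 hd
  have hn0 : (0 : ℝ) < n := Nat.cast_pos.2 (hk1.trans hkn)
  have hpos : ∀ u, 0 < (d : ℝ) * ∏ e ∈ E with e.1 = u, Y e ^ ((1 : ℝ) / d) := fun u =>
    mul_pos hd0 (Finset.prod_pos fun e _ => Real.rpow_pos_of_pos (hY e) _)
  have hle : ∀ u, (d : ℝ) * ∏ e ∈ E with e.1 = u, Y e ^ ((1 : ℝ) / d) ≤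
      ∑ e ∈ E with e.1 = u, Y e := fun u => by
    have := card_mul_prod_rpow_le_sum (E.filter fun e => e.1 = u) (fun e _ => (hY e).le)
    rwa [hrow u] at this
  refine le_trans ?_ ((choose_mul_prod_rpow_le_sum_powersetCard Finset.univ (fun u _ => hpos u)
    hk1 (by rwa [Finset.card_univ, hL])).trans (Finset.sum_le_sum fun t _ =>
      Finset.prod_le_prod (fun u _ => (hpos u).le) fun u _ => hle u))
  rw [Finset.card_univ, hL, mul_assoc]
  refine mul_le_mul_of_nonneg_left (le_of_eq ?_) (Nat.cast_nonneg _)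
  have h1 : ∀ u, ((d : ℝ) * ∏ e ∈ E with e.1 = u, Y e ^ ((1 : ℝ) / d)) ^ ((k : ℝ) / n) =
      (d : ℝ) ^ ((k : ℝ) / n) * ∏ e ∈ E with e.1 = u, Y e ^ ((k : ℝ) / n / d) := fun u => by
    rw [Real.mul_rpow hd0.le (Finset.prod_nonneg fun e _ => Real.rpow_nonneg (hY e).le _),
      ← Real.finsetProd_rpow _ _ fun e _ => Real.rpow_nonneg (hY e).le _]
    congr 1
    refine Finset.prod_congr rfl fun e _ => ?_
    rw [← Real.rpow_mul (hY e).le]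
    congr 1
    ring
  simp only [h1]
  rw [Finset.prod_mul_distrib, Finset.prod_const, Finset.card_univ, hL,
    ← Real.rpow_mul_natCast hd0.le, div_mul_cancel₀ _ hn0.ne', Real.rpow_natCast,
    Finset.prod_fiberwise]

theorem column_bound [DecidableEq R] [Fintype R] {E : Finset (L × R)} {d n k : ℕ} (hd : 1 ≤ d)
    (hk1 : 1 ≤ k) (hkn : k ≤ n) (hR : Fintype.card R = n) (hcol : ∀ x, (E.filter fun e => e.2 = x).card = d)
    {Z : L × R → ℝ} (hZ : ∀ e, 0 < Z e) :
    (d : ℝ) ^ k * ∏ e ∈ E, Z e ^ ((k : ℝ) / n / d) ≤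
      ((k : ℝ) / n) ^ k * (1 - (k : ℝ) / n) ^ (n - k) * ∏ x, (1 + ∑ e ∈ E with e.2 = x, Z e) := by
  have hd0 : (0 : ℝ) < d := Nat.cast_pos.2 hd
  have hk0 : (0 : ℝ) < k := Nat.cast_pos.2 hk1
  have hn0 : (0 : ℝ) < n := Nat.cast_pos.2 (hk1.trans hkn)
  set p : ℝ := (k : ℝ) / n with hp
  have hp0 : 0 < p := div_pos hk0 hn0
  have hp1 : p ≤ 1 := (div_le_one hn0).2 (Nat.cast_le.2 hkn)
  have hpn : p * n = k := div_mul_cancel₀ _ hn0.ne'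
  have hle : ∀ x, (d : ℝ) ^ p * ∏ e ∈ E with e.2 = x, Z e ^ (p / d) ≤
      p ^ p * (1 - p) ^ (1 - p) * (1 + ∑ e ∈ E with e.2 = x, Z e) := fun x => by
    have h1 := card_mul_prod_rpow_le_sum (E.filter fun e => e.2 = x) (fun e _ => (hZ e).le)
    rw [hcol x] at h1
    have hprod : 0 ≤ ∏ e ∈ E with e.2 = x, Z e ^ ((1 : ℝ) / d) :=
      Finset.prod_nonneg fun e _ => Real.rpow_nonneg (hZ e).le _
    refine le_trans (le_of_eq ?_) ((Real.rpow_le_rpow (by positivity) h1 hp0.le).trans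
      (rpow_le_entropy_mul_one_add hp0 hp1 (Finset.sum_nonneg fun e _ => (hZ e).le)))
    rw [Real.mul_rpow hd0.le hprod,
      ← Real.finsetProd_rpow _ _ fun e _ => Real.rpow_nonneg (hZ e).le _]
    congr 1
    refine Finset.prod_congr rfl fun e _ => ?_
    rw [← Real.rpow_mul (hZ e).le]
    congr 1
    ring
  have h := Finset.prod_le_prod (s := Finset.univ)
    (fun x _ => mul_nonneg (Real.rpow_nonneg hd0.le p)
      (Finset.prod_nonneg fun e _ => Real.rpow_nonneg (hZ e).le (p / d)))
    fun x _ => hle x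
  have hq : ((1 - p) ^ (1 - p)) ^ n = (1 - p) ^ (n - k) := by
    rw [← Real.rpow_mul_natCast (sub_nonneg.2 hp1), ← Real.rpow_natCast, Nat.cast_sub hkn]
    congr 1
    linarith
  simp only [Finset.prod_mul_distrib, Finset.prod_const, Finset.card_univ, hR,
    Finset.prod_fiberwise, hq] at h
  rwa [← Real.rpow_mul_natCast hd0.le, ← Real.rpow_mul_natCast hp0.le, hpn, Real.rpow_natCast,
    Real.rpow_natCast] at h

open Polynomial in
theorem coeff_prod_X_add_C_univ [Fintype L] (f : L → ℝ) {j k : ℕ}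
    (h : k + j = Fintype.card L) :
    (((Finset.univ : Finset L).toList.map fun u => X + C (f u)).prod).coeff j =
      ∑ t ∈ Finset.powersetCard k Finset.univ, ∏ u ∈ t, f u := by
  rw [← Multiset.prod_coe, ← Multiset.map_coe, Finset.coe_toList,
    Multiset.prod_X_add_C_coeff' _ _ (by rw [Finset.card_val, Finset.card_univ]; omega),
    Finset.esymm_map_val, Finset.card_val, Finset.card_univ, ← h, Nat.add_sub_cancel]

variable [DecidableEq L] [DecidableEq R] [Fintype L] [Fintype R]

theorem le_card_bipartiteMatchings {E : Finset (L × R)} {d n k : ℕ} (hd : 1 ≤ d) (hk1 : 1 ≤ k)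
    (hkn : k ≤ n) (hL : Fintype.card L = n) (hR : Fintype.card R = n)
    (hrow : ∀ u, (E.filter fun e => e.1 = u).card = d)
    (hcol : ∀ x, (E.filter fun e => e.2 = x).card = d) :
    (n.choose k : ℝ) * (d : ℝ) ^ k * (1 - (k : ℝ) / n / d) ^ (n * d - k) ≤
      (1 - (k : ℝ) / n) ^ (n - k) *
        ((bipartiteMatchings E (n - k) Finset.univ.toList Finset.univ).card : ℝ) := by
  have hd0 : (0 : ℝ) < d := Nat.cast_pos.2 hd
  have hk0 : (0 : ℝ) < k := Nat.cast_pos.2 hk1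
  have hn0 : (0 : ℝ) < n := Nat.cast_pos.2 (hk1.trans hkn)
  have hknd : k ≤ n * d := hkn.trans (Nat.le_mul_of_pos_right n hd)
  obtain ⟨j, hj⟩ : ∃ j, j = n - k := ⟨_, rfl⟩
  rw [← hj]
  obtain ⟨p, hp⟩ : ∃ p : ℝ, p = (k : ℝ) / n := ⟨_, rfl⟩
  obtain ⟨α, hα⟩ : ∃ α : ℝ, α = p / d := ⟨_, rfl⟩
  have hp0 : 0 < p := hp ▸ div_pos hk0 hn0
  have hα0 : 0 < α := hα ▸ div_pos hp0 hd0
  have hαnd : α * (n * d : ℕ) = k := by rw [hα, hp]; push_cast; field_simp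
  have hα1 : α ≤ 1 := by
    rw [hα, hp, div_div, div_le_one (by positivity)]
    exact_mod_cast hknd
  have hq0 : 0 < (1 - p) ^ j := by
    rcases hkn.eq_or_lt with rfl | hlt
    · simp [hj]
    · exact pow_pos (sub_pos.2 (hp ▸ (div_lt_one hn0).2 (Nat.cast_lt.2 hlt))) _
  let ι : L × R ↪ L × (R ⊕ Fin j) := ⟨fun e => (e.1, Sum.inl e.2), fun e f h => by
    simpa [Prod.ext_iff] using h⟩
  have hι : ∀ e, ι e = (e.1, Sum.inl e.2) := fun _ => rfl
  have huniv : (Finset.univ : Finset (R ⊕ Fin j)) = Finset.univ.disjSum Finset.univ := by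
    ext (x | x) <;> simp
  have hbase : ∀ Y Z : L × (R ⊕ Fin j) → ℝ, (∀ e, 0 < Y e) → (∀ e, 0 < Z e) →
      (j.factorial : ℝ) * (n.choose k * (d : ℝ) ^ k * (d : ℝ) ^ k / (p ^ k * (1 - p) ^ j)) *
          ∏ e ∈ E.map ι, (Y e * Z e) ^ α ≤
        monomerDimer (fun _ => Sum.elim (0 : R → ℝ) 1) (0 + ∑ e ∈ E.map ι, Pi.single e.1 (Y e))
          (Sum.elim (1 : R → ℝ) (0 : Fin j → ℝ) + ∑ e ∈ E.map ι, Pi.single e.2 (Z e)) Finset.univ.toList Finset.univ := by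
    intro Y Z hY hZ
    have hw : (Sum.elim (1 : R → ℝ) (0 : Fin j → ℝ) + ∑ e ∈ E.map ι, Pi.single e.2 (Z e) : R ⊕ Fin j → ℝ) =
        Sum.elim (1 + ∑ e ∈ E, Pi.single e.2 (Z (ι e))) (0 : Fin j → ℝ) := by
      ext (x | x) <;> simp [hι, Finset.sum_apply, Pi.single_apply]
    have hmd := monomerDimer_disjSum (0 : L → R → ℝ) (∑ e ∈ E, Pi.single e.1 (Y (ι e)))
      (1 + ∑ e ∈ E, Pi.single e.2 (Z (ι e))) Finset.univ.toList Finset.univ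
      (Finset.univ : Finset (Fin j))
    rw [hw, zero_add, Finset.sum_map, huniv]
    refine le_of_le_of_eq ?_ hmd.symm
    rw [Finset.card_univ, Fintype.card_fin, markedDimer_zero,
      coeff_prod_X_add_C_univ _ (k := k) (by omega), mul_assoc]
    refine mul_le_mul_of_nonneg_left ?_ (Nat.cast_nonneg _)
    simp only [Pi.add_apply, Pi.one_apply, sum_single_fst_apply, sum_single_snd_apply]
    have hr := row_bound hd hk1 hkn hL hrow (Y := Y ∘ ι) fun e => hY _
    have hc := column_bound hd hk1 hkn hR hcol (Z := Z ∘ ι) fun e => hZ _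
    rw [← hp, ← hα] at hr hc
    rw [← hj] at hc
    have hYp : 0 ≤ ∏ e ∈ E, (Y ∘ ι) e ^ α :=
      Finset.prod_nonneg fun e _ => Real.rpow_nonneg (hY _).le _
    have hw0 : 0 ≤ ∏ x, (1 + ∑ e ∈ E with e.2 = x, (Z ∘ ι) e) :=
      Finset.prod_nonneg fun x _ => add_nonneg zero_le_one (Finset.sum_nonneg fun e _ => (hZ _).le)
    have hmul := mul_le_mul hc hr (by positivity) (by positivity)
    rw [Finset.prod_map, Finset.prod_congr rfl fun e _ => Real.mul_rpow (hY _).le (hZ _).le,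
      Finset.prod_mul_distrib, div_mul_eq_mul_div, div_le_iff₀ (by positivity)]
    simp only [Function.comp_apply] at hmul
    linarith
  have hcap := monomerDimer.capacity_le (y := 0) (w := Sum.elim (1 : R → ℝ) (0 : Fin j → ℝ)) hα0 hα1 (Finset.nodup_toList Finset.univ)
    (fun u : L => Finset.mem_toList.2 (Finset.mem_univ u)) (by rintro _ (x | x) <;> simp) (fun _ => le_rfl)
    (by rintro (x | x) <;> simp) _ _ hbase
  have hA : ((fun _ => Sum.elim (0 : R → ℝ) 1) + ∑ e ∈ E.map ι, Pi.single e.1 (Pi.single e.2 1) :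
      L → R ⊕ Fin j → ℝ) = fun u => Sum.elim (fun x => if (u, x) ∈ E then 1 else 0) 1 := by
    have hsum : ∀ u x, ∑ e ∈ E, (Pi.single e.1 (Pi.single (Sum.inl e.2) 1) :
        L → R ⊕ Fin j → ℝ) u (Sum.inl x) = if (u, x) ∈ E then 1 else 0 := fun u x => by
      rw [← Finset.sum_ite_eq' E (u, x) fun _ => (1 : ℝ)]
      refine Finset.sum_congr rfl fun e _ => ?_
      by_cases h1 : u = e.1 <;> by_cases h2 : x = e.2 <;>
        simp [Prod.ext_iff, h1, h2, eq_comm]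
    ext u (x | x)
    · simp [hι, hsum]
    · rw [Pi.add_apply, Pi.add_apply, Finset.sum_apply, Finset.sum_apply, Finset.sum_map,
        Finset.sum_eq_zero]
      · simp
      · intro e _
        by_cases h1 : u = e.1 <;> simp [hι, h1]
  have hmd := monomerDimer_disjSum (fun u x => if (u, x) ∈ E then (1 : ℝ) else 0) 0 1
    (Finset.univ : Finset L).toList Finset.univ (Finset.univ : Finset (Fin j))
  have hcardE : E.card = n * d := by
    rw [Finset.card_eq_sum_card_fiberwise (f := Prod.fst) (t := Finset.univ)
      (fun _ _ => Finset.mem_coe.2 (Finset.mem_univ _)), Finset.sum_congr rfl fun u _ => hrow u]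
    simp [hL]
  have hent : (α ^ α * (1 - α) ^ (1 - α)) ^ (n * d) = α ^ k * (1 - α) ^ (n * d - k) := by
    rw [mul_pow, ← Real.rpow_mul_natCast hα0.le, hαnd, Real.rpow_natCast,
      ← Real.rpow_mul_natCast (sub_nonneg.2 hα1), sub_mul, one_mul, hαnd, ← Nat.cast_sub hknd,
      Real.rpow_natCast]
  rw [hA, huniv, hmd, Finset.card_univ, Fintype.card_fin, Finset.card_map, hcardE, hent,
    mul_assoc] at hcap
  have hle := (le_of_mul_le_mul_left hcap (Nat.cast_pos.2 j.factorial_pos)).trans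
    (markedDimer_le_card E j (Finset.nodup_toList _) Finset.univ)
  rw [← hp, ← hα, mul_comm ((1 - p) ^ j), ← div_le_iff₀ hq0]
  refine le_of_eq_of_le ?_ hle
  have hαd : (d : ℝ) ^ k * α ^ k = p ^ k := by
    rw [← mul_pow, hα, mul_div_cancel₀ _ hd0.ne']
  rw [eq_comm, div_mul_eq_mul_div, div_eq_div_iff (by positivity) hq0.ne']
  linear_combination
    (n.choose k * (d : ℝ) ^ k * (1 - α) ^ (n * d - k) * (1 - p) ^ j) * hαd

end Bipartite

section Regular

theorem card_bipartiteMatchings_le_matchCount {V : Type*} [Finite V] (G : SimpleGraph V)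
    {P : V → Prop} [DecidableEq {v // P v}] [DecidableEq {v // ¬ P v}] {n k : ℕ} (hkn : k ≤ n)
    {E : Finset ({v // P v} × {v // ¬ P v})} (hE : ∀ e ∈ E, G.Adj e.1 e.2)
    {l : List {v // P v}} (hl : l.length = n) (B : Finset {v // ¬ P v}) :
    (bipartiteMatchings E (n - k) l B).card ≤ matchCount G k := by
  classical
  let φ : {v // P v} × {v // ¬ P v} ↪ Sym2 V := ⟨fun e => s(e.1.1, e.2.1), by
    rintro ⟨⟨a, ha⟩, ⟨b, hb⟩⟩ ⟨⟨c, hc⟩, ⟨d, hd⟩⟩ h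
    rcases Sym2.eq_iff.1 h with ⟨h1, h2⟩ | ⟨h1, h2⟩
    · simp_all
    · have h3 : a = d := h1
      exact absurd (h3 ▸ ha) hd⟩
  have hφ : ∀ e v, v ∈ φ e ↔ v = e.1.1 ∨ v = e.2.1 := fun e v => Sym2.mem_iff
  have hmem : ∀ M ∈ bipartiteMatchings E (n - k) l B,
      ↑(M.map φ) ⊆ G.edgeSet ∧ (M.map φ).card = k ∧
        ∀ e ∈ M.map φ, ∀ f ∈ M.map φ, e ≠ f → ∀ v : V, v ∈ e → v ∉ f := by
    intro M hM
    obtain ⟨h1, h2, h3, -⟩ := mem_bipartiteMatchings.1 hM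
    refine ⟨fun s hs => ?_, ?_, ?_⟩
    · obtain ⟨e, he, rfl⟩ := Finset.mem_map.1 (Finset.mem_coe.1 hs)
      exact hE e (h1 he)
    · rw [Finset.card_map]; omega
    · intro s hs t ht hst v hvs hvt
      obtain ⟨e, he, rfl⟩ := Finset.mem_map.1 hs
      obtain ⟨f, hf, rfl⟩ := Finset.mem_map.1 ht
      obtain ⟨hn1, hn2⟩ := h3 e he f hf fun h => hst (h ▸ rfl)
      rcases (hφ e v).1 hvs with rfl | rfl <;> rcases (hφ f _).1 hvt with h | h
      · exact hn1 (Subtype.ext h)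
      · exact f.2.2 (h ▸ e.1.2)
      · exact e.2.2 (h ▸ f.1.2)
      · exact hn2 (Subtype.ext h)
  rw [matchCount, ← Nat.card_eq_finsetCard]
  refine Nat.card_le_card_of_injective (fun M => ⟨M.1.map φ, hmem M.1 M.2⟩) fun M M' h => ?_
  exact Subtype.ext (Finset.map_injective φ (Subtype.ext_iff.1 h))

theorem exp_two_mul_Gammad {d n k : ℕ} (hd : 1 ≤ d) (hk1 : 1 ≤ k) (hkn : k ≤ n) :
    Real.exp (2 * n * Gammad d ((k : ℝ) / n)) =
      (d / ((k : ℝ) / n)) ^ k * (1 - (k : ℝ) / n / d) ^ (n * d - k) /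
        ((1 - (k : ℝ) / n) ^ (n - k)) ^ 2 := by
  have hd0 : (0 : ℝ) < d := Nat.cast_pos.2 hd
  have hk0 : (0 : ℝ) < k := Nat.cast_pos.2 hk1
  have hn0 : (0 : ℝ) < n := Nat.cast_pos.2 (hk1.trans hkn)
  have hknd : k ≤ n * d := hkn.trans (Nat.le_mul_of_pos_right n hd)
  obtain ⟨p, hp⟩ : ∃ p : ℝ, p = (k : ℝ) / n := ⟨_, rfl⟩
  have hp0 : 0 < p := hp ▸ div_pos hk0 hn0
  have hpn : p * n = k := by rw [hp, div_mul_cancel₀ _ hn0.ne']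
  have hp1 : p ≤ 1 := hp ▸ (div_le_one hn0).2 (Nat.cast_le.2 hkn)
  have hα1 : p / d ≤ 1 := (div_le_one hd0).2 (hp1.trans (Nat.one_le_cast.2 hd))
  rw [← hp]
  have h1 : Real.exp (k * Real.log (d / p)) = (d / p) ^ k :=
    exp_mul_log_natCast (by positivity) fun h => absurd h (by positivity)
  have h2 : Real.exp ((n * d - k : ℕ) * Real.log (1 - p / d)) = (1 - p / d) ^ (n * d - k) :=
    exp_mul_log_natCast (sub_nonneg.2 hα1) fun h => by
      have h3 : p = d := by field_simp at h; linarith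
      rw [h3] at hpn
      have : d * n = k := by exact_mod_cast hpn
      rw [← this, mul_comm, Nat.sub_self]
  have h3 : Real.exp ((n - k : ℕ) * Real.log (1 - p)) = (1 - p) ^ (n - k) :=
    exp_mul_log_natCast (sub_nonneg.2 hp1) fun h => by
      have h4 : p = 1 := by linarith
      rw [h4, one_mul] at hpn
      have : n = k := by exact_mod_cast hpn
      rw [this, Nat.sub_self]
  rw [← h1, ← h2, ← h3, ← Real.exp_nat_mul, ← Real.exp_add, ← Real.exp_sub]
  congr 1
  rw [Gammad, Nat.cast_sub hkn, Nat.cast_sub hknd]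
  push_cast
  rw [← hpn]
  ring

end Regular

/-- Strengthened lower matching bound: `m_k(G) ≥ p_μ · exp(2n·Γ_d(p))` for a `d`-regular
bipartite simple graph on `2n` vertices. -/
theorem lower_matching_strengthened {V : Type*} [Fintype V] (d n : ℕ) (hd : 1 ≤ d)
    (hn : 1 ≤ n) (G : SimpleGraph V) [DecidableRel G.Adj]
    (hcard : Fintype.card V = 2 * n)
    (hreg : G.IsRegularOfDegree d) (hbip : G.Colorable 2)
    (k : ℕ) (hk1 : 1 ≤ k) (hkn : k ≤ n) (p pμ : ℝ) (hp : p = (k : ℝ) / n)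
    (hpμ : pμ = (n.choose k : ℝ) * p ^ k * (1 - p) ^ (n - k)) :
    pμ * Real.exp (2 * n * Gammad d p) ≤ (matchCount G k : ℝ) := by
  classical
  obtain ⟨c⟩ := hbip
  let L := {v // c v = 0}
  let R := {v // ¬ c v = 0}
  let E : Finset (L × R) := Finset.univ.filter fun e => G.Adj e.1 e.2
  have hE : ∀ e ∈ E, G.Adj e.1 e.2 := fun e he => (Finset.mem_filter.1 he).2
  have hfin : ∀ a b : Fin 2, ¬ a = 0 → b ≠ a → b = 0 := by decide
  have hrow : ∀ u, (E.filter fun e => e.1 = u).card = d := fun u => by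
    rw [← hreg u.1, ← SimpleGraph.card_neighborFinset_eq_degree]
    refine Finset.card_bij (fun e _ => e.2.1) ?_ ?_ ?_
    · rintro e he
      obtain ⟨hf, rfl⟩ := Finset.mem_filter.1 he
      exact (G.mem_neighborFinset _ _).2 (hE e hf)
    · intro e he f hf h
      exact Prod.ext ((Finset.mem_filter.1 he).2.trans (Finset.mem_filter.1 hf).2.symm)
        (Subtype.ext h)
    · intro v hv
      rw [SimpleGraph.mem_neighborFinset] at hv
      have hcv : ¬ c v = 0 := fun h => c.valid hv (u.2.trans h.symm)
      exact ⟨(u, ⟨v, hcv⟩), by simpa [E] using hv, rfl⟩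
  have hcol : ∀ x, (E.filter fun e => e.2 = x).card = d := fun x => by
    rw [← hreg x.1, ← SimpleGraph.card_neighborFinset_eq_degree]
    refine Finset.card_bij (fun e _ => e.1.1) ?_ ?_ ?_
    · rintro e he
      obtain ⟨hf, rfl⟩ := Finset.mem_filter.1 he
      exact (G.mem_neighborFinset _ _).2 (hE e hf).symm
    · intro e he f hf h
      exact Prod.ext (Subtype.ext h)
        ((Finset.mem_filter.1 he).2.trans (Finset.mem_filter.1 hf).2.symm)
    · intro v hv
      rw [SimpleGraph.mem_neighborFinset] at hv
      have hcv : c v = 0 := hfin _ _ x.2 (c.valid hv).symm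
      exact ⟨(⟨v, hcv⟩, x), by simpa [E] using hv.symm, rfl⟩
  have h1 : E.card = Fintype.card L * d := by
    rw [Finset.card_eq_sum_card_fiberwise (f := Prod.fst) (t := Finset.univ)
      (fun _ _ => Finset.mem_coe.2 (Finset.mem_univ _)), Finset.sum_congr rfl fun u _ => hrow u]
    simp
  have h2 : E.card = Fintype.card R * d := by
    rw [Finset.card_eq_sum_card_fiberwise (f := Prod.snd) (t := Finset.univ)
      (fun _ _ => Finset.mem_coe.2 (Finset.mem_univ _)), Finset.sum_congr rfl fun x _ => hcol x]
    simp
  have hLR : Fintype.card L = Fintype.card R := Nat.eq_of_mul_eq_mul_right hd (h1.symm.trans h2)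
  have hsum : Fintype.card L + Fintype.card R = 2 * n := by
    rw [← hcard, ← Fintype.card_sum]
    exact Fintype.card_congr (Equiv.sumCompl fun v => c v = 0)
  have hL : Fintype.card L = n := by omega
  have hR : Fintype.card R = n := by omega
  have hmain := le_card_bipartiteMatchings hd hk1 hkn hL hR hrow hcol
  have hcount := card_bipartiteMatchings_le_matchCount G hkn hE
    (l := Finset.univ.toList) (by rw [Finset.length_toList, Finset.card_univ, hL]) Finset.univ
  have hn0 : (0 : ℝ) < n := Nat.cast_pos.2 hn
  have hp0 : 0 < p := hp ▸ div_pos (Nat.cast_pos.2 hk1) hn0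
  have hq0 : 0 < (1 - p) ^ (n - k) := by
    rcases hkn.eq_or_lt with rfl | hlt
    · simp
    · exact pow_pos (sub_pos.2 (hp ▸ (div_lt_one hn0).2 (Nat.cast_lt.2 hlt))) _
  rw [← hp] at hmain
  refine le_trans ?_ (Nat.cast_le.2 hcount)
  rw [hp, exp_two_mul_Gammad hd hk1 hkn, ← hp, hpμ, div_pow, mul_div_assoc',
    div_le_iff₀ (by positivity)]
  calc _ = (1 - p) ^ (n - k) * ((n.choose k : ℝ) * (d : ℝ) ^ k * (1 - p / d) ^ (n * d - k)) := by
        field_simp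
    _ ≤ _ := mul_le_mul_of_nonneg_left hmain hq0.le
    _ = _ := by ring
end
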